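/- Let N ≥ 1, let q ≥ p ≥ 1 with pq > 1, let 0 < γ₁ ≤ γ₂ < 1, and let the nonlinearities be f(v) = ε₁|v|^{p-1}v, g(u) = ε₂|u|^{q-1}u or f(v) = ε₁|v|^p, g(u) = ε₂|u|^q with ε₁, ε₂ ∈ {−1, 1}. Assume N/2 ≥ ((γ₂ − γ₁)pq + qγ₂ + γ₁)/(γ₁(pq − 1)). Then there exists ε₀ > 0 such that: for every δ with max{1 − (pq−1)/(γ₂q(p+1)), 1 − γ₁(pq−1)/(γ₂(p+1)), 1 − (pq−1)/(q+1)} < δ < min{1, N(pq−1)/(2q(p+1))}, setting 1/s₁ = (2δ/N)(p+1)/(pq−1) and 1/s₂ = (2δ/N)(q+1)/(pq−1) (so that s₁ > q and s₂ > p), whenever u₀, v₀ ∈ C₀(ℝᴺ) ∩ L¹(ℝᴺ) satisfy ‖u₀‖₁ + ‖u₀‖_∞ + ‖v₀‖₁ + ‖v₀‖_∞ ≤ ε₀, there exists a global mild solution (u, v) on [0, ∞) with u ∈ L^∞([0,∞), L^∞(ℝᴺ)) ∩ L^∞([0,∞), L^{s₁}(ℝᴺ)), v ∈ L^∞([0,∞),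 L^∞(ℝᴺ)) ∩ L^∞([0,∞), L^{s₂}(ℝᴺ)), and there is a constant C > 0 such that ‖u(t)‖_{s₁} ≤ C(1+t)^{−(1−δ)(γ₁+pγ₂)/(pq−1)} and ‖v(t)‖_{s₂} ≤ C(1+t)^{−(1−δ)(γ₂+qγ₁)/(pq−1)} for all t ≥ 0. -/

import Mathlib

open MeasureTheory Filter Topology

noncomputable section

abbrev Euc (N : ℕ) := EuclideanSpace ℝ (Fin N)

/-- Wright type function `φ_α(z) = Σ_{k} (−z)^k/(k! Γ(−αk + 1 − α))`. -/
def wrightFn (α z : ℝ) : ℝ :=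
  ∑' k : ℕ, (-z) ^ k / ((k.factorial : ℝ) * Real.Gamma (-α * (k : ℝ) + 1 - α))

/-- Heat kernel `G(t,x) = (4πt)^{−N/2} exp(−|x|²/(4t))` on `ℝᴺ`. -/
def heatKernel (N : ℕ) (t : ℝ) (x : Euc N) : ℝ :=
  (4 * Real.pi * t) ^ (-(N : ℝ) / 2) * Real.exp (-‖x‖ ^ 2 / (4 * t))

/-- Heat semigroup `T(t)` acting by convolution with the heat kernel. -/
def heatOp (N : ℕ) (t : ℝ) (w : Euc N → ℝ) (x : Euc N) : ℝ :=
  ∫ y, heatKernel N t (x - y) * w y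

/-- `(P_α(t)w)(x) = ∫_0^∞ φ_α(θ) (T(t^α θ)w)(x) dθ`. -/
def Pop (N : ℕ) (α t : ℝ) (w : Euc N → ℝ) (x : Euc N) : ℝ :=
  ∫ θ in Set.Ioi (0 : ℝ), wrightFn α θ * heatOp N (t ^ α * θ) w x

/-- `(S_α(t)w)(x) = α ∫_0^∞ θ φ_α(θ) (T(t^α θ)w)(x) dθ`. -/
def Sop (N : ℕ) (α t : ℝ) (w : Euc N → ℝ) (x : Euc N) : ℝ :=
  α * ∫ θ in Set.Ioi (0 : ℝ), θ * wrightFn α θ * heatOp N (t ^ α * θ) w x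

/-- Mild solution of the coupled system `ᶜD^{γ₁}u − Δu = f(v)`, `ᶜD^{γ₂}v − Δv = g(u)`
with data `(u₀, v₀)`, on the time set `s`: a pair of continuous curves into `C₀(ℝᴺ)`
satisfying the Duhamel integral equations. -/
def IsMildSolution (N : ℕ) (γ₁ γ₂ : ℝ) (f g : ℝ → ℝ)
    (u₀ v₀ : ZeroAtInftyContinuousMap (Euc N) ℝ) (s : Set ℝ)
    (u v : ℝ → ZeroAtInftyContinuousMap (Euc N) ℝ) : Prop :=
  ContinuousOn u s ∧ ContinuousOn v s ∧ u 0 = u₀ ∧ v 0 = v₀ ∧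
  ∀ t ∈ s, 0 < t → ∀ x : Euc N,
    (u t x = Pop N γ₁ t (⇑u₀) x +
      ∫ τ in (0:ℝ)..t, (t - τ) ^ (γ₁ - 1) * Sop N γ₁ (t - τ) (fun y => f (v τ y)) x) ∧
    (v t x = Pop N γ₂ t (⇑v₀) x +
      ∫ τ in (0:ℝ)..t, (t - τ) ^ (γ₂ - 1) * Sop N γ₂ (t - τ) (fun y => g (u τ y)) x)

lemma norm_cexp_neg_ray (ρ ψ t : ℝ) :
    ‖Complex.exp (-(ρ * Complex.exp (Complex.I * ψ) * t))‖ =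
      Real.exp (-(ρ * Real.cos ψ) * t) := by
  rw [Complex.norm_exp]
  congr 1
  have : Complex.exp (Complex.I * ψ) = Real.cos ψ + Real.sin ψ * Complex.I := by
    rw [mul_comm, Complex.exp_mul_I]; simp
  rw [this]
  simp [-Complex.ofReal_cos, -Complex.ofReal_sin]

lemma norm_cexp_I_mul_mul (a b : ℝ) : ‖Complex.exp (Complex.I * a * b)‖ = 1 := by
  rw [Complex.norm_exp]; simp

lemma norm_cexp_I_mul (a : ℝ) : ‖Complex.exp (Complex.I * a)‖ = 1 := by
  rw [Complex.norm_exp]; simp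

lemma integrableOn_rpow_mul_exp_neg_mul {s b : ℝ} (hs : -1 < s) (hb : 0 < b) :
    IntegrableOn (fun t : ℝ => t ^ s * Real.exp (-b * t)) (Set.Ioi 0) := by
  simpa using integrableOn_rpow_mul_exp_neg_mul_rpow hs one_pos hb

lemma aesm_rpow_mul_cexp (s : ℝ) (c d : ℂ) :
    AEStronglyMeasurable (fun t : ℝ => c * ((t ^ s : ℝ) : ℂ) * Complex.exp (-(d * t)))
      (volume.restrict (Set.Ioi 0)) := by
  refine ContinuousOn.aestronglyMeasurable ?_ measurableSet_Ioi
  refine ContinuousOn.mul (continuousOn_const.mul ?_) (by fun_prop)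
  exact Complex.continuous_ofReal.comp_continuousOn
    (fun t ht => (Real.continuousAt_rpow_const t s (Or.inl (ne_of_gt ht))).continuousWithinAt)

lemma hasDerivAt_ray_integral {w ρ ψ₀ : ℝ} (hw : 0 < w) (hρ : 0 < ρ)
    (hψ : ψ₀ ∈ Set.Ioo (-(Real.pi / 2)) (Real.pi / 2)) :
    HasDerivAt (fun ψ : ℝ => ∫ t in Set.Ioi (0:ℝ), Complex.exp (Complex.I * ψ * w) *
      ((t ^ (w - 1) : ℝ) : ℂ) * Complex.exp (-(ρ * Complex.exp (Complex.I * ψ) * t))) 0 ψ₀ := by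
  set F : ℝ → ℝ → ℂ := fun ψ t => Complex.exp (Complex.I * ψ * w) *
      ((t ^ (w - 1) : ℝ) : ℂ) * Complex.exp (-(ρ * Complex.exp (Complex.I * ψ) * t)) with hF
  set F' : ℝ → ℝ → ℂ := fun ψ t => Complex.I * (Complex.exp (Complex.I * ψ * w) *
      ((w * t ^ (w - 1) : ℝ) : ℂ) * Complex.exp (-(ρ * Complex.exp (Complex.I * ψ) * t)) +
      Complex.exp (Complex.I * ψ * w) * ((t ^ w : ℝ) : ℂ) *
        (Complex.exp (-(ρ * Complex.exp (Complex.I * ψ) * t)) *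
          (-(ρ * Complex.exp (Complex.I * ψ))))) with hF'
  have hc0 : 0 < Real.cos ψ₀ := Real.cos_pos_of_mem_Ioo hψ
  set c := Real.cos ψ₀ / 2 with hc
  have hcpos : 0 < c := by positivity
  have hs : {ψ : ℝ | c < Real.cos ψ} ∈ 𝓝 ψ₀ :=
    (isOpen_lt continuous_const Real.continuous_cos).mem_nhds (by simp [hc]; linarith)
  have hexp : ∀ ψ ∈ {ψ : ℝ | c < Real.cos ψ}, ∀ t : ℝ, 0 < t →
      ‖Complex.exp (-(ρ * Complex.exp (Complex.I * ψ) * t))‖ ≤ Real.exp (-(ρ * c) * t) := by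
    intro ψ hψ t ht
    rw [norm_cexp_neg_ray]
    apply Real.exp_le_exp.2
    have : ρ * c ≤ ρ * Real.cos ψ := by gcongr; exact le_of_lt hψ
    nlinarith
  have hb1 : IntegrableOn (fun t : ℝ => t ^ (w - 1) * Real.exp (-(ρ * c) * t)) (Set.Ioi 0) :=
    integrableOn_rpow_mul_exp_neg_mul (by linarith) (by positivity)
  have hb2 : IntegrableOn (fun t : ℝ => t ^ w * Real.exp (-(ρ * c) * t)) (Set.Ioi 0) :=
    integrableOn_rpow_mul_exp_neg_mul (by linarith) (by positivity)
  have hmeas : ∀ ψ : ℝ, AEStronglyMeasurable (F ψ) (volume.restrict (Set.Ioi 0)) :=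
    fun ψ => aesm_rpow_mul_cexp _ _ _
  have hFint : IntegrableOn (F ψ₀) (Set.Ioi 0) := by
    refine hb1.mono' (hmeas _) ?_
    refine ae_restrict_of_forall_mem measurableSet_Ioi fun t ht => ?_
    simp only [hF, norm_mul, norm_cexp_I_mul_mul, one_mul, Complex.norm_real, Real.norm_eq_abs]
    rw [abs_of_nonneg (Real.rpow_nonneg (le_of_lt ht) _)]
    exact mul_le_mul_of_nonneg_left (hexp _ (mem_of_mem_nhds hs) t ht)
      (Real.rpow_nonneg (le_of_lt ht) _)
  have hF'meas : AEStronglyMeasurable (F' ψ₀) (volume.restrict (Set.Ioi 0)) := by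
    have h1 := aesm_rpow_mul_cexp (w - 1) (w * Complex.exp (Complex.I * ψ₀ * w))
      (ρ * Complex.exp (Complex.I * ψ₀))
    have h2 := aesm_rpow_mul_cexp w (-(ρ * Complex.exp (Complex.I * ψ₀)) *
      Complex.exp (Complex.I * ψ₀ * w)) (ρ * Complex.exp (Complex.I * ψ₀))
    refine ((h1.add h2).const_mul Complex.I).congr (Eventually.of_forall fun t => ?_)
    simp only [hF', Pi.add_apply]
    push_cast
    ring
  have key := hasDerivAt_integral_of_dominated_loc_of_deriv_le (μ := volume.restrict (Set.Ioi 0))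
    (F := F) (F' := F') (x₀ := ψ₀) (bound := fun t => w * (t ^ (w - 1) * Real.exp (-(ρ * c) * t)) +
      ρ * (t ^ w * Real.exp (-(ρ * c) * t))) hs (Eventually.of_forall hmeas) hFint hF'meas ?_
    ((hb1.const_mul w).add (hb2.const_mul ρ)) ?_
  · have hkey := key.2
    set G : ℝ → ℂ := fun t => Complex.I * (Complex.exp (Complex.I * ψ₀ * w) * ((t ^ w : ℝ) : ℂ) *
      Complex.exp (-(ρ * Complex.exp (Complex.I * ψ₀) * t))) with hG
    have hGc : Continuous G := by
      have : Continuous fun t : ℝ => t ^ w := Real.continuous_rpow_const hw.le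
      fun_prop
    have hGd : ∀ t ∈ Set.Ioi (0:ℝ), HasDerivAt G (F' ψ₀ t) t := by
      intro t ht
      have h1 : HasDerivAt (fun t : ℝ => t ^ w) (w * t ^ (w - 1)) t :=
        Real.hasDerivAt_rpow_const (Or.inl (ne_of_gt ht))
      have h2 : HasDerivAt (fun t : ℝ => Complex.exp (-(ρ * Complex.exp (Complex.I * ψ₀) * t)))
          (Complex.exp (-(ρ * Complex.exp (Complex.I * ψ₀) * t)) *
          (-(ρ * Complex.exp (Complex.I * ψ₀)))) t := by
        have h3 : HasDerivAt (fun t : ℝ => (t : ℂ)) 1 t := by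
          exact Complex.ofRealCLM.hasDerivAt
        have h4 := ((h3.const_mul (ρ * Complex.exp (Complex.I * ψ₀))).fun_neg).cexp
        rwa [mul_one] at h4
      exact ((h1.ofReal_comp.const_mul _).mul h2).const_mul _
    have hlim : Tendsto G atTop (𝓝 0) := by
      rw [tendsto_zero_iff_norm_tendsto_zero]
      have := tendsto_rpow_mul_exp_neg_mul_atTop_nhds_zero w (ρ * Real.cos ψ₀) (by positivity)
      refine this.congr' ?_
      filter_upwards [eventually_gt_atTop 0] with t ht
      simp only [hG, norm_mul, norm_cexp_I_mul_mul, one_mul, Complex.norm_real, Real.norm_eq_abs,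
        Complex.norm_I, norm_cexp_neg_ray]
      rw [abs_of_nonneg (Real.rpow_nonneg (le_of_lt ht) _)]
    rw [integral_Ioi_of_hasDerivAt_of_tendsto hGc.continuousWithinAt hGd key.1 hlim] at hkey
    simpa [hG, Real.zero_rpow hw.ne'] using hkey
  · refine ae_restrict_of_forall_mem measurableSet_Ioi fun t ht ψ hψ => ?_
    have ht' : 0 < t := ht
    have e := hexp ψ hψ t ht
    simp only [hF', norm_mul, Complex.norm_I, one_mul]
    refine (norm_add_le _ _).trans ?_
    simp only [norm_mul, norm_neg, norm_cexp_I_mul_mul, norm_cexp_I_mul, one_mul, Complex.norm_real,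
      Real.norm_eq_abs, mul_one, abs_of_pos hw, abs_of_pos hρ,
      abs_of_nonneg (Real.rpow_nonneg ht'.le _)]
    have h1 : 0 ≤ t ^ (w - 1) := Real.rpow_nonneg ht'.le _
    have h2 : 0 ≤ t ^ w := Real.rpow_nonneg ht'.le _
    calc _ ≤ w * t ^ (w - 1) * Real.exp (-(ρ * c) * t) + t ^ w * (Real.exp (-(ρ * c) * t) * ρ) := by
          gcongr
      _ = _ := by ring
  · refine ae_restrict_of_forall_mem measurableSet_Ioi fun t ht ψ hψ => ?_
    have ht' : 0 < t := ht
    have h3 : HasDerivAt (fun ψ : ℝ => Complex.I * (ψ : ℂ)) Complex.I ψ := by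
      simpa using (Complex.ofRealCLM.hasDerivAt (x := ψ)).const_mul Complex.I
    have h4 := (h3.mul_const (w : ℂ)).cexp
    have h5 := ((((h3.cexp).const_mul (ρ : ℂ)).mul_const (t : ℂ)).fun_neg).cexp
    have h6 := (h4.mul_const ((t ^ (w - 1) : ℝ) : ℂ)).mul h5
    refine h6.congr_deriv ?_
    have h7 : ((t ^ w : ℝ) : ℂ) = ((t ^ (w - 1) : ℝ) : ℂ) * t := by
      rw [← Complex.ofReal_mul, Real.rpow_sub_one ht'.ne', div_mul_cancel₀ _ ht'.ne']
    simp only [hF', h7]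
    push_cast
    ring

lemma integral_ray_rpow_mul_cexp {w ρ ψ : ℝ} (hw : 0 < w) (hρ : 0 < ρ)
    (hψ : ψ ∈ Set.Ioo (-(Real.pi / 2)) (Real.pi / 2)) :
    ∫ t in Set.Ioi (0:ℝ), ((t ^ (w - 1) : ℝ) : ℂ) *
      Complex.exp (-(ρ * Complex.exp (Complex.I * ψ) * t)) =
      Complex.exp (-(Complex.I * ψ * w)) * ((ρ ^ (-w) * Real.Gamma w : ℝ) : ℂ) := by
  have hconst := (isOpen_Ioo (a := -(Real.pi / 2)) (b := Real.pi / 2)).is_const_of_deriv_eq_zero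
    (f := fun ψ : ℝ => ∫ t in Set.Ioi (0:ℝ), Complex.exp (Complex.I * ψ * w) *
      ((t ^ (w - 1) : ℝ) : ℂ) * Complex.exp (-(ρ * Complex.exp (Complex.I * ψ) * t)))
    isPreconnected_Ioo
    (fun ψ hψ => (hasDerivAt_ray_integral hw hρ hψ).differentiableAt.differentiableWithinAt)
    (fun ψ hψ => (hasDerivAt_ray_integral hw hρ hψ).deriv) hψ
    (show (0:ℝ) ∈ Set.Ioo (-(Real.pi / 2)) (Real.pi / 2) from
      ⟨by linarith [Real.pi_pos], by linarith [Real.pi_pos]⟩)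
  have h0 : ∫ t in Set.Ioi (0:ℝ), Complex.exp (Complex.I * (0:ℝ) * w) *
      ((t ^ (w - 1) : ℝ) : ℂ) * Complex.exp (-(ρ * Complex.exp (Complex.I * (0:ℝ)) * t)) =
      ((ρ ^ (-w) * Real.Gamma w : ℝ) : ℂ) := by
    have := Real.integral_rpow_mul_exp_neg_mul_Ioi hw hρ
    rw [one_div, Real.inv_rpow hρ.le, ← Real.rpow_neg hρ.le] at this
    rw [← this, ← integral_complex_ofReal]
    refine setIntegral_congr_fun measurableSet_Ioi fun t _ => ?_
    simp
  rw [h0] at hconst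
  have h1 : ∫ t in Set.Ioi (0:ℝ), Complex.exp (Complex.I * ψ * w) *
      ((t ^ (w - 1) : ℝ) : ℂ) * Complex.exp (-(ρ * Complex.exp (Complex.I * ψ) * t)) =
      Complex.exp (Complex.I * ψ * w) * ∫ t in Set.Ioi (0:ℝ), ((t ^ (w - 1) : ℝ) : ℂ) *
      Complex.exp (-(ρ * Complex.exp (Complex.I * ψ) * t)) := by
    rw [← integral_const_mul]
    simp only [mul_assoc]
  rw [h1] at hconst
  rw [← hconst, ← mul_assoc, ← Complex.exp_add]
  simp

/-- Admissible angles for the ray representation of the Wright function. -/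
structure WrightAngle (α ψ : ℝ) : Prop where
  pos : 0 < α
  lt_one : α < 1
  neg_lt : -(Real.pi / 2) < ψ
  lt_zero : ψ < 0
  mul_lt : (ψ + Real.pi) * α < Real.pi / 2

lemma exists_wrightAngle {α : ℝ} (h0 : 0 < α) (h1 : α < 1) : ∃ ψ, WrightAngle α ψ := by
  have hpi := Real.pi_pos
  refine ⟨-(Real.pi / 2) + (1 - α) * Real.pi / 2, h0, h1, by nlinarith, by nlinarith, ?_⟩
  nlinarith [mul_pos h0 hpi, mul_pos (mul_pos (sub_pos.2 h1) (sub_pos.2 h1)) hpi]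

lemma WrightAngle.cos_pos {α ψ : ℝ} (h : WrightAngle α ψ) : 0 < Real.cos ψ :=
  Real.cos_pos_of_mem_Ioo ⟨h.neg_lt, h.lt_zero.trans (by positivity)⟩

lemma WrightAngle.cos_mul_pos {α ψ : ℝ} (h : WrightAngle α ψ) :
    0 < Real.cos ((ψ + Real.pi) * α) := by
  refine Real.cos_pos_of_mem_Ioo ⟨?_, h.mul_lt⟩
  have : 0 < (ψ + Real.pi) * α := mul_pos (by linarith [h.neg_lt, Real.pi_pos]) h.pos
  linarith [Real.pi_pos]

/-- Integrand of the ray representation of the Wright function. -/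
def wrightIntegrand (α ψ z t : ℝ) : ℂ :=
  Complex.exp (Complex.I * ((ψ + Real.pi) * α : ℝ)) * ((t ^ (α - 1) : ℝ) : ℂ) *
    Complex.exp (-((1:ℝ) * Complex.exp (Complex.I * ψ) * t)) *
    Complex.exp (-(z * Complex.exp (Complex.I * ((ψ + Real.pi) * α : ℝ)) * ((t ^ α : ℝ) : ℂ)))

lemma norm_wrightIntegrand (α ψ z : ℝ) {t : ℝ} (ht : 0 < t) :
    ‖wrightIntegrand α ψ z t‖ = t ^ (α - 1) * Real.exp (-Real.cos ψ * t) *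
      Real.exp (-(z * Real.cos ((ψ + Real.pi) * α)) * t ^ α) := by
  unfold wrightIntegrand
  rw [norm_mul, norm_mul, norm_mul, norm_cexp_I_mul, norm_cexp_neg_ray, norm_cexp_neg_ray,
    Complex.norm_real, Real.norm_of_nonneg (Real.rpow_nonneg ht.le _)]
  simp

lemma exists_rpow_le_mul_add {α c : ℝ} (h0 : 0 < α) (h1 : α < 1) (hc : 0 < c) :
    ∃ K, ∀ t : ℝ, 0 < t → t ^ α ≤ c * t + K := by
  set M := c ^ (-(1 / (1 - α))) with hM
  have hMpos : 0 < M := Real.rpow_pos_of_pos hc _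
  refine ⟨M ^ α, fun t ht => ?_⟩
  rcases le_total t M with h | h
  · have := Real.rpow_le_rpow ht.le h h0.le
    nlinarith [mul_pos hc ht]
  · have h2 : t ^ (α - 1) ≤ M ^ (α - 1) :=
      Real.rpow_le_rpow_of_nonpos hMpos h (by linarith)
    have h3 : M ^ (α - 1) = c := by
      rw [hM, ← Real.rpow_mul hc.le]
      have : -(1 / (1 - α)) * (α - 1) = 1 := by
        have : 1 - α ≠ 0 := by linarith
        field_simp
        ring
      rw [this, Real.rpow_one]
    rw [h3, Real.rpow_sub_one ht.ne', div_le_iff₀ ht] at h2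
    linarith [Real.rpow_nonneg hMpos.le α]

lemma integrableOn_wright_majorant {α c : ℝ} (z : ℝ) (h0 : 0 < α) (h1 : α < 1) (hc : 0 < c) :
    IntegrableOn (fun t : ℝ => t ^ (α - 1) * Real.exp (-c * t) * Real.exp (|z| * t ^ α))
      (Set.Ioi 0) := by
  obtain ⟨K, hK⟩ := exists_rpow_le_mul_add h0 h1 (show 0 < c / (2 * (|z| + 1)) by positivity)
  have hb := (integrableOn_rpow_mul_exp_neg_mul (s := α - 1) (b := c / 2) (by linarith)
    (by positivity)).const_mul (Real.exp (|z| * K))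
  refine hb.mono' ?_ ?_
  · refine ContinuousOn.aestronglyMeasurable ?_ measurableSet_Ioi
    have h : ∀ s : ℝ, ContinuousOn (fun t : ℝ => t ^ s) (Set.Ioi 0) := fun s t ht =>
      (Real.continuousAt_rpow_const t s (Or.inl (ne_of_gt ht))).continuousWithinAt
    exact ((h _).mul (by fun_prop)).mul (((h _).const_mul _).rexp)
  · refine ae_restrict_of_forall_mem measurableSet_Ioi fun t ht => ?_
    have ht' : 0 < t := ht
    have h3 : 0 ≤ t ^ (α - 1) := Real.rpow_nonneg ht'.le _
    rw [Real.norm_of_nonneg (by positivity), mul_assoc, ← Real.exp_add, mul_left_comm,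
      ← Real.exp_add]
    refine mul_le_mul_of_nonneg_left (Real.exp_le_exp.2 ?_) h3
    have h4 := mul_le_mul_of_nonneg_left (hK t ht') (abs_nonneg z)
    have h5 : |z| * (c / (2 * (|z| + 1)) * t) ≤ c / 2 * t := by
      rw [← mul_assoc]
      gcongr
      rw [mul_div_assoc', div_le_div_iff₀ (by positivity) (by positivity)]
      nlinarith [abs_nonneg z]
    linarith

lemma continuousOn_ofReal_rpow (s : ℝ) :
    ContinuousOn (fun t : ℝ => ((t ^ s : ℝ) : ℂ)) (Set.Ioi 0) :=
  Complex.continuous_ofReal.comp_continuousOn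
    (fun t ht => (Real.continuousAt_rpow_const t s (Or.inl (ne_of_gt ht))).continuousWithinAt)

lemma aesm_wrightIntegrand (α ψ z : ℝ) :
    AEStronglyMeasurable (wrightIntegrand α ψ z) (volume.restrict (Set.Ioi 0)) := by
  refine ContinuousOn.aestronglyMeasurable ?_ measurableSet_Ioi
  unfold wrightIntegrand
  refine ((continuousOn_const.mul (continuousOn_ofReal_rpow _)).mul (by fun_prop)).mul ?_
  exact ((continuousOn_const.mul (continuousOn_ofReal_rpow _)).neg).cexp

/-- Ray integral representation of the Wright function. -/
lemma wrightFn_eq_integral {α ψ : ℝ} (h : WrightAngle α ψ) (z : ℝ) :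
    wrightFn α z = (1 / Real.pi) * (∫ t in Set.Ioi (0:ℝ), wrightIntegrand α ψ z t).im := by
  have hα := h.pos
  set χ : ℝ := (ψ + Real.pi) * α with hχ
  set w : ℕ → ℝ := fun k => α * (k + 1) with hw
  have hwpos : ∀ k, 0 < w k := fun k => by positivity
  set F : ℕ → ℝ → ℂ := fun k t => ((-z) ^ k / (k.factorial : ℝ) : ℝ) *
    Complex.exp (Complex.I * χ) ^ (k + 1) * (((t ^ (w k - 1) : ℝ) : ℂ) *
    Complex.exp (-((1:ℝ) * Complex.exp (Complex.I * ψ) * t))) with hF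
  have hpow : ∀ t : ℝ, 0 < t → ∀ k, t ^ (w k - 1) = t ^ (α - 1) * (t ^ α) ^ k := by
    intro t ht k
    rw [← Real.rpow_mul_natCast ht.le, ← Real.rpow_add ht]
    congr 1
    simp only [hw]; ring
  have hsum : HasSum (fun k => ∫ t in Set.Ioi (0:ℝ), F k t)
      (∫ t in Set.Ioi (0:ℝ), wrightIntegrand α ψ z t) := by
    refine hasSum_integral_of_dominated_convergence
      (fun k t => t ^ (α - 1) * Real.exp (-Real.cos ψ * t) * ((|z| * t ^ α) ^ k / k.factorial))
      (fun k => ?_) (fun k => ?_) ?_ ?_ ?_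
    · refine ContinuousOn.aestronglyMeasurable ?_ measurableSet_Ioi
      exact continuousOn_const.mul ((continuousOn_ofReal_rpow _).mul (by fun_prop))
    · refine ae_restrict_of_forall_mem measurableSet_Ioi fun t ht => ?_
      have ht' : 0 < t := ht
      simp only [hF, norm_mul, norm_pow, norm_cexp_I_mul, norm_cexp_neg_ray, one_pow, mul_one,
        Complex.norm_real, norm_div, norm_neg, Real.norm_eq_abs, Nat.abs_cast, one_mul]
      rw [abs_of_nonneg (Real.rpow_nonneg ht'.le _), hpow t ht', mul_pow]
      apply le_of_eq; ring
    · refine ae_restrict_of_forall_mem measurableSet_Ioi fun t ht => ?_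
      exact (Real.summable_pow_div_factorial _).mul_left _
    · have := integrableOn_wright_majorant z h.pos h.lt_one h.cos_pos
      refine this.congr_fun (fun t ht => ?_) measurableSet_Ioi
      simp only
      rw [tsum_mul_left, Real.exp_eq_exp_ℝ, NormedSpace.exp_eq_tsum_div]
    · refine ae_restrict_of_forall_mem measurableSet_Ioi fun t ht => ?_
      have ht' : 0 < t := ht
      have hexp := NormedSpace.expSeries_div_hasSum_exp
        (-(z * Complex.exp (Complex.I * χ) * ((t ^ α : ℝ) : ℂ)))
      have := hexp.mul_left (Complex.exp (Complex.I * χ) * ((t ^ (α - 1) : ℝ) : ℂ) *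
        Complex.exp (-((1:ℝ) * Complex.exp (Complex.I * ψ) * t)))
      rw [← Complex.exp_eq_exp_ℂ] at this
      refine this.congr_fun (fun k => ?_)
      simp only [hF, hpow t ht' k]
      push_cast
      rw [neg_pow, neg_pow (_ * _), mul_pow, mul_pow]
      ring
  have hval : ∀ k, (∫ t in Set.Ioi (0:ℝ), F k t).im =
      Real.pi * ((-z) ^ k / ((k.factorial : ℝ) * Real.Gamma (-α * (k : ℝ) + 1 - α))) := by
    intro k
    simp only [hF]
    rw [integral_const_mul, integral_ray_rpow_mul_cexp (hwpos k) one_pos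
      ⟨h.neg_lt, h.lt_zero.trans (by positivity)⟩]
    have e1 : Complex.exp (Complex.I * χ) ^ (k + 1) * (Complex.exp (-(Complex.I * ψ * (w k : ℝ))) *
        (((1:ℝ) ^ (-w k) * Real.Gamma (w k) : ℝ) : ℂ)) =
        Complex.exp ((Real.pi * w k : ℝ) * Complex.I) * ((Real.Gamma (w k) : ℝ) : ℂ) := by
      rw [← mul_assoc, ← Complex.exp_nat_mul, ← Complex.exp_add, Real.one_rpow, one_mul]
      congr 2
      simp only [hχ, hw]
      push_cast
      ring
    rw [mul_assoc, e1, Complex.im_ofReal_mul, Complex.im_mul_ofReal, Complex.exp_ofReal_mul_I_im]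
    have hG := Real.Gamma_mul_Gamma_one_sub (w k)
    have e2 : -α * (k : ℝ) + 1 - α = 1 - w k := by simp only [hw]; ring
    rw [e2]
    have hGp : Real.Gamma (w k) ≠ 0 := (Real.Gamma_pos_of_pos (hwpos k)).ne'
    have hf : (k.factorial : ℝ) ≠ 0 := by positivity
    by_cases hs : Real.sin (Real.pi * w k) = 0
    · rw [hs, div_zero] at hG
      have : Real.Gamma (1 - w k) = 0 := by
        rcases mul_eq_zero.1 hG with h | h
        · exact absurd h hGp
        · exact h
      rw [hs, this]; simp
    · have hG1 : Real.Gamma (1 - w k) ≠ 0 := by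
        intro h0
        rw [h0, mul_zero] at hG
        exact (div_ne_zero Real.pi_pos.ne' hs) hG.symm
      have : Real.sin (Real.pi * w k) * Real.Gamma (w k) = Real.pi / Real.Gamma (1 - w k) := by
        field_simp
        rw [eq_div_iff hs] at hG
        linarith
      rw [this]
      field_simp
  have him := Complex.hasSum_im hsum
  simp only [hval] at him
  rw [← him.tsum_eq, tsum_mul_left, ← mul_assoc, one_div, inv_mul_cancel₀ Real.pi_pos.ne', one_mul]
  rfl

section

variable {α ψ : ℝ}

lemma norm_wrightIntegrand_le (h : WrightAngle α ψ) {z t : ℝ} (hz : 0 ≤ z) (ht : 0 < t) :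
    ‖wrightIntegrand α ψ z t‖ ≤ t ^ (α - 1) * Real.exp (-Real.cos ψ * t) := by
  rw [norm_wrightIntegrand _ _ _ ht]
  refine mul_le_of_le_one_right
    (mul_nonneg (Real.rpow_nonneg ht.le _) (Real.exp_nonneg _)) (Real.exp_le_one_iff.2 ?_)
  have := mul_nonneg (mul_nonneg hz h.cos_mul_pos.le) (Real.rpow_nonneg ht.le α)
  linarith

lemma continuousOn_wrightFn (h : WrightAngle α ψ) : ContinuousOn (wrightFn α) (Set.Ici 0) := by
  have : ContinuousOn (fun z => ∫ t in Set.Ioi (0:ℝ), wrightIntegrand α ψ z t) (Set.Ici 0) := by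
    refine continuousOn_of_dominated (bound := fun t => t ^ (α - 1) * Real.exp (-Real.cos ψ * t))
      (fun z _ => aesm_wrightIntegrand _ _ _) (fun z hz => ?_)
      (integrableOn_rpow_mul_exp_neg_mul (by linarith [h.pos]) h.cos_pos) ?_
    · exact ae_restrict_of_forall_mem measurableSet_Ioi fun t ht =>
        norm_wrightIntegrand_le h hz ht
    · refine Eventually.of_forall fun t => ?_
      unfold wrightIntegrand
      fun_prop
  refine (continuousOn_const.mul (Complex.continuous_im.comp_continuousOn this)).congr
    fun z _ => wrightFn_eq_integral h z

lemma abs_wrightFn_le_norm (h : WrightAngle α ψ) (z : ℝ) :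
    |wrightFn α z| ≤ |(∫ t in Set.Ioi (0:ℝ), wrightIntegrand α ψ z t).im| := by
  rw [wrightFn_eq_integral h, abs_mul]
  refine mul_le_of_le_one_left (abs_nonneg _) ?_
  rw [abs_of_pos (by positivity), div_le_one Real.pi_pos]
  linarith [Real.pi_gt_three]

lemma exists_abs_wrightFn_le (h : WrightAngle α ψ) :
    ∃ C, ∀ z, 0 ≤ z → |wrightFn α z| ≤ C := by
  refine ⟨∫ t in Set.Ioi (0:ℝ), t ^ (α - 1) * Real.exp (-Real.cos ψ * t), fun z hz => ?_⟩
  refine (abs_wrightFn_le_norm h z).trans ((Complex.abs_im_le_norm _).trans ?_)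
  refine norm_integral_le_of_norm_le
    (integrableOn_rpow_mul_exp_neg_mul (by linarith [h.pos]) h.cos_pos) ?_
  exact ae_restrict_of_forall_mem measurableSet_Ioi fun t ht => norm_wrightIntegrand_le h hz ht

lemma norm_cexp_sub_one_le {w : ℂ} (hw : w.re ≤ 0) : ‖Complex.exp w - 1‖ ≤ 2 * ‖w‖ := by
  rcases le_total ‖w‖ 1 with h | h
  · exact Complex.norm_exp_sub_one_le h
  · have : ‖Complex.exp w‖ ≤ 1 := by
      rw [Complex.norm_exp]; exact Real.exp_le_one_iff.2 hw
    calc _ ≤ ‖Complex.exp w‖ + ‖(1:ℂ)‖ := norm_sub_le _ _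
      _ ≤ 2 * ‖w‖ := by rw [norm_one]; linarith

/-- The model integrand obtained by dropping the exponential factor `exp (-e^{iψ} t)`. -/
def wrightModel (α ψ z t : ℝ) : ℂ :=
  Complex.exp (Complex.I * ((ψ + Real.pi) * α : ℝ)) * ((t ^ (α - 1) : ℝ) : ℂ) *
    Complex.exp (-(z * Complex.exp (Complex.I * ((ψ + Real.pi) * α : ℝ)) * ((t ^ α : ℝ) : ℂ)))

lemma norm_wrightModel (α ψ z : ℝ) {t : ℝ} (ht : 0 < t) :
    ‖wrightModel α ψ z t‖ = t ^ (α - 1) *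
      Real.exp (-(z * Real.cos ((ψ + Real.pi) * α)) * t ^ α) := by
  unfold wrightModel
  rw [norm_mul, norm_mul, norm_cexp_I_mul, norm_cexp_neg_ray,
    Complex.norm_real, Real.norm_of_nonneg (Real.rpow_nonneg ht.le _), one_mul]

lemma integrableOn_wrightModel (h : WrightAngle α ψ) {z : ℝ} (hz : 0 < z) :
    IntegrableOn (wrightModel α ψ z) (Set.Ioi 0) := by
  have hb := integrableOn_rpow_mul_exp_neg_mul_rpow (s := α - 1) (p := α)
    (b := z * Real.cos ((ψ + Real.pi) * α)) (by linarith [h.pos]) h.pos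
    (mul_pos hz h.cos_mul_pos)
  refine hb.mono' ?_ (ae_restrict_of_forall_mem measurableSet_Ioi fun t ht =>
    (norm_wrightModel _ _ _ ht).le)
  refine ContinuousOn.aestronglyMeasurable ?_ measurableSet_Ioi
  exact (continuousOn_const.mul (continuousOn_ofReal_rpow _)).mul
    ((continuousOn_const.mul (continuousOn_ofReal_rpow _)).neg).cexp

lemma integral_wrightModel (h : WrightAngle α ψ) {z : ℝ} (hz : 0 < z) :
    ∫ t in Set.Ioi (0:ℝ), wrightModel α ψ z t = ((1 / (α * z) : ℝ) : ℂ) := by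
  have hα := h.pos
  set A := Complex.exp (Complex.I * ((ψ + Real.pi) * α : ℝ)) with hA
  set G : ℝ → ℂ := fun t => ((-(1 / (α * z)) : ℝ) : ℂ) *
    Complex.exp (-(z * A * ((t ^ α : ℝ) : ℂ))) with hG
  have hGc : Continuous G := by
    have : Continuous fun t : ℝ => t ^ α := Real.continuous_rpow_const h.pos.le
    fun_prop
  have hGd : ∀ t ∈ Set.Ioi (0:ℝ), HasDerivAt G (wrightModel α ψ z t) t := by
    intro t ht
    have h1 : HasDerivAt (fun t : ℝ => t ^ α) (α * t ^ (α - 1)) t :=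
      Real.hasDerivAt_rpow_const (Or.inl (ne_of_gt ht))
    have h2 := (((h1.ofReal_comp.const_mul (z * A)).fun_neg).cexp).const_mul
      ((-(1 / (α * z)) : ℝ) : ℂ)
    refine h2.congr_deriv ?_
    unfold wrightModel
    rw [← hA]
    have : (α : ℂ) ≠ 0 := by exact_mod_cast hα.ne'
    have : (z : ℂ) ≠ 0 := by exact_mod_cast hz.ne'
    push_cast
    field_simp
  have hlim : Tendsto G atTop (𝓝 0) := by
    rw [tendsto_zero_iff_norm_tendsto_zero]
    have hc := mul_pos hz h.cos_mul_pos
    have h1 : Tendsto (fun t : ℝ => -(z * Real.cos ((ψ + Real.pi) * α)) * t ^ α) atTop atBot := by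
      simpa using (tendsto_rpow_atTop h.pos).const_mul_atTop_of_neg (neg_neg_of_pos hc)
    have h2 := (Real.tendsto_exp_atBot.comp h1).const_mul (1 / (α * z))
    rw [mul_zero] at h2
    refine h2.congr fun t => ?_
    simp only [hG, hA, norm_mul, norm_cexp_neg_ray, Complex.norm_real, Function.comp]
    rw [norm_neg, Real.norm_of_nonneg (by positivity)]
  rw [integral_Ioi_of_hasDerivAt_of_tendsto hGc.continuousWithinAt hGd
    (integrableOn_wrightModel h hz) hlim]
  simp [hG, Real.zero_rpow h.pos.ne']

lemma exists_abs_wrightFn_le_rpow (h : WrightAngle α ψ) :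
    ∃ C, ∀ z, 0 < z → |wrightFn α z| ≤ C * z ^ (-(1 + 1 / α)) := by
  have hα := h.pos
  set c := Real.cos ((ψ + Real.pi) * α) with hc
  have hcp : 0 < c := h.cos_mul_pos
  refine ⟨2 * (c ^ (-(α + 1) / α) * (1 / α) * Real.Gamma ((α + 1) / α)), fun z hz => ?_⟩
  have hJ : IntegrableOn (wrightIntegrand α ψ z) (Set.Ioi 0) :=
    (integrableOn_rpow_mul_exp_neg_mul (s := α - 1) (by linarith [h.pos]) h.cos_pos).mono'
      (aesm_wrightIntegrand _ _ _) (ae_restrict_of_forall_mem measurableSet_Ioi fun t ht =>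
        norm_wrightIntegrand_le h hz.le ht)
  have hM := integrableOn_wrightModel h hz
  have him : (∫ t in Set.Ioi (0:ℝ), wrightIntegrand α ψ z t).im =
      (∫ t in Set.Ioi (0:ℝ), (wrightIntegrand α ψ z t - wrightModel α ψ z t)).im := by
    rw [integral_sub hJ hM, integral_wrightModel h hz, Complex.sub_im, Complex.ofReal_im, sub_zero]
  refine (abs_wrightFn_le_norm h z).trans ?_
  rw [him]
  refine (Complex.abs_im_le_norm _).trans ?_
  have hint := integral_rpow_mul_exp_neg_mul_rpow (p := α) (q := α) (b := z * c) hα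
    (by linarith) (by positivity)
  have e1 : 2 * (c ^ (-(α + 1) / α) * (1 / α) * Real.Gamma ((α + 1) / α)) * z ^ (-(1 + 1 / α)) =
      ∫ t in Set.Ioi (0:ℝ), 2 * (t ^ α * Real.exp (-(z * c) * t ^ α)) := by
    rw [integral_const_mul, hint, Real.mul_rpow hz.le hcp.le]
    have : -(1 + 1 / α) = -(α + 1) / α := by field_simp
    rw [this]; ring
  rw [e1]
  refine norm_integral_le_of_norm_le
    ((integrableOn_rpow_mul_exp_neg_mul_rpow (by linarith) hα (by positivity)).const_mul 2) ?_
  refine ae_restrict_of_forall_mem measurableSet_Ioi fun t ht => ?_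
  have ht' : 0 < t := ht
  have e2 : wrightIntegrand α ψ z t - wrightModel α ψ z t =
      wrightModel α ψ z t * (Complex.exp (-((1:ℝ) * Complex.exp (Complex.I * ψ) * t)) - 1) := by
    unfold wrightIntegrand wrightModel; ring
  have e3 : (-((1:ℝ) * Complex.exp (Complex.I * ψ) * t) : ℂ).re ≤ 0 := by
    have h1 := norm_cexp_neg_ray 1 ψ t
    rw [Complex.norm_exp, Real.exp_eq_exp] at h1
    rw [h1]
    have := mul_pos h.cos_pos ht'
    linarith
  have e4 := norm_cexp_sub_one_le e3
  rw [norm_neg, norm_mul, norm_mul, norm_cexp_I_mul, Complex.norm_real, Complex.norm_real,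
    norm_one, Real.norm_of_nonneg ht'.le, one_mul, one_mul] at e4
  rw [e2, norm_mul, norm_wrightModel _ _ _ ht']
  have hn : 0 ≤ t ^ (α - 1) * Real.exp (-(z * c) * t ^ α) :=
    mul_nonneg (Real.rpow_nonneg ht'.le _) (Real.exp_nonneg _)
  refine (mul_le_mul_of_nonneg_left e4 hn).trans (le_of_eq ?_)
  rw [Real.rpow_sub_one ht'.ne']
  field_simp

/-- Integrability of `θ^y φ_α(θ)` on the half line. -/
lemma integrableOn_rpow_mul_wrightFn (h0 : 0 < α) (h1 : α < 1) {y : ℝ} (hy : -1 < y)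
    (hy1 : y ≤ 1) : IntegrableOn (fun θ => θ ^ y * wrightFn α θ) (Set.Ioi 0) := by
  obtain ⟨ψ, h⟩ := exists_wrightAngle h0 h1
  obtain ⟨C, hC⟩ := exists_abs_wrightFn_le h
  obtain ⟨C', hC'⟩ := exists_abs_wrightFn_le_rpow h
  have hcont : ContinuousOn (fun θ => θ ^ y * wrightFn α θ) (Set.Ioi 0) := by
    refine ContinuousOn.mul (fun t ht =>
      (Real.continuousAt_rpow_const t y (Or.inl (ne_of_gt ht))).continuousWithinAt)
      ((continuousOn_wrightFn h).mono Set.Ioi_subset_Ici_self)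
  rw [← Set.Ioc_union_Ioi_eq_Ioi (zero_le_one : (0:ℝ) ≤ 1)]
  refine IntegrableOn.union ?_ ?_
  · have hb : IntegrableOn (fun θ : ℝ => C * θ ^ y) (Set.Ioc 0 1) :=
      ((intervalIntegral.intervalIntegrable_rpow' hy).1).const_mul C
    refine hb.mono' ((hcont.mono Set.Ioc_subset_Ioi_self).aestronglyMeasurable measurableSet_Ioc) ?_
    refine ae_restrict_of_forall_mem measurableSet_Ioc fun t ht => ?_
    rw [norm_mul, Real.norm_of_nonneg (Real.rpow_nonneg ht.1.le _), mul_comm]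
    exact mul_le_mul_of_nonneg_right (hC t ht.1.le) (Real.rpow_nonneg ht.1.le _)
  · have hlt : y + -(1 + 1 / α) < -1 := by
      have : 1 < 1 / α := by rw [lt_div_iff₀ h0]; linarith
      linarith
    have hb : IntegrableOn (fun θ : ℝ => C' * θ ^ (y + -(1 + 1 / α))) (Set.Ioi 1) :=
      (integrableOn_Ioi_rpow_of_lt hlt one_pos).const_mul C'
    refine hb.mono' ((hcont.mono (Set.Ioi_subset_Ioi zero_le_one)).aestronglyMeasurable
      measurableSet_Ioi) ?_
    refine ae_restrict_of_forall_mem measurableSet_Ioi fun t ht => ?_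
    have ht0 : 0 < t := lt_trans one_pos ht
    rw [norm_mul, Real.norm_of_nonneg (Real.rpow_nonneg ht0.le _), Real.rpow_add ht0,
      mul_left_comm]
    exact mul_le_mul_of_nonneg_left (hC' t ht0) (Real.rpow_nonneg ht0.le _)

end

lemma integral_rpow_mul_wrightIntegrand {α ψ : ℝ} (h : WrightAngle α ψ) {r t : ℝ} (hr : -1 < r)
    (ht : 0 < t) :
    ∫ z in Set.Ioi (0:ℝ), ((z ^ r : ℝ) : ℂ) * wrightIntegrand α ψ z t =
      (Complex.exp (-(Complex.I * ((ψ + Real.pi) * α : ℝ) * r)) * (Real.Gamma (r + 1) : ℝ)) *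
        (((t ^ (-(α * r) - 1) : ℝ) : ℂ) *
          Complex.exp (-((1:ℝ) * Complex.exp (Complex.I * ψ) * t))) := by
  have hα := h.pos
  set χ : ℝ := (ψ + Real.pi) * α with hχ
  have hχ1 : χ ∈ Set.Ioo (-(Real.pi / 2)) (Real.pi / 2) := by
    have : 0 < χ := mul_pos (by linarith [h.neg_lt, Real.pi_pos]) hα
    exact ⟨by linarith [Real.pi_pos], h.mul_lt⟩
  have hray := integral_ray_rpow_mul_cexp (w := r + 1) (ρ := t ^ α) (by linarith)
    (Real.rpow_pos_of_pos ht α) hχ1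
  rw [add_sub_cancel_right] at hray
  have : ∀ z : ℝ, ((z ^ r : ℝ) : ℂ) * wrightIntegrand α ψ z t =
      (Complex.exp (Complex.I * χ) * ((t ^ (α - 1) : ℝ) : ℂ) *
        Complex.exp (-((1:ℝ) * Complex.exp (Complex.I * ψ) * t))) *
      (((z ^ r : ℝ) : ℂ) *
        Complex.exp (-(((t ^ α : ℝ) : ℂ) * Complex.exp (Complex.I * χ) * z))) := by
    intro z
    unfold wrightIntegrand
    rw [← hχ]
    have : -(((t ^ α : ℝ) : ℂ) * Complex.exp (Complex.I * χ) * z) =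
      -(z * Complex.exp (Complex.I * χ) * ((t ^ α : ℝ) : ℂ)) := by ring
    rw [this]; ring
  simp only [this]
  rw [integral_const_mul, hray]
  have e1 : t ^ (-(α * r) - 1) = t ^ (α - 1) * (t ^ α) ^ (-(r + 1)) := by
    rw [← Real.rpow_mul ht.le, ← Real.rpow_add ht]; congr 1; ring
  have e2 : Complex.exp (-(Complex.I * χ * r)) =
      Complex.exp (Complex.I * χ) * Complex.exp (-(Complex.I * χ * ((r + 1 : ℝ) : ℂ))) := by
    rw [← Complex.exp_add]; congr 1; push_cast; ring
  rw [e1, e2]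
  push_cast
  ring

lemma integrable_prod_wrightIntegrand {α ψ : ℝ} (h : WrightAngle α ψ) {r : ℝ} (hr : -1 < r)
    (hr0 : r < 0) :
    Integrable (fun x : ℝ × ℝ => ((x.1 ^ r : ℝ) : ℂ) * wrightIntegrand α ψ x.1 x.2)
      ((volume.restrict (Set.Ioi 0)).prod (volume.restrict (Set.Ioi 0))) := by
  have hα := h.pos
  have hc := h.cos_mul_pos
  set c := Real.cos ((ψ + Real.pi) * α) with hcdef
  have hmeas : AEStronglyMeasurable
      (fun x : ℝ × ℝ => ((x.1 ^ r : ℝ) : ℂ) * wrightIntegrand α ψ x.1 x.2)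
      ((volume.restrict (Set.Ioi 0)).prod (volume.restrict (Set.Ioi 0))) := by
    refine Measurable.aestronglyMeasurable ?_
    unfold wrightIntegrand
    fun_prop
  have hnorm : ∀ t : ℝ, 0 < t → ∀ z : ℝ, 0 < z →
      ‖((z ^ r : ℝ) : ℂ) * wrightIntegrand α ψ z t‖ = (t ^ (α - 1) * Real.exp (-Real.cos ψ * t)) *
        (z ^ (r + 1 - 1) * Real.exp (-(c * t ^ α * z))) := by
    intro t ht z hz
    rw [norm_mul, norm_wrightIntegrand _ _ _ ht, Complex.norm_real,
      Real.norm_of_nonneg (Real.rpow_nonneg hz.le _), add_sub_cancel_right]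
    have : -(z * Real.cos ((ψ + Real.pi) * α)) * t ^ α = -(c * t ^ α * z) := by rw [hcdef]; ring
    rw [this]; ring
  rw [integrable_prod_iff' hmeas]
  constructor
  · refine ae_restrict_of_forall_mem measurableSet_Ioi fun t ht => ?_
    have ht' : 0 < t := ht
    have hb := (integrableOn_rpow_mul_exp_neg_mul (s := r) (b := c * t ^ α) hr
      (mul_pos hc (Real.rpow_pos_of_pos ht' _))).const_mul
      (t ^ (α - 1) * Real.exp (-Real.cos ψ * t))
    refine hb.mono' ?_ ?_
    · refine Measurable.aestronglyMeasurable ?_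
      unfold wrightIntegrand
      fun_prop
    · refine ae_restrict_of_forall_mem measurableSet_Ioi fun z hz => ?_
      simp only
      rw [hnorm t ht' z hz, add_sub_cancel_right, neg_mul (c * _) z]
  · have hb := (integrableOn_rpow_mul_exp_neg_mul (s := -(α * r) - 1) (b := Real.cos ψ)
      (by nlinarith) h.cos_pos).const_mul (c ^ (-(r + 1)) * Real.Gamma (r + 1))
    refine Integrable.congr hb ?_
    refine ae_restrict_of_forall_mem measurableSet_Ioi fun t ht => ?_
    have ht' : 0 < t := ht
    have hta := Real.rpow_pos_of_pos ht' α
    have e0 : ∫ z in Set.Ioi (0:ℝ), ‖((z ^ r : ℝ) : ℂ) * wrightIntegrand α ψ z t‖ =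
        ∫ z in Set.Ioi (0:ℝ), (t ^ (α - 1) * Real.exp (-Real.cos ψ * t)) *
        (z ^ (r + 1 - 1) * Real.exp (-(c * t ^ α * z))) :=
      setIntegral_congr_fun measurableSet_Ioi fun z hz => hnorm t ht' z hz
    simp only
    rw [e0, integral_const_mul, Real.integral_rpow_mul_exp_neg_mul_Ioi (by linarith)
      (mul_pos hc hta), one_div, Real.inv_rpow (by positivity), ← Real.rpow_neg (by positivity),
      Real.mul_rpow hc.le hta.le]
    have e1 : t ^ (-(α * r) - 1) = t ^ (α - 1) * (t ^ α) ^ (-(r + 1)) := by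
      rw [← Real.rpow_mul ht'.le, ← Real.rpow_add ht']; congr 1; ring
    rw [e1]; ring

/-- Mellin transform of the Wright function. -/
lemma integral_rpow_mul_wrightFn {α : ℝ} (h0 : 0 < α) (h1 : α < 1) {r : ℝ} (hr : -1 < r)
    (hr0 : r < 0) :
    ∫ z in Set.Ioi (0:ℝ), z ^ r * wrightFn α z = Real.Gamma (r + 1) / Real.Gamma (1 + α * r) := by
  obtain ⟨ψ, h⟩ := exists_wrightAngle h0 h1
  have hint := integrable_prod_wrightIntegrand h hr hr0
  have hswap := integral_integral_swap
    (f := fun z t : ℝ => ((z ^ r : ℝ) : ℂ) * wrightIntegrand α ψ z t) hint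
  have hR : ∫ t in Set.Ioi (0:ℝ), ∫ z in Set.Ioi (0:ℝ),
      ((z ^ r : ℝ) : ℂ) * wrightIntegrand α ψ z t =
      Complex.exp ((Real.pi * (-(α * r)) : ℝ) * Complex.I) *
        ((Real.Gamma (r + 1) * Real.Gamma (-(α * r)) : ℝ) : ℂ) := by
    rw [setIntegral_congr_fun measurableSet_Ioi
      (fun t ht => integral_rpow_mul_wrightIntegrand h hr ht), integral_const_mul,
      integral_ray_rpow_mul_cexp (w := -(α * r)) (by nlinarith) one_pos
      ⟨h.neg_lt, h.lt_zero.trans (by positivity)⟩, Real.one_rpow, one_mul]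
    rw [mul_mul_mul_comm, ← Complex.exp_add]
    push_cast
    congr 2
    ring
  have hL : ∀ z : ℝ, z ^ r * wrightFn α z = (1 / Real.pi) *
      (∫ t in Set.Ioi (0:ℝ), ((z ^ r : ℝ) : ℂ) * wrightIntegrand α ψ z t).im := by
    intro z
    rw [wrightFn_eq_integral h, integral_const_mul, Complex.im_ofReal_mul]
    ring
  have hw : 0 < -(α * r) := by nlinarith
  have hw1 : -(α * r) < 1 := by nlinarith
  have hGr := Real.Gamma_mul_Gamma_one_sub (-(α * r))
  have hs : 0 < Real.sin (Real.pi * (-(α * r))) :=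
    Real.sin_pos_of_pos_of_lt_pi (by positivity) (by nlinarith [Real.pi_pos])
  simp only [hL]
  have him := integral_im (𝕜 := ℂ) hint.integral_prod_left
  simp only [RCLike.im_to_complex] at him
  rw [integral_const_mul, him, hswap, hR, Complex.im_mul_ofReal, Complex.exp_ofReal_mul_I_im]
  have hG1 : 0 < Real.Gamma (1 + α * r) := Real.Gamma_pos_of_pos (by linarith)
  rw [sub_neg_eq_add, eq_div_iff hs.ne'] at hGr
  rw [eq_div_iff hG1.ne']
  have := Real.pi_pos.ne'
  rw [one_div, mul_assoc, inv_mul_eq_iff_eq_mul₀ this]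
  linear_combination (Real.Gamma (r + 1)) * hGr

lemma integral_wrightFn {α : ℝ} (h0 : 0 < α) (h1 : α < 1) :
    ∫ z in Set.Ioi (0:ℝ), wrightFn α z = 1 := by
  set r : ℕ → ℝ := fun n => -(1 / ((n:ℝ) + 2)) with hr
  have hr1 : ∀ n, -(1/2) ≤ r n := fun n => by
    simp only [hr]; rw [neg_le_neg_iff]
    exact one_div_le_one_div_of_le (by norm_num) (by linarith [n.cast_nonneg (α := ℝ)])
  have hr2 : ∀ n, r n < 0 := fun n => by simp only [hr]; rw [neg_lt_zero]; positivity
  have hrlim : Tendsto r atTop (𝓝 0) := by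
    have := (tendsto_const_nhds (x := (1:ℝ))).div_atTop
      (tendsto_atTop_add_const_right _ (2:ℝ) tendsto_natCast_atTop_atTop)
    simpa [hr] using this.neg
  have hb : Integrable (fun z : ℝ => ‖z ^ (-(1/2) : ℝ) * wrightFn α z‖ +
      ‖z ^ (0:ℝ) * wrightFn α z‖) (volume.restrict (Set.Ioi 0)) :=
    (integrableOn_rpow_mul_wrightFn h0 h1 (by norm_num) (by norm_num)).norm.add
      (integrableOn_rpow_mul_wrightFn h0 h1 (by norm_num) (by norm_num)).norm
  have hlim := tendsto_integral_of_dominated_convergence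
    (F := fun n z => z ^ (r n) * wrightFn α z) (f := wrightFn α) _
    (fun n => (integrableOn_rpow_mul_wrightFn h0 h1 (by linarith [hr1 n])
      (by linarith [hr2 n])).aestronglyMeasurable) hb ?_ ?_
  · have hlim2 : Tendsto (fun n => Real.Gamma (r n + 1) / Real.Gamma (1 + α * r n)) atTop
        (𝓝 1) := by
      have hc : ContinuousAt (fun x : ℝ => Real.Gamma (x + 1) / Real.Gamma (1 + α * x)) 0 := by
        have hG : ContinuousAt Real.Gamma 1 := (Real.differentiableAt_Gamma fun m => by
          have := m.cast_nonneg (α := ℝ)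
          linarith).continuousAt
        refine ContinuousAt.div ?_ ?_ (by simp)
        · exact ContinuousAt.comp (g := Real.Gamma) (x := 0) (f := fun x : ℝ => x + 1)
            (by simpa using hG) (by fun_prop)
        · exact ContinuousAt.comp (g := Real.Gamma) (x := 0) (f := fun x : ℝ => 1 + α * x)
            (by simpa using hG) (by fun_prop)
      have := hc.tendsto.comp hrlim
      simpa [Function.comp_def] using this
    refine tendsto_nhds_unique hlim (hlim2.congr fun n => ?_)
    exact (integral_rpow_mul_wrightFn h0 h1 (by linarith [hr1 n]) (hr2 n)).symm
  · intro n
    refine ae_restrict_of_forall_mem measurableSet_Ioi fun z hz => ?_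
    have hz' : 0 < z := hz
    rw [norm_mul, norm_mul, norm_mul, ← add_mul]
    refine mul_le_mul_of_nonneg_right ?_ (norm_nonneg _)
    rw [Real.norm_of_nonneg (Real.rpow_nonneg hz'.le _),
      Real.norm_of_nonneg (Real.rpow_nonneg hz'.le _),
      Real.norm_of_nonneg (Real.rpow_nonneg hz'.le _)]
    rcases le_total z 1 with hz1 | hz1
    · exact le_add_of_le_of_nonneg (Real.rpow_le_rpow_of_exponent_ge hz' hz1 (hr1 n))
        (Real.rpow_nonneg hz'.le _)
    · exact le_add_of_nonneg_of_le (Real.rpow_nonneg hz'.le _)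
        (Real.rpow_le_rpow_of_exponent_le hz1 (hr2 n).le)
  · refine ae_restrict_of_forall_mem measurableSet_Ioi fun z hz => ?_
    have hc : ContinuousAt (fun y : ℝ => z ^ y) 0 := Real.continuousAt_const_rpow (ne_of_gt hz)
    have := (hc.tendsto.comp hrlim).mul_const (wrightFn α z)
    simpa [Function.comp_def] using this

section

/-- The space `C₀(ℝᴺ)`. -/
abbrev C0 (N : ℕ) := ZeroAtInftyContinuousMap (Euc N) ℝ

variable {N : ℕ}

namespace C0

lemma abs_apply_le (w : C0 N) (x : Euc N) : |w x| ≤ ‖w‖ := by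
  rw [← ZeroAtInftyContinuousMap.norm_toBCF_eq_norm]
  exact w.toBCF.norm_coe_le_norm x

lemma norm_le_of_forall {w : C0 N} {M : ℝ} (hM : 0 ≤ M) (h : ∀ x, |w x| ≤ M) : ‖w‖ ≤ M := by
  rw [← ZeroAtInftyContinuousMap.norm_toBCF_eq_norm]
  exact (BoundedContinuousFunction.norm_le hM).2 h

/-- Evaluation at a point as a continuous linear functional on `C₀(ℝᴺ)`. -/
def evalCLM (x : Euc N) : C0 N →L[ℝ] ℝ :=
  LinearMap.mkContinuous
    { toFun := fun w => w x
      map_add' := fun _ _ => rfl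
      map_smul' := fun _ _ => rfl } 1 (fun w => by simpa using abs_apply_le w x)

@[simp] lemma evalCLM_apply (x : Euc N) (w : C0 N) : evalCLM x w = w x := rfl

/-- Translation on `C₀(ℝᴺ)`. -/
def transl (y : Euc N) (w : C0 N) : C0 N := w.comp (Homeomorph.subRight y).toCocompactMap

@[simp] lemma transl_apply (y : Euc N) (w : C0 N) (x : Euc N) : transl y w x = w (x - y) := rfl

lemma transl_sub (y : Euc N) (w w' : C0 N) : transl y (w - w') = transl y w - transl y w' := rfl

@[simp] lemma transl_zero (w : C0 N) : transl 0 w = w := by ext x; simp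

lemma norm_transl_le (y : Euc N) (w : C0 N) : ‖transl y w‖ ≤ ‖w‖ :=
  norm_le_of_forall (norm_nonneg _) fun x => abs_apply_le w (x - y)

lemma continuous_transl : Continuous fun y : Euc N × C0 N => transl y.1 y.2 := by
  rw [continuous_iff_continuousAt]
  rintro ⟨y, w⟩
  rw [Metric.continuousAt_iff]
  intro ε hε
  obtain ⟨η, hη, H⟩ := Metric.uniformContinuous_iff.1
    (ZeroAtInftyContinuousMap.uniformContinuous w) (ε / 3) (by positivity)
  refine ⟨min η (ε / 3), by positivity, ?_⟩
  rintro ⟨y', w'⟩ hd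
  rw [Prod.dist_eq, max_lt_iff] at hd
  have h1 : ‖transl y' w' - transl y' w‖ ≤ ε / 3 := by
    rw [← transl_sub]
    refine (norm_transl_le _ _).trans ?_
    rw [← dist_eq_norm]
    exact (hd.2.trans_le (min_le_right _ _)).le
  have h2 : ‖transl y' w - transl y w‖ ≤ ε / 3 := by
    refine norm_le_of_forall (by positivity) fun x => ?_
    have : dist (x - y') (x - y) < η := by
      rw [dist_sub_left]; exact hd.1.trans_le (min_le_left _ _)
    exact (H this).le
  rw [dist_eq_norm]
  calc ‖transl y' w' - transl y w‖ ≤ ‖transl y' w' - transl y' w‖ + ‖transl y' w - transl y w‖ :=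
        norm_sub_le_norm_sub_add_norm_sub _ _ _
    _ < ε := by linarith

end C0

/-- Continuity of parameter integrals with an integrable scalar weight and locally bounded,
continuous vector-valued integrand. -/
lemma continuous_integral_smul {Ω Y E : Type*} [MeasurableSpace Ω] {μ : Measure Ω}
    [TopologicalSpace Y] [FirstCountableTopology Y] [NormedAddCommGroup E] [NormedSpace ℝ E]
    {k : Ω → ℝ} (hk : Integrable k μ) {Φ : Ω → Y → E} {B : Y → ℝ} (hB : Continuous B)
    (hm : ∀ y, AEStronglyMeasurable (fun ω => Φ ω y) μ) (hc : ∀ ω, Continuous (Φ ω))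
    (hb : ∀ ω y, ‖Φ ω y‖ ≤ B y) :
    Continuous fun y => ∫ ω, k ω • Φ ω y ∂μ := by
  rw [continuous_iff_continuousAt]
  intro y
  have hev : ∀ᶠ y' in 𝓝 y, B y' < B y + 1 :=
    hB.continuousAt.eventually (gt_mem_nhds (by linarith))
  refine tendsto_integral_filter_of_dominated_convergence (fun ω => ‖k ω‖ * (B y + 1))
    (Eventually.of_forall fun y' => hk.aestronglyMeasurable.smul (hm y')) ?_
    (hk.norm.mul_const _) (Eventually.of_forall fun ω => ((hc ω).const_smul _).continuousAt)
  filter_upwards [hev] with y' hy'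
  refine Eventually.of_forall fun ω => ?_
  rw [norm_smul]
  exact mul_le_mul_of_nonneg_left ((hb ω y').trans hy'.le) (norm_nonneg _)

lemma integrable_smul_of_bounded {Ω E : Type*} [MeasurableSpace Ω] {μ : Measure Ω}
    [NormedAddCommGroup E] [NormedSpace ℝ E]
    {k : Ω → ℝ} (hk : Integrable k μ) {Φ : Ω → E} {B : ℝ}
    (hm : AEStronglyMeasurable Φ μ) (hb : ∀ ω, ‖Φ ω‖ ≤ B) :
    Integrable (fun ω => k ω • Φ ω) μ := by
  refine (hk.norm.mul_const B).mono' (hk.aestronglyMeasurable.smul hm)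
    (Eventually.of_forall fun ω => ?_)
  rw [norm_smul]
  exact mul_le_mul_of_nonneg_left (hb ω) (norm_nonneg _)

lemma norm_integral_smul_le {Ω E : Type*} [MeasurableSpace Ω] {μ : Measure Ω}
    [NormedAddCommGroup E] [NormedSpace ℝ E]
    {k : Ω → ℝ} (hk : Integrable k μ) {Φ : Ω → E} {B : ℝ} (hb : ∀ ω, ‖Φ ω‖ ≤ B) :
    ‖∫ ω, k ω • Φ ω ∂μ‖ ≤ (∫ ω, ‖k ω‖ ∂μ) * B := by
  rw [← integral_mul_const]
  refine norm_integral_le_of_norm_le (hk.norm.mul_const B) (Eventually.of_forall fun ω => ?_)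
  rw [norm_smul]
  exact mul_le_mul_of_nonneg_left (hb ω) (norm_nonneg _)

lemma heatKernel_nonneg (N : ℕ) {t : ℝ} (ht : 0 ≤ t) (x : Euc N) : 0 ≤ heatKernel N t x := by
  unfold heatKernel; positivity

lemma integral_heatKernel (N : ℕ) {t : ℝ} (ht : 0 < t) : ∫ z, heatKernel N t z = 1 := by
  unfold heatKernel
  rw [integral_const_mul]
  have h := GaussianFourier.integral_rexp_neg_mul_sq_norm (V := Euc N) (b := 1 / (4 * t))
    (by positivity)
  have e : ∀ v : Euc N, -(1 / (4 * t)) * ‖v‖ ^ 2 = -‖v‖ ^ 2 / (4 * t) := fun v => by ring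
  simp only [e] at h
  rw [h, finrank_euclideanSpace, Fintype.card_fin, div_div_eq_mul_div, div_one,
    ← mul_assoc, mul_comm Real.pi 4, ← Real.rpow_add (by positivity)]
  ring_nf
  simp

lemma integrable_heatKernel (N : ℕ) {t : ℝ} (ht : 0 < t) : Integrable (heatKernel N t) := by
  by_contra h
  have := integral_undef h
  rw [integral_heatKernel N ht] at this
  exact one_ne_zero this

lemma integral_heatKernel_one (N : ℕ) : ∫ z, heatKernel N 1 z = 1 := integral_heatKernel N one_pos

lemma integrable_heatKernel_one (N : ℕ) : Integrable (heatKernel N 1) :=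
  integrable_heatKernel N one_pos

namespace C0

/-- The heat semigroup on `C₀(ℝᴺ)`. -/
def heat (t : ℝ) (w : C0 N) : C0 N := ∫ z, heatKernel N 1 z • transl (√t • z) w

lemma aesm_transl (t : ℝ) (w : C0 N) :
    AEStronglyMeasurable (fun z : Euc N => transl (√t • z) w) volume :=
  Continuous.aestronglyMeasurable
    (continuous_transl.comp (f := fun z : Euc N => (√t • z, w)) (by fun_prop))

lemma continuous_heat : Continuous fun y : ℝ × C0 N => heat y.1 y.2 := by
  refine continuous_integral_smul (integrable_heatKernel_one N) (B := fun y => ‖y.2‖) (by fun_prop)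
    (fun y => aesm_transl _ _) (fun z => ?_) (fun z y => norm_transl_le _ _)
  exact continuous_transl.comp (f := fun y : ℝ × C0 N => (√y.1 • z, y.2)) (by fun_prop)

lemma integrable_heat (t : ℝ) (w : C0 N) :
    Integrable fun z => heatKernel N 1 z • transl (√t • z) w :=
  integrable_smul_of_bounded (integrable_heatKernel_one N) (aesm_transl _ _)
    (fun _ => norm_transl_le _ _)

lemma heat_sub (t : ℝ) (w w' : C0 N) : heat t (w - w') = heat t w - heat t w' := by
  unfold heat
  rw [← integral_sub (integrable_heat _ _) (integrable_heat _ _)]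
  refine integral_congr_ae (Eventually.of_forall fun z => ?_)
  exact smul_sub (heatKernel N 1 z) (transl (√t • z) w) (transl (√t • z) w')

lemma norm_heat_le (t : ℝ) (w : C0 N) : ‖heat t w‖ ≤ ‖w‖ := by
  refine (norm_integral_smul_le (integrable_heatKernel_one N) (fun _ => norm_transl_le _ w)).trans ?_
  have : ∀ z, ‖heatKernel N 1 z‖ = heatKernel N 1 z := fun z =>
    Real.norm_of_nonneg (heatKernel_nonneg N zero_le_one z)
  simp only [this, integral_heatKernel_one, one_mul, le_refl]

lemma heat_zero (w : C0 N) : heat 0 w = w := by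
  unfold heat
  simp [integral_smul_const, integral_heatKernel_one]

lemma heat_apply {t : ℝ} (ht : 0 < t) (w : C0 N) (x : Euc N) :
    heat t w x = heatOp N t w x := by
  unfold heat heatOp
  rw [← evalCLM_apply, ← ContinuousLinearMap.integral_comp_comm _ (integrable_heat t w)]
  have h1 := integral_sub_left_eq_self (fun y => heatKernel N t y * w (x - y)) volume x
  simp only [sub_sub_cancel] at h1
  rw [h1]
  have h2 := Measure.integral_comp_smul_of_nonneg (E := Euc N) volume
    (fun y => heatKernel N t y * w (x - y)) (√t) (hR := Real.sqrt_nonneg t)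
  have hs : 0 < √t := Real.sqrt_pos.2 ht
  rw [eq_inv_smul_iff₀ (by positivity), finrank_euclideanSpace, Fintype.card_fin] at h2
  rw [← h2, smul_eq_mul, ← integral_const_mul]
  refine integral_congr_ae (Eventually.of_forall fun z => ?_)
  simp only [map_smul, evalCLM_apply, transl_apply, smul_eq_mul]
  rw [← mul_assoc]
  congr 1
  unfold heatKernel
  rw [norm_smul, mul_pow, Real.norm_of_nonneg hs.le, Real.sq_sqrt ht.le, ← mul_assoc]
  have e1 : -(t * ‖z‖ ^ 2) / (4 * t) = -‖z‖ ^ 2 / (4 * 1) := by field_simp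
  rw [e1]
  congr 1
  rw [Real.mul_rpow (by positivity) ht.le, Real.sqrt_eq_rpow, ← Real.rpow_mul_natCast ht.le,
    mul_left_comm, ← Real.rpow_add ht, mul_one]
  have : 1 / 2 * (N:ℝ) + -(N:ℝ) / 2 = 0 := by ring
  rw [this, Real.rpow_zero, mul_one]

end C0

end

section

variable {N : ℕ}

namespace C0

/-- Subordination `∫_0^∞ k(θ) T(rθ)w dθ` of the heat semigroup to a kernel `k`. -/
def subord (k : ℝ → ℝ) (r : ℝ) (w : C0 N) : C0 N := ∫ θ in Set.Ioi (0:ℝ), k θ • heat (r * θ) w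

lemma aesm_heat_mul (r : ℝ) (w : C0 N) (μ : Measure ℝ) :
    AEStronglyMeasurable (fun θ : ℝ => heat (r * θ) w) μ :=
  Continuous.aestronglyMeasurable
    (continuous_heat.comp (f := fun θ : ℝ => (r * θ, w)) (by fun_prop))

variable {k : ℝ → ℝ}

lemma continuous_subord (hk : IntegrableOn k (Set.Ioi 0)) :
    Continuous fun y : ℝ × C0 N => subord k y.1 y.2 := by
  refine continuous_integral_smul hk (B := fun y => ‖y.2‖) (by fun_prop)
    (fun y => aesm_heat_mul _ _ _) (fun θ => ?_) (fun z y => norm_heat_le _ _)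
  exact continuous_heat.comp (f := fun y : ℝ × C0 N => (y.1 * θ, y.2)) (by fun_prop)

lemma integrable_subord (hk : IntegrableOn k (Set.Ioi 0)) (r : ℝ) (w : C0 N) :
    IntegrableOn (fun θ => k θ • heat (r * θ) w) (Set.Ioi 0) :=
  integrable_smul_of_bounded hk (aesm_heat_mul _ _ _) (fun _ => norm_heat_le _ _)

lemma subord_sub (hk : IntegrableOn k (Set.Ioi 0)) (r : ℝ) (w w' : C0 N) :
    subord k r (w - w') = subord k r w - subord k r w' := by
  unfold subord
  rw [← integral_sub (integrable_subord hk _ _) (integrable_subord hk _ _)]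
  refine integral_congr_ae (Eventually.of_forall fun θ => ?_)
  simp only [heat_sub]
  exact smul_sub (k θ) (heat (r * θ) w) (heat (r * θ) w')

lemma norm_subord_le (hk : IntegrableOn k (Set.Ioi 0)) (r : ℝ) (w : C0 N) :
    ‖subord k r w‖ ≤ (∫ θ in Set.Ioi (0:ℝ), ‖k θ‖) * ‖w‖ :=
  norm_integral_smul_le hk (fun _ => norm_heat_le _ w)

lemma subord_zero (w : C0 N) : subord k 0 w = (∫ θ in Set.Ioi (0:ℝ), k θ) • w := by
  unfold subord
  simp [heat_zero, integral_smul_const]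

lemma subord_apply (hk : IntegrableOn k (Set.Ioi 0)) {r : ℝ} (hr : 0 < r) (w : C0 N)
    (x : Euc N) : subord k r w x = ∫ θ in Set.Ioi (0:ℝ), k θ * heatOp N (r * θ) w x := by
  unfold subord
  rw [← evalCLM_apply, ← ContinuousLinearMap.integral_comp_comm _ (integrable_subord hk r w)]
  refine setIntegral_congr_fun measurableSet_Ioi fun θ hθ => ?_
  simp only [map_smul, evalCLM_apply, smul_eq_mul]
  rw [heat_apply (mul_pos hr hθ)]

/-- Kernel `α θ φ_α(θ)` of the operator `S_α`. -/
def kernelS (γ θ : ℝ) : ℝ := γ * (θ * wrightFn γ θ)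

lemma integrableOn_wrightFn {γ : ℝ} (h0 : 0 < γ) (h1 : γ < 1) :
    IntegrableOn (wrightFn γ) (Set.Ioi 0) := by
  simpa using integrableOn_rpow_mul_wrightFn h0 h1 (y := 0) (by norm_num) (by norm_num)

lemma integrableOn_kernelS {γ : ℝ} (h0 : 0 < γ) (h1 : γ < 1) :
    IntegrableOn (kernelS γ) (Set.Ioi 0) := by
  have := (integrableOn_rpow_mul_wrightFn h0 h1 (y := 1) (by norm_num) (by norm_num)).const_mul γ
  simp only [Real.rpow_one] at this
  exact this

lemma subord_wrightFn_apply {γ t : ℝ} (h0 : 0 < γ) (h1 : γ < 1) (ht : 0 < t) (w : C0 N)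
    (x : Euc N) : subord (wrightFn γ) (t ^ γ) w x = Pop N γ t w x :=
  subord_apply (integrableOn_wrightFn h0 h1) (Real.rpow_pos_of_pos ht γ) w x

lemma subord_kernelS_apply {γ t : ℝ} (h0 : 0 < γ) (h1 : γ < 1) (ht : 0 < t) (w : C0 N)
    (x : Euc N) : subord (kernelS γ) (t ^ γ) w x = Sop N γ t w x := by
  rw [subord_apply (integrableOn_kernelS h0 h1) (Real.rpow_pos_of_pos ht γ), Sop,
    ← integral_const_mul]
  simp only [kernelS, mul_assoc]

/-- Duhamel operator, with the time integral rescaled to the unit interval. -/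
def duhamel (γ : ℝ) (h : ℝ → C0 N) (t : ℝ) : C0 N :=
  t ^ γ • ∫ r in Set.Ioc (0:ℝ) 1, r ^ (γ - 1) •
    subord (kernelS γ) ((t * r) ^ γ) (h (t * (1 - r)))

lemma integrableOn_rpow_sub_one {γ : ℝ} (h0 : 0 < γ) :
    IntegrableOn (fun r : ℝ => r ^ (γ - 1)) (Set.Ioc 0 1) :=
  (intervalIntegral.intervalIntegrable_rpow' (by linarith)).1

lemma continuous_duhamel_integrand {γ : ℝ} (h0 : 0 < γ) (h1 : γ < 1) {h : ℝ → C0 N}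
    (hc : Continuous h) : Continuous fun y : ℝ × ℝ =>
      subord (kernelS γ) ((y.1 * y.2) ^ γ) (h (y.1 * (1 - y.2))) := by
  refine (continuous_subord (integrableOn_kernelS h0 h1)).comp
    (f := fun y : ℝ × ℝ => ((y.1 * y.2) ^ γ, h (y.1 * (1 - y.2)))) ?_
  have := Real.continuous_rpow_const (q := γ) h0.le
  exact (this.comp (by fun_prop)).prodMk (hc.comp (by fun_prop))

lemma norm_duhamel_integrand_le {γ : ℝ} (h0 : 0 < γ) (h1 : γ < 1) {h : ℝ → C0 N} {K : ℝ}
    (hK : ∀ t, ‖h t‖ ≤ K) (t r : ℝ) :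
    ‖subord (kernelS γ) ((t * r) ^ γ) (h (t * (1 - r)))‖ ≤
      (∫ θ in Set.Ioi (0:ℝ), ‖kernelS γ θ‖) * K :=
  (norm_subord_le (integrableOn_kernelS h0 h1) _ _).trans
    (mul_le_mul_of_nonneg_left (hK _) (integral_nonneg fun _ => norm_nonneg _))

lemma continuous_duhamel {γ : ℝ} (h0 : 0 < γ) (h1 : γ < 1) {h : ℝ → C0 N} {K : ℝ}
    (hc : Continuous h) (hK : ∀ t, ‖h t‖ ≤ K) : Continuous (duhamel γ h) := by
  unfold duhamel
  refine (Real.continuous_rpow_const h0.le).smul ?_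
  refine continuous_integral_smul (integrableOn_rpow_sub_one h0) continuous_const
    (fun t => ?_) (fun r => ?_) (fun r t => norm_duhamel_integrand_le h0 h1 hK t r)
  · exact ((continuous_duhamel_integrand h0 h1 hc).comp
      (f := fun r : ℝ => (t, r)) (by fun_prop)).aestronglyMeasurable
  · exact (continuous_duhamel_integrand h0 h1 hc).comp (f := fun t : ℝ => (t, r)) (by fun_prop)

lemma integrable_duhamel {γ : ℝ} (h0 : 0 < γ) (h1 : γ < 1) {h : ℝ → C0 N} {K : ℝ}
    (hc : Continuous h) (hK : ∀ t, ‖h t‖ ≤ K) (t : ℝ) :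
    IntegrableOn (fun r : ℝ => r ^ (γ - 1) •
      subord (kernelS γ) ((t * r) ^ γ) (h (t * (1 - r)))) (Set.Ioc 0 1) :=
  integrable_smul_of_bounded (integrableOn_rpow_sub_one h0)
    ((continuous_duhamel_integrand h0 h1 hc).comp
      (f := fun r : ℝ => (t, r)) (by fun_prop)).aestronglyMeasurable
    (fun r => norm_duhamel_integrand_le h0 h1 hK t r)

lemma duhamel_sub {γ : ℝ} (h0 : 0 < γ) (h1 : γ < 1) {h h' : ℝ → C0 N} {K : ℝ}
    (hc : Continuous h) (hK : ∀ t, ‖h t‖ ≤ K) (hc' : Continuous h') (hK' : ∀ t, ‖h' t‖ ≤ K)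
    (t : ℝ) : duhamel γ (fun τ => h τ - h' τ) t = duhamel γ h t - duhamel γ h' t := by
  unfold duhamel
  refine Eq.trans ?_ (smul_sub (t ^ γ) (∫ r in Set.Ioc (0:ℝ) 1, r ^ (γ - 1) •
    subord (kernelS γ) ((t * r) ^ γ) (h (t * (1 - r)))) _)
  rw [← integral_sub (integrable_duhamel h0 h1 hc hK t) (integrable_duhamel h0 h1 hc' hK' t)]
  congr 1
  refine integral_congr_ae (Eventually.of_forall fun r => ?_)
  simp only [subord_sub (integrableOn_kernelS h0 h1)]
  exact smul_sub (r ^ (γ - 1)) (subord (kernelS γ) ((t * r) ^ γ) (h (t * (1 - r)))) _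

lemma duhamel_apply {γ : ℝ} (h0 : 0 < γ) (h1 : γ < 1) {h : ℝ → C0 N} {K : ℝ}
    (hc : Continuous h) (hK : ∀ t, ‖h t‖ ≤ K) {t : ℝ} (ht : 0 < t) (x : Euc N) :
    duhamel γ h t x = ∫ τ in (0:ℝ)..t, (t - τ) ^ (γ - 1) * Sop N γ (t - τ) (h τ) x := by
  have hsub := intervalIntegral.integral_comp_sub_mul
    (fun τ => (t - τ) ^ (γ - 1) * Sop N γ (t - τ) (h τ) x) (a := 0) (b := 1) ht.ne' t
  simp only [mul_one, sub_self, mul_zero, sub_zero, sub_sub_cancel] at hsub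
  rw [eq_inv_smul_iff₀ ht.ne'] at hsub
  rw [← hsub, smul_eq_mul, intervalIntegral.integral_of_le zero_le_one, duhamel,
    ← evalCLM_apply, map_smul,
    ← ContinuousLinearMap.integral_comp_comm _ (integrable_duhamel h0 h1 hc hK t),
    smul_eq_mul, ← integral_const_mul, ← integral_const_mul]
  refine setIntegral_congr_fun measurableSet_Ioc fun r hr => ?_
  simp only [map_smul, evalCLM_apply, smul_eq_mul]
  rw [subord_kernelS_apply h0 h1 (mul_pos ht hr.1), Real.mul_rpow ht.le hr.1.le,
    Real.rpow_sub_one ht.ne']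
  have : t * (1 - r) = t - t * r := by ring
  rw [this]
  field_simp

end C0

end

section

variable {N : ℕ}

namespace C0

/-- The `L^{1/κ}` norm on `C₀(ℝᴺ)`, with the convention `1/0 = ∞`. -/
def nrm (κ : ℝ) (w : C0 N) : ENNReal := eLpNorm w (ENNReal.ofReal κ)⁻¹ volume

lemma aesm (w : C0 N) (μ : Measure (Euc N)) : AEStronglyMeasurable (⇑w) μ :=
  (map_continuous w).aestronglyMeasurable

lemma one_le_exponent {κ : ℝ} (h : κ ≤ 1) : 1 ≤ (ENNReal.ofReal κ)⁻¹ := by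
  rw [ENNReal.one_le_inv]; exact ENNReal.ofReal_le_one.2 h

lemma nrm_add_le {κ : ℝ} (h : κ ≤ 1) (w w' : C0 N) : nrm κ (w + w') ≤ nrm κ w + nrm κ w' :=
  eLpNorm_add_le (aesm _ _) (aesm _ _) (one_le_exponent h)

lemma nrm_smul (κ c : ℝ) (w : C0 N) : nrm κ (c • w) = ENNReal.ofReal |c| * nrm κ w := by
  have := eLpNorm_const_smul c (⇑w) (ENNReal.ofReal κ)⁻¹ volume
  rw [Real.enorm_eq_ofReal_abs] at this
  exact this

lemma nrm_zero_right (κ : ℝ) : nrm κ (0 : C0 N) = 0 := eLpNorm_zero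

lemma nrm_zero_left (w : C0 N) : nrm 0 w = eLpNorm w ⊤ volume := by simp [nrm]

lemma nrm_zero_le {w : C0 N} {M : ℝ} (h : ‖w‖ ≤ M) : nrm 0 w ≤ ENNReal.ofReal M := by
  rw [nrm_zero_left, eLpNorm_exponent_top]
  exact eLpNormEssSup_le_of_ae_bound (Eventually.of_forall fun x => (abs_apply_le w x).trans h)

lemma norm_le_of_nrm_zero_le {w : C0 N} {M : ℝ} (hM : 0 ≤ M) (h : nrm 0 w ≤ ENNReal.ofReal M) :
    ‖w‖ ≤ M := by
  rw [nrm_zero_left, eLpNorm_exponent_top] at h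
  refine norm_le_of_forall hM fun x => ?_
  by_contra! hx
  have hopen : IsOpen {y : Euc N | M < |w y|} :=
    isOpen_lt continuous_const (map_continuous w).abs
  have hpos := hopen.measure_pos volume ⟨x, hx⟩
  have hae : ∀ᵐ y : Euc N, ‖w y‖ₑ ≤ ENNReal.ofReal M := by
    filter_upwards [enorm_ae_le_eLpNormEssSup (⇑w) volume] with y hy using hy.trans h
  refine hpos.ne' (measure_mono_null (fun y hy => ?_) (ae_iff.1 hae))
  simp only [Set.mem_ofPred_eq, not_le] at hy ⊢
  rw [Real.enorm_eq_ofReal_abs]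
  exact (ENNReal.ofReal_lt_ofReal_iff (lt_of_le_of_lt hM hy)).2 hy

lemma nrm_le_of_tendsto {κ : ℝ} {w : ℕ → C0 N} {w' : C0 N} {a : ℕ → ℝ} {b : ℝ}
    (hw : Tendsto w atTop (𝓝 w')) (ha : Tendsto a atTop (𝓝 b))
    (h : ∀ n, nrm κ (w n) ≤ ENNReal.ofReal (a n)) : nrm κ w' ≤ ENNReal.ofReal b := by
  refine (Lp.eLpNorm_lim_le_liminf_eLpNorm (f := fun n => ⇑(w n)) (fun n => aesm _ _) (⇑w')
    (Eventually.of_forall fun x => ((evalCLM x).continuous.tendsto w').comp hw)).trans ?_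
  have := ((ENNReal.continuous_ofReal.tendsto b).comp ha).liminf_eq
  rw [← this]
  exact liminf_le_liminf (Eventually.of_forall h)

/-- A Bochner integral of a function with values in a closed convex cone lies in the cone. -/
lemma _root_.integral_mem_of_closed_cone {E : Type*} [NormedAddCommGroup E] [NormedSpace ℝ E]
    [CompleteSpace E] {K : Set E} (hclosed : IsClosed K) (hzero : (0 : E) ∈ K)
    (hadd : ∀ x ∈ K, ∀ y ∈ K, x + y ∈ K) (hsmul : ∀ x ∈ K, ∀ a : ℝ, 0 ≤ a → a • x ∈ K)
    {Ω : Type*} [MeasurableSpace Ω] {μ : Measure Ω} {F : Ω → E} (hF : Integrable F μ)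
    (h : ∀ᵐ ω ∂μ, F ω ∈ K) : ∫ ω, F ω ∂μ ∈ K := by
  have hconv : Convex ℝ K := fun x hx y hy a b ha hb _ =>
    hadd _ (hsmul x hx a ha) _ (hsmul y hy b hb)
  by_contra hnot
  obtain ⟨f, u, hfu, hux⟩ := geometric_hahn_banach_closed_point hconv hclosed hnot
  have hu : 0 < u := by simpa using hfu 0 hzero
  have hf : ∀ x ∈ K, f x ≤ 0 := by
    intro x hx
    by_contra! hpos
    have := hfu _ (hsmul x hx (u / f x) (by positivity))
    rw [map_smul, smul_eq_mul, div_mul_cancel₀ _ hpos.ne'] at this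
    exact lt_irrefl _ this
  rw [← ContinuousLinearMap.integral_comp_comm f hF] at hux
  have : ∫ ω, f (F ω) ∂μ ≤ 0 := by
    refine integral_nonpos_of_ae ?_
    filter_upwards [h] with ω hω using hf _ hω
  linarith

/-- Minkowski's integral inequality for `C₀(ℝᴺ)`-valued Bochner integrals. -/
lemma nrm_integral_le {κ : ℝ} (h1 : κ ≤ 1) {Ω : Type*} [MeasurableSpace Ω] {μ : Measure Ω}
    {F : Ω → C0 N} {c : Ω → ℝ} (hF : Integrable F μ) (hc : Integrable c μ)
    (hc0 : ∀ᵐ ω ∂μ, 0 ≤ c ω)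
    (h : ∀ᵐ ω ∂μ, nrm κ (F ω) ≤ ENNReal.ofReal (c ω)) :
    nrm κ (∫ ω, F ω ∂μ) ≤ ENNReal.ofReal (∫ ω, c ω ∂μ) := by
  have hmem := integral_mem_of_closed_cone (E := C0 N × ℝ)
    (K := {x | nrm κ x.1 ≤ ENNReal.ofReal x.2 ∧ 0 ≤ x.2}) (F := fun ω => (F ω, c ω)) (μ := μ)
    ?_ ?_ ?_ ?_ (hF.prodMk hc) ?_
  · rw [integral_pair hF hc] at hmem
    exact hmem.1
  · refine IsSeqClosed.isClosed fun x y hx hxy => ?_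
    have h2 : Tendsto (fun n => (x n).2) atTop (𝓝 y.2) := (continuous_snd.tendsto y).comp hxy
    exact ⟨nrm_le_of_tendsto ((continuous_fst.tendsto y).comp hxy) h2 (fun n => (hx n).1),
      ge_of_tendsto' h2 fun n => (hx n).2⟩
  · exact ⟨(nrm_zero_right κ).trans_le zero_le, le_refl _⟩
  · rintro x ⟨hx, hx0⟩ y ⟨hy, hy0⟩
    refine ⟨?_, add_nonneg hx0 hy0⟩
    change nrm κ (x.1 + y.1) ≤ ENNReal.ofReal (x.2 + y.2)
    rw [ENNReal.ofReal_add hx0 hy0]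
    exact (nrm_add_le h1 _ _).trans (add_le_add hx hy)
  · rintro x ⟨hx, hx0⟩ a ha
    refine ⟨?_, mul_nonneg ha hx0⟩
    change nrm κ (a • x.1) ≤ ENNReal.ofReal (a * x.2)
    rw [nrm_smul, abs_of_nonneg ha, ENNReal.ofReal_mul ha]
    gcongr
  · filter_upwards [hc0, h] with ω h0 hω using ⟨hω, h0⟩

lemma nrm_interpolate {κ κ' A B : ℝ} {w : C0 N} (hκ : 0 < κ) (hκ' : 0 ≤ κ') (hle : κ' ≤ κ)
    (hA : ‖w‖ ≤ A) (hB0 : 0 ≤ B) (hB : nrm κ w ≤ ENNReal.ofReal B) :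
    nrm κ' w ≤ ENNReal.ofReal (A ^ (1 - κ' / κ) * B ^ (κ' / κ)) := by
  have hA0 : 0 ≤ A := (norm_nonneg _).trans hA
  rcases hκ'.eq_or_lt with rfl | hpos
  · simpa using nrm_zero_le hA
  set θ := κ' / κ with hθ
  have hθ0 : 0 < θ := by positivity
  have hθ1 : θ ≤ 1 := (div_le_one hκ).2 hle
  have hpt : ∀ x, ‖w x‖ ≤ ‖(A ^ (1 - θ)) • (‖w x‖ ^ θ)‖ := by
    intro x
    have hr : ‖(A ^ (1 - θ)) • (‖w x‖ ^ θ)‖ = A ^ (1 - θ) * ‖w x‖ ^ θ := by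
      rw [smul_eq_mul]; exact Real.norm_of_nonneg (by positivity)
    rw [hr]
    rcases (norm_nonneg (w x)).eq_or_lt with h0 | h0
    · rw [← h0]; positivity
    calc ‖w x‖ = ‖w x‖ ^ (1 - θ) * ‖w x‖ ^ θ := by
          rw [← Real.rpow_add h0]; simp
      _ ≤ _ := by
          gcongr
          · exact (abs_apply_le w x).trans hA
  have h1 : nrm κ' w ≤ eLpNorm ((A ^ (1 - θ)) • fun x => ‖w x‖ ^ θ) (ENNReal.ofReal κ')⁻¹ volume :=
    eLpNorm_mono hpt
  have h2 : (ENNReal.ofReal κ')⁻¹ * ENNReal.ofReal θ = (ENNReal.ofReal κ)⁻¹ := by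
    rw [hθ, ENNReal.ofReal_div_of_pos hκ, ← mul_div_assoc, ENNReal.inv_mul_cancel (by simpa)
      ENNReal.ofReal_ne_top, one_div]
  rw [eLpNorm_const_smul, eLpNorm_norm_rpow _ hθ0, h2, Real.enorm_eq_ofReal_abs,
    abs_of_nonneg (by positivity)] at h1
  refine h1.trans ?_
  rw [ENNReal.ofReal_mul (by positivity), ← ENNReal.ofReal_rpow_of_nonneg hB0 hθ0.le]
  gcongr
  exact hB

lemma nrm_transl (κ : ℝ) (y : Euc N) (w : C0 N) : nrm κ (transl y w) = nrm κ w :=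
  eLpNorm_comp_measurePreserving (aesm w volume) (measurePreserving_sub_right volume y)

lemma nrm_heat_le {κ t B : ℝ} (h1 : κ ≤ 1) {w : C0 N} (hB0 : 0 ≤ B)
    (hB : nrm κ w ≤ ENNReal.ofReal B) : nrm κ (heat t w) ≤ ENNReal.ofReal B := by
  have := nrm_integral_le h1 (integrable_heat t w) ((integrable_heatKernel_one N).mul_const B)
    (Eventually.of_forall fun z => mul_nonneg (heatKernel_nonneg N zero_le_one z) hB0)
    (Eventually.of_forall fun z => ?_)
  · rwa [integral_mul_const, integral_heatKernel_one, one_mul] at this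
  · have hz := heatKernel_nonneg N zero_le_one z
    rw [nrm_smul, nrm_transl, abs_of_nonneg hz, ENNReal.ofReal_mul hz]
    gcongr

end C0

end

section

variable {N : ℕ}

namespace C0

lemma _root_.heatKernel_le (N : ℕ) {t : ℝ} (ht : 0 < t) (x : Euc N) :
    heatKernel N t x ≤ t ^ (-(N : ℝ) / 2) := by
  unfold heatKernel
  have h1 : Real.exp (-‖x‖ ^ 2 / (4 * t)) ≤ 1 := by
    rw [Real.exp_le_one_iff, neg_div]
    have : 0 ≤ ‖x‖ ^ 2 / (4 * t) := by positivity
    linarith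
  have h2 : (4 * Real.pi * t) ^ (-(N : ℝ) / 2) ≤ t ^ (-(N : ℝ) / 2) := by
    refine Real.rpow_le_rpow_of_nonpos ht ?_ ?_
    · nlinarith [Real.pi_gt_three]
    · have : (0:ℝ) ≤ N := by positivity
      linarith
  calc _ ≤ t ^ (-(N : ℝ) / 2) * 1 := by
        gcongr
    _ = _ := mul_one _

lemma _root_.continuous_heatKernel (N : ℕ) (t : ℝ) : Continuous (heatKernel N t) := by
  unfold heatKernel; fun_prop

/-- The heat semigroup maps `L^{1/κ}` to `L^∞`. -/
lemma norm_heat_smoothing {κ t B : ℝ} (ht : 0 < t) (h0 : 0 < κ) (h1 : κ ≤ 1) {w : C0 N}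
    (hB0 : 0 ≤ B) (hB : nrm κ w ≤ ENNReal.ofReal B) :
    ‖heat t w‖ ≤ t ^ (-((N : ℝ) / 2 * κ)) * B := by
  refine norm_le_of_forall (by positivity) fun x => ?_
  rw [heat_apply ht]
  unfold heatOp
  set ρ : Euc N → ENNReal := fun y => ENNReal.ofReal (heatKernel N t (x - y)) with hρ
  have hρm : Measurable ρ :=
    (((continuous_heatKernel N t).comp (continuous_const.sub continuous_id)).measurable).ennreal_ofReal
  have hprob : IsProbabilityMeasure (volume.withDensity ρ) := by
    constructor
    rw [withDensity_apply _ MeasurableSet.univ, Measure.restrict_univ, hρ,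
      ← ofReal_integral_eq_lintegral_ofReal ((integrable_heatKernel N ht).comp_sub_left x)
        (Eventually.of_forall fun y => heatKernel_nonneg N ht.le _),
      integral_sub_left_eq_self (heatKernel N t) volume x, integral_heatKernel N ht,
      ENNReal.ofReal_one]
  have hc0 : 0 < t ^ (-(N : ℝ) / 2) := by positivity
  have hle : volume.withDensity ρ ≤ ENNReal.ofReal (t ^ (-(N : ℝ) / 2)) • (volume : Measure (Euc N)) := by
    rw [← withDensity_const]
    exact withDensity_mono (Eventually.of_forall fun y =>
      ENNReal.ofReal_le_ofReal (heatKernel_le N ht _))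
  have hint : ∫ y, heatKernel N t (x - y) * w y = ∫ y, w y ∂(volume.withDensity ρ) := by
    rw [integral_withDensity_eq_integral_toReal_smul hρm
      (Eventually.of_forall fun y => ENNReal.ofReal_lt_top)]
    refine integral_congr_ae (Eventually.of_forall fun y => ?_)
    simp [hρ, ENNReal.toReal_ofReal (heatKernel_nonneg N ht.le _)]
  have hnorm : ENNReal.ofReal |∫ y, w y ∂(volume.withDensity ρ)| ≤
      ENNReal.ofReal (t ^ (-((N : ℝ) / 2 * κ)) * B) := by
    rw [← Real.enorm_eq_ofReal_abs]
    calc _ ≤ ∫⁻ y, ‖w y‖ₑ ∂(volume.withDensity ρ) := enorm_integral_le_lintegral_enorm _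
      _ = eLpNorm w 1 (volume.withDensity ρ) := eLpNorm_one_eq_lintegral_enorm.symm
      _ ≤ eLpNorm w (ENNReal.ofReal κ)⁻¹ (volume.withDensity ρ) :=
          eLpNorm_le_eLpNorm_of_exponent_le (one_le_exponent h1) (aesm _ _)
      _ ≤ eLpNorm w (ENNReal.ofReal κ)⁻¹ (ENNReal.ofReal (t ^ (-(N : ℝ) / 2)) • volume) :=
          eLpNorm_mono_measure _ hle
      _ = ENNReal.ofReal (t ^ (-((N : ℝ) / 2 * κ))) * nrm κ w := by
          rw [eLpNorm_smul_measure_of_ne_zero (by simpa using hc0), one_div, inv_inv,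
            ENNReal.toReal_ofReal h0.le, ENNReal.ofReal_rpow_of_pos hc0, ← Real.rpow_mul ht.le,
            smul_eq_mul, nrm]
          congr 3; ring
      _ ≤ _ := by
          rw [ENNReal.ofReal_mul (by positivity)]
          gcongr
  rw [hint]
  exact (ENNReal.ofReal_le_ofReal_iff (by positivity)).1 hnorm

/-- `L^{1/κ}`–`L^{1/κ'}` smoothing of the heat semigroup. -/
lemma nrm_heat_smoothing {κ κ' t B : ℝ} (ht : 0 < t) (h0 : 0 ≤ κ') (hle : κ' ≤ κ) (h1 : κ ≤ 1)
    {w : C0 N} (hB0 : 0 ≤ B) (hB : nrm κ w ≤ ENNReal.ofReal B) :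
    nrm κ' (heat t w) ≤ ENNReal.ofReal (t ^ (-((N : ℝ) / 2 * (κ - κ'))) * B) := by
  rcases hle.eq_or_lt with rfl | hlt
  · simpa using nrm_heat_le h1 hB0 hB
  have hκ : 0 < κ := h0.trans_lt hlt
  have := nrm_interpolate hκ h0 hle (norm_heat_smoothing ht hκ h1 hB0 hB) hB0
    (nrm_heat_le (t := t) h1 hB0 hB)
  convert this using 2
  rw [Real.mul_rpow (by positivity) hB0, ← Real.rpow_mul ht.le, mul_assoc]
  congr 1
  · congr 1; field_simp
  rcases hB0.eq_or_lt with rfl | hBpos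
  · rcases eq_or_ne (κ' / κ) 0 with h | h
    · simp [h]
    · rw [Real.zero_rpow h, mul_zero]
  · rw [← Real.rpow_add hBpos]; simp

/-- Smoothing of subordinated heat semigroups. -/
lemma nrm_subord_le {k : ℝ → ℝ} {κ κ' r B x : ℝ} (hk : IntegrableOn k (Set.Ioi 0))
    (hx : (N : ℝ) / 2 * (κ - κ') = x)
    (hkx : IntegrableOn (fun θ => θ ^ (-x) * k θ) (Set.Ioi 0)) (hr : 0 < r) (h0 : 0 ≤ κ')
    (hle : κ' ≤ κ) (h1 : κ ≤ 1) {w : C0 N} (hB0 : 0 ≤ B) (hB : nrm κ w ≤ ENNReal.ofReal B) :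
    nrm κ' (subord k r w) ≤
      ENNReal.ofReal ((∫ θ in Set.Ioi (0:ℝ), ‖θ ^ (-x) * k θ‖) * (r ^ (-x) * B)) := by
  rw [← integral_mul_const]
  refine nrm_integral_le (hle.trans h1) (integrable_subord hk r w) (hkx.norm.mul_const _)
    (Eventually.of_forall fun θ => by positivity) ?_
  refine (ae_restrict_iff' measurableSet_Ioi).2 (Eventually.of_forall fun θ hθ => ?_)
  have hθ' : 0 < θ := hθ
  rw [nrm_smul]
  refine (mul_le_mul_right (nrm_heat_smoothing (mul_pos hr hθ') h0 hle h1 hB0 hB) _).trans ?_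
  rw [← ENNReal.ofReal_mul (abs_nonneg _), hx]
  refine ENNReal.ofReal_le_ofReal (le_of_eq ?_)
  rw [Real.mul_rpow hr.le hθ'.le, norm_mul, Real.norm_of_nonneg (by positivity : 0 ≤ θ ^ (-x)),
    Real.norm_eq_abs]
  ring

end C0

end

section

variable {N : ℕ}

namespace C0

lemma _root_.rpow_mul_one_sub_rpow_le {a m r : ℝ} (ha0 : 0 < a) (ha1 : a < 1) (hm0 : 0 ≤ m)
    (hm1 : m < 1) (hr0 : 0 < r) (hr1 : r < 1) :
    r ^ (a - 1) * (1 - r) ^ (-m) ≤ 2 * r ^ (a - 1) + 2 * (1 - r) ^ (-m) := by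
  have hs : 0 < 1 - r := by linarith
  have hA : 0 < r ^ (a - 1) := by positivity
  have hB : 0 < (1 - r) ^ (-m) := by positivity
  have key : ∀ z e : ℝ, 1 / 2 ≤ z → -1 ≤ e → e ≤ 0 → z ^ e ≤ 2 := by
    intro z e hz he1 he0
    calc z ^ e ≤ (1 / 2 : ℝ) ^ e := Real.rpow_le_rpow_of_nonpos (by norm_num) hz he0
      _ ≤ (1 / 2 : ℝ) ^ (-1 : ℝ) :=
          Real.rpow_le_rpow_of_exponent_ge (by norm_num) (by norm_num) he1
      _ = 2 := by norm_num [Real.rpow_neg_one]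
  rcases le_total r (1 / 2) with h | h
  · nlinarith [key (1 - r) (-m) (by linarith) (by linarith) (by linarith)]
  · nlinarith [key r (a - 1) h (by linarith) (by linarith)]

lemma _root_.integrableOn_one_sub_rpow {m : ℝ} (hm1 : m < 1) :
    IntegrableOn (fun r : ℝ => (1 - r) ^ (-m)) (Set.Ioc 0 1) := by
  have h : IntervalIntegrable (fun r : ℝ => r ^ (-m)) volume 0 1 :=
    intervalIntegral.intervalIntegrable_rpow' (by linarith)
  have := (h.comp_sub_left 1).symm
  simp only [sub_self, sub_zero] at this
  exact this.1

lemma integrableOn_rpow_mul_kernelS {γ x : ℝ} (h0 : 0 < γ) (h1 : γ < 1) (hx0 : 0 ≤ x)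
    (hx1 : x < 1) : IntegrableOn (fun θ => θ ^ (-x) * kernelS γ θ) (Set.Ioi 0) := by
  refine IntegrableOn.congr_fun ((integrableOn_rpow_mul_wrightFn h0 h1 (y := 1 - x)
    (by linarith) (by linarith)).const_mul γ) (fun θ hθ => ?_) measurableSet_Ioi
  have hθ' : 0 < θ := hθ
  simp only [kernelS]
  rw [sub_eq_add_neg, Real.rpow_add hθ', Real.rpow_one]
  ring

/-- Time-weighted `L^{1/κ}`–`L^{1/κ'}` estimate for the Duhamel operator. -/
lemma nrm_duhamel_le {γ κ κ' x m : ℝ} (h0 : 0 < γ) (h1 : γ < 1)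
    (hx : (N : ℝ) / 2 * (κ - κ') = x) (hx1 : x < 1) (hκ' : 0 ≤ κ') (hle : κ' ≤ κ) (hκ1 : κ ≤ 1)
    (hm0 : 0 ≤ m) (hm1 : m < 1) :
    ∃ C > 0, ∀ (h : ℝ → C0 N) (K M : ℝ), Continuous h → (∀ t, ‖h t‖ ≤ M) → 0 ≤ K →
      (∀ t, nrm κ (h t) ≤ ENNReal.ofReal (K * (1 + |t|) ^ (-m))) →
      ∀ t, nrm κ' (duhamel γ h |t|) ≤ ENNReal.ofReal (C * K * (1 + |t|) ^ (γ * (1 - x) - m)) := by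
  have hx0 : 0 ≤ x := hx ▸ mul_nonneg (by positivity) (by linarith)
  have hkx := integrableOn_rpow_mul_kernelS h0 h1 hx0 hx1
  have ha0 : 0 < γ * (1 - x) := mul_pos h0 (by linarith)
  have ha1 : γ * (1 - x) < 1 := by nlinarith
  set I := ∫ θ in Set.Ioi (0:ℝ), ‖θ ^ (-x) * kernelS γ θ‖ with hI
  have hI0 : 0 ≤ I := integral_nonneg fun _ => norm_nonneg _
  have hint : IntegrableOn (fun r : ℝ => 2 * r ^ (γ * (1 - x) - 1) + 2 * (1 - r) ^ (-m))
      (Set.Ioc 0 1) :=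
    ((integrableOn_rpow_sub_one ha0).const_mul 2).add ((integrableOn_one_sub_rpow hm1).const_mul 2)
  set J := ∫ r in Set.Ioc (0:ℝ) 1, (2 * r ^ (γ * (1 - x) - 1) + 2 * (1 - r) ^ (-m)) with hJ
  have hpos : ∀ r ∈ Set.Ioc (0:ℝ) 1, 0 ≤ 2 * r ^ (γ * (1 - x) - 1) + 2 * (1 - r) ^ (-m) := by
    intro r hr
    have : 0 ≤ 1 - r := by linarith [hr.2]
    have := hr.1
    positivity
  have hJ0 : 0 ≤ J := setIntegral_nonneg measurableSet_Ioc hpos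
  refine ⟨I * J + 1, by positivity, fun h K M hc hM hK hh t => ?_⟩
  rcases (abs_nonneg t).eq_or_lt with ht0 | ht0
  · rw [← ht0]
    have : duhamel γ h 0 = 0 := by
      unfold duhamel; rw [Real.zero_rpow h0.ne', zero_smul]
    rw [this, nrm_zero_right]; exact zero_le
  generalize |t| = s at ht0
  have hcst : 0 ≤ I * s ^ (-(γ * x)) * K * (1 + s) ^ (-m) := by positivity
  have hmain := nrm_integral_le (hle.trans hκ1) (integrable_duhamel h0 h1 hc hM s)
    (hint.const_mul (I * s ^ (-(γ * x)) * K * (1 + s) ^ (-m)))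
    ((ae_restrict_iff' measurableSet_Ioc).2 (Eventually.of_forall fun r hr =>
      mul_nonneg hcst (hpos r hr))) (κ := κ') ?_
  · unfold duhamel
    rw [nrm_smul]
    refine (mul_le_mul_right hmain _).trans ?_
    rw [← ENNReal.ofReal_mul (abs_nonneg _), integral_const_mul, abs_of_nonneg (by positivity)]
    refine ENNReal.ofReal_le_ofReal ?_
    calc s ^ γ * (I * s ^ (-(γ * x)) * K * (1 + s) ^ (-m) * J)
        = I * J * K * (s ^ (γ * (1 - x)) * (1 + s) ^ (-m)) := by
          rw [show γ * (1 - x) = γ + -(γ * x) by ring, Real.rpow_add ht0]; ring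
      _ ≤ (I * J + 1) * K * ((1 + s) ^ (γ * (1 - x)) * (1 + s) ^ (-m)) := by
          gcongr <;> linarith
      _ = _ := by rw [← Real.rpow_add (by linarith)]; rfl
  · refine (ae_restrict_iff' measurableSet_Ioc).2 ?_
    filter_upwards [Measure.ae_ne volume (1:ℝ)] with r hr1 hr
    have hr0 : 0 < r := hr.1
    have hr2 : r < 1 := lt_of_le_of_ne hr.2 hr1
    have hB := hh (s * (1 - r))
    rw [abs_of_nonneg (mul_nonneg ht0.le (by linarith))] at hB
    have hs1 : 0 < 1 + s * (1 - r) := by nlinarith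
    have hS := nrm_subord_le (integrableOn_kernelS h0 h1) hx hkx
      (Real.rpow_pos_of_pos (mul_pos ht0 hr0) γ) hκ' hle hκ1 (by positivity) hB
    rw [nrm_smul]
    refine (mul_le_mul_right hS _).trans ?_
    rw [← ENNReal.ofReal_mul (abs_nonneg _)]
    refine ENNReal.ofReal_le_ofReal ?_
    rw [abs_of_nonneg (by positivity), ← Real.rpow_mul (by positivity),
      Real.mul_rpow ht0.le hr0.le, ← hI, show γ * -x = -(γ * x) by ring]
    have h3 : (1 + s * (1 - r)) ^ (-m) ≤ (1 + s) ^ (-m) * (1 - r) ^ (-m) := by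
      rw [← Real.mul_rpow (by linarith) (by linarith)]
      refine Real.rpow_le_rpow_of_nonpos (mul_pos (by linarith) (by linarith)) ?_ (by linarith)
      nlinarith
    calc r ^ (γ - 1) * (I * (s ^ (-(γ * x)) * r ^ (-(γ * x)) * (K * (1 + s * (1 - r)) ^ (-m))))
        ≤ r ^ (γ - 1) * (I * (s ^ (-(γ * x)) * r ^ (-(γ * x)) *
            (K * ((1 + s) ^ (-m) * (1 - r) ^ (-m))))) := by gcongr
      _ = I * s ^ (-(γ * x)) * K * (1 + s) ^ (-m) *
            (r ^ (γ * (1 - x) - 1) * (1 - r) ^ (-m)) := by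
          rw [show γ * (1 - x) - 1 = γ - 1 + -(γ * x) by ring, Real.rpow_add hr0]; ring
      _ ≤ _ := by
          gcongr
          exact rpow_mul_one_sub_rpow_le ha0 ha1 hm0 hm1 hr0 hr2

/-- Uniform bound for the Duhamel operator on bounded curves decaying in `L^{1/κ}`. -/
lemma norm_duhamel_le {γ κ m : ℝ} (hN : 1 ≤ N) (h0 : 0 < γ) (h1 : γ < 1) (hκ0 : 0 < κ)
    (hκ1 : κ ≤ 1) (hm0 : 0 < m) (hm1 : m < 1) (hcond : γ * (1 - (N : ℝ) / 2 * κ) ≤ m) :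
    ∃ C > 0, ∀ (h : ℝ → C0 N) (K : ℝ), Continuous h → (∀ t, ‖h t‖ ≤ K) →
      (∀ t, nrm κ (h t) ≤ ENNReal.ofReal (K * (1 + |t|) ^ (-m))) →
      ∀ t, ‖duhamel γ h |t|‖ ≤ C * K := by
  have hNpos : (0:ℝ) < N := by exact_mod_cast hN
  rcases lt_or_ge ((N : ℝ) / 2 * κ) 1 with hlt | hge
  · obtain ⟨C, hC, H⟩ := nrm_duhamel_le (N := N) (κ' := 0) h0 h1 rfl (by simpa using hlt) le_rfl
      hκ0.le hκ1 hm0.le hm1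
    refine ⟨C, hC, fun h K hc hK hh t => ?_⟩
    have hK0 : 0 ≤ K := (norm_nonneg _).trans (hK 0)
    refine norm_le_of_nrm_zero_le (by positivity) ((H h K K hc hK hK0 hh t).trans
      (ENNReal.ofReal_le_ofReal ?_))
    refine mul_le_of_le_one_right (by positivity) (Real.rpow_le_one_of_one_le_of_nonpos
      (by linarith [abs_nonneg t]) ?_)
    rw [sub_zero]; linarith
  · set k := (N : ℝ) / 2 * κ with hk
    have hk0 : 0 < k := by linarith
    have hd : 0 < γ + m / k := by positivity
    set y := γ / (γ + m / k) with hy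
    have hy0 : 0 < y := by positivity
    have hy1 : y < 1 := by
      rw [hy, div_lt_one hd]; have : 0 < m / k := by positivity
      linarith
    have hyk : y / k ≤ 1 := (div_le_one hk0).2 (by linarith)
    have hκ'' : 2 * y / N = κ * (y / k) := by rw [hk]; field_simp
    have hle : 2 * y / N ≤ κ := by rw [hκ'']; exact mul_le_of_le_one_right hκ0.le hyk
    have hmy : m * (y / k) ≤ m := mul_le_of_le_one_right hm0.le hyk
    obtain ⟨C, hC, H⟩ := nrm_duhamel_le (N := N) (κ' := 0) (κ := 2 * y / N) (x := y)
      (m := m * (y / k)) h0 h1 (by field_simp; ring) hy1 le_rfl (by positivity) (hle.trans hκ1)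
      (by positivity) (by linarith)
    refine ⟨C, hC, fun h K hc hK hh t => ?_⟩
    have hK0 : 0 ≤ K := (norm_nonneg _).trans (hK 0)
    have hh' : ∀ t, nrm (2 * y / N) (h t) ≤
        ENNReal.ofReal (K * (1 + |t|) ^ (-(m * (y / k)))) := by
      intro t
      have hpos : 0 < 1 + |t| := by positivity
      refine (nrm_interpolate hκ0 (by positivity) hle (hK t) (by positivity) (hh t)).trans
        (ENNReal.ofReal_le_ofReal (le_of_eq ?_))
      have hq : 2 * y / N / κ = y / k := by rw [hκ'']; field_simp
      rw [hq, Real.mul_rpow hK0 (by positivity), ← Real.rpow_mul hpos.le, ← mul_assoc, neg_mul]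
      congr 1
      rcases hK0.eq_or_lt with h | h
      · rw [← h, Real.zero_rpow (by positivity : y / k ≠ 0), mul_zero]
      · rw [← Real.rpow_add h]; simp
    refine norm_le_of_nrm_zero_le (by positivity) ((H h K K hc hK hK0 hh' t).trans
      (ENNReal.ofReal_le_ofReal ?_))
    have hz : γ * (1 - y) - m * (y / k) = 0 := by
      have : y * (γ + m / k) = γ := by rw [hy]; field_simp
      have h2 : m * (y / k) = y * (m / k) := by ring
      rw [h2]; linarith
    rw [hz, Real.rpow_zero, mul_one]

/-- Decay of the free evolution for data in `L¹ ∩ L^∞`. -/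
lemma nrm_subord_wrightFn_le {γ κ x : ℝ} (hN : 1 ≤ N) (h0 : 0 < γ) (h1 : γ < 1) (hκ : 0 ≤ κ)
    (hx0 : 0 ≤ x) (hx1 : x < 1) (hκx : (N : ℝ) / 2 * κ + x ≤ N / 2) :
    ∃ C > 0, ∀ (w : C0 N) (ε : ℝ), ‖w‖ ≤ ε → nrm 1 w ≤ ENNReal.ofReal ε →
      ∀ t, nrm κ (subord (wrightFn γ) (|t| ^ γ) w) ≤
        ENNReal.ofReal (C * ε * (1 + |t|) ^ (-(γ * x))) := by
  have hNpos : (0:ℝ) < N := by exact_mod_cast hN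
  have hk := integrableOn_wrightFn h0 h1
  have hint : ∀ y : ℝ, 0 ≤ y → y < 1 → IntegrableOn (fun θ => θ ^ (-y) * wrightFn γ θ) (Set.Ioi 0) :=
    fun y hy0 hy1 => integrableOn_rpow_mul_wrightFn h0 h1 (by linarith) (by linarith)
  set I : ℝ → ℝ := fun y => ∫ θ in Set.Ioi (0:ℝ), ‖θ ^ (-y) * wrightFn γ θ‖ with hI
  have hI0 : ∀ y, 0 ≤ I y := fun y => integral_nonneg fun _ => norm_nonneg _
  have hκ1 : κ + 2 * x / N ≤ 1 := by
    have : κ + 2 * x / N = ((N : ℝ) / 2 * κ + x) / (N / 2) := by field_simp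
    rw [this, div_le_one (by positivity)]; exact hκx
  have hxN : 0 ≤ 2 * x / N := by positivity
  refine ⟨2 * (I 0 + I x + 1), by linarith [hI0 0, hI0 x], fun w ε hw hw1 t => ?_⟩
  have hε : 0 ≤ ε := (norm_nonneg _).trans hw
  have hinter : ∀ κ'' : ℝ, 0 ≤ κ'' → κ'' ≤ 1 → nrm κ'' w ≤ ENNReal.ofReal ε := by
    intro κ'' ha hb
    refine (nrm_interpolate one_pos ha hb hw hε hw1).trans (ENNReal.ofReal_le_ofReal (le_of_eq ?_))
    rw [div_one]
    rcases hε.eq_or_lt with h | h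
    · rw [← h]
      rcases eq_or_ne κ'' 0 with h' | h'
      · simp [h']
      · rw [Real.zero_rpow h', mul_zero]
    · rw [← Real.rpow_add h]; simp
  have hγx : 0 ≤ γ * x ∧ γ * x ≤ 1 := ⟨by positivity, by nlinarith⟩
  have htwo : ∀ z : ℝ, 0 < z → z ≤ 2 → 1 ≤ 2 * z ^ (-(γ * x)) := by
    intro z hz hz2
    have h3 : (2:ℝ) ^ (-1:ℝ) ≤ z ^ (-(γ * x)) :=
      calc (2:ℝ) ^ (-1:ℝ) ≤ 2 ^ (-(γ * x)) :=
            Real.rpow_le_rpow_of_exponent_le (by norm_num) (by linarith)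
        _ ≤ _ := Real.rpow_le_rpow_of_nonpos hz hz2 (by linarith)
    rw [Real.rpow_neg_one] at h3
    linarith
  generalize ht : |t| = s
  have hs : 0 ≤ s := ht ▸ abs_nonneg t
  have hpow : 0 < (1 + s) ^ (-(γ * x)) := by positivity
  rcases le_total s 1 with hs1 | hs1
  · have hmain : nrm κ (subord (wrightFn γ) (s ^ γ) w) ≤ ENNReal.ofReal ((I 0 + 1) * ε) := by
      rcases hs.eq_or_lt with h | h
      · rw [← h, Real.zero_rpow h0.ne', subord_zero, integral_wrightFn h0 h1, one_smul]
        refine (hinter κ hκ (by linarith)).trans (ENNReal.ofReal_le_ofReal ?_)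
        nlinarith [hI0 0]
      · have := nrm_subord_le (x := 0) (κ := κ) (κ' := κ) hk (by simp) (hint 0 le_rfl one_pos)
          (Real.rpow_pos_of_pos h γ) hκ le_rfl (by linarith) hε (hinter κ hκ (by linarith))
        refine this.trans (ENNReal.ofReal_le_ofReal ?_)
        change I 0 * ((s ^ γ) ^ (-0:ℝ) * ε) ≤ _
        rw [neg_zero, Real.rpow_zero, one_mul]
        nlinarith
    refine hmain.trans (ENNReal.ofReal_le_ofReal ?_)
    have h2 := htwo (1 + s) (by linarith) (by linarith)
    have h3 : 0 ≤ (I 0 + 1) * ε := by nlinarith [hI0 0]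
    have h4 : (I 0 + 1) * ε ≤ (I 0 + I x + 1) * ε := by nlinarith [hI0 x]
    nlinarith
  · have hs0 : 0 < s := by linarith
    have := nrm_subord_le (x := x) (κ := κ + 2 * x / N) (κ' := κ) hk (by field_simp; ring)
      (hint x hx0 hx1) (Real.rpow_pos_of_pos hs0 γ) hκ (by linarith) hκ1 hε
      (hinter _ (by positivity) hκ1)
    refine this.trans (ENNReal.ofReal_le_ofReal ?_)
    rw [← Real.rpow_mul hs0.le, show γ * -x = -(γ * x) by ring]
    change I x * (s ^ (-(γ * x)) * ε) ≤ _
    have h2 := htwo ((1 + s) / s) (by positivity) ((div_le_iff₀ hs0).2 (by linarith))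
    rw [Real.div_rpow (by positivity) hs0.le] at h2
    have h5 : 0 < s ^ (-(γ * x)) := by positivity
    have h6 : s ^ (-(γ * x)) ≤ 2 * (1 + s) ^ (-(γ * x)) := by
      rw [← mul_div_assoc, le_div_iff₀ h5] at h2; linarith
    calc I x * (s ^ (-(γ * x)) * ε) ≤ (I 0 + I x + 1) * (2 * (1 + s) ^ (-(γ * x)) * ε) := by
          have := hI0 0
          have := hI0 x
          gcongr
          linarith
      _ = _ := by ring

end C0

end

section

variable {N : ℕ}

/-- Functions vanishing at `0` that are locally Lipschitz with the growth of a power `p`. -/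
structure PowerLip (p : ℝ) (f : ℝ → ℝ) : Prop where
  map_zero : f 0 = 0
  lip : ∀ a b, |f a - f b| ≤ p * max |a| |b| ^ (p - 1) * |a - b|

lemma rpow_sub_rpow_le {p x y : ℝ} (hp : 1 ≤ p) (hy : 0 ≤ y) (hyx : y ≤ x) :
    x ^ p - y ^ p ≤ p * x ^ (p - 1) * (x - y) := by
  rcases (hy.trans hyx).eq_or_lt with h | hx
  · have : y = 0 := by linarith
    simp [← h, this]
  have hB := one_add_mul_self_le_rpow_one_add (s := y / x - 1) (p := p)
    (by linarith [div_nonneg hy hx.le]) hp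
  rw [add_sub_cancel, Real.div_rpow hy hx.le, le_div_iff₀ (by positivity)] at hB
  have hxp : x ^ p = x ^ (p - 1) * x := by
    rw [Real.rpow_sub_one hx.ne']; field_simp
  have : (1 + p * (y / x - 1)) * x ^ p = x ^ p - p * x ^ (p - 1) * (x - y) := by
    rw [hxp]; field_simp; ring
  linarith

lemma abs_abs_rpow_sub_le {p : ℝ} (hp : 1 ≤ p) (a b : ℝ) :
    |(|a| ^ p - |b| ^ p)| ≤ p * max |a| |b| ^ (p - 1) * |(|a| - |b|)| := by
  wlog h : |b| ≤ |a| generalizing a b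
  · have := this b a (le_of_not_ge h)
    rwa [abs_sub_comm, max_comm, abs_sub_comm |b|] at this
  rw [max_eq_left h, abs_of_nonneg (sub_nonneg.2 h), abs_of_nonneg
    (sub_nonneg.2 (Real.rpow_le_rpow (abs_nonneg b) h (by linarith)))]
  exact rpow_sub_rpow_le hp (abs_nonneg b) h

lemma powerLip_abs_rpow {p : ℝ} (hp : 1 ≤ p) : PowerLip p fun a => |a| ^ p where
  map_zero := by simp [Real.zero_rpow (by linarith : p ≠ 0)]
  lip a b := (abs_abs_rpow_sub_le hp a b).trans
    (mul_le_mul_of_nonneg_left (abs_abs_sub_abs_le a b) (by positivity))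

lemma powerLip_abs_rpow_mul {p : ℝ} (hp : 1 ≤ p) : PowerLip p fun a => |a| ^ (p - 1) * a where
  map_zero := by simp
  lip a b := by
    have habs : ∀ c : ℝ, |c| ^ (p - 1) * |c| = |c| ^ p := by
      intro c
      rcases eq_or_ne c 0 with rfl | hc
      · simp [Real.zero_rpow (by linarith : p ≠ 0)]
      · rw [Real.rpow_sub_one (abs_ne_zero.2 hc)]; field_simp
    wlog ha : 0 ≤ a generalizing a b
    · have := this (-a) (-b) (by linarith)
      simp only [abs_neg] at this
      rw [show |a| ^ (p - 1) * -a - |b| ^ (p - 1) * -b =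
        -(|a| ^ (p - 1) * a - |b| ^ (p - 1) * b) by ring, abs_neg, show -a - -b = -(a - b) by ring,
        abs_neg] at this
      exact this
    rcases le_total 0 b with hb | hb
    · have h1 := habs a
      have h2 := habs b
      have h3 := abs_abs_rpow_sub_le hp a b
      rw [← h1, ← h2] at h3
      simpa only [abs_of_nonneg ha, abs_of_nonneg hb] using h3
    · have hM : 0 ≤ max |a| |b| := le_max_of_le_left (abs_nonneg a)
      have h1 : |a| ^ (p - 1) ≤ max |a| |b| ^ (p - 1) :=
        Real.rpow_le_rpow (abs_nonneg a) (le_max_left _ _) (by linarith)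
      have h2 : |b| ^ (p - 1) ≤ max |a| |b| ^ (p - 1) :=
        Real.rpow_le_rpow (abs_nonneg b) (le_max_right _ _) (by linarith)
      have hM' : 0 ≤ max |a| |b| ^ (p - 1) := by positivity
      have ha' : 0 ≤ |a| ^ (p - 1) := by positivity
      have hb' : 0 ≤ |b| ^ (p - 1) := by positivity
      rw [abs_of_nonneg (by nlinarith : 0 ≤ |a| ^ (p - 1) * a - |b| ^ (p - 1) * b),
        abs_of_nonneg (by linarith : 0 ≤ a - b)]
      calc |a| ^ (p - 1) * a - |b| ^ (p - 1) * b
          ≤ max |a| |b| ^ (p - 1) * a - max |a| |b| ^ (p - 1) * b := by nlinarith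
        _ = 1 * max |a| |b| ^ (p - 1) * (a - b) := by ring
        _ ≤ _ := by gcongr; linarith

lemma PowerLip.const_mul {p ε : ℝ} {f : ℝ → ℝ} (hf : PowerLip p f) (hε : |ε| = 1) :
    PowerLip p fun a => ε * f a where
  map_zero := by simp [hf.map_zero]
  lip a b := by rw [← mul_sub, abs_mul, hε, one_mul]; exact hf.lip a b

lemma PowerLip.abs_le {p : ℝ} {f : ℝ → ℝ} (hf : PowerLip p f) (hp : 1 ≤ p) (a : ℝ) :
    |f a| ≤ p * |a| ^ p := by
  have := hf.lip a 0
  rw [hf.map_zero, sub_zero, sub_zero, abs_zero, max_eq_left (abs_nonneg a)] at this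
  refine this.trans (le_of_eq ?_)
  rcases eq_or_ne a 0 with rfl | ha
  · simp [Real.zero_rpow (by linarith : p ≠ 0)]
  · rw [Real.rpow_sub_one (abs_ne_zero.2 ha)]
    have := abs_ne_zero.2 ha
    field_simp

lemma PowerLip.continuous {p : ℝ} {f : ℝ → ℝ} (hf : PowerLip p f) (hp : 1 ≤ p) :
    Continuous f := by
  rw [continuous_iff_continuousAt]
  intro a
  rw [ContinuousAt, tendsto_iff_norm_sub_tendsto_zero]
  refine squeeze_zero (fun _ => norm_nonneg _) (fun b => hf.lip b a) ?_
  have hc : Continuous fun b : ℝ => p * max |b| |a| ^ (p - 1) * |b - a| :=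
    (continuous_const.mul ((Continuous.rpow_const (by fun_prop) fun _ => Or.inr (by linarith)))).mul
      (by fun_prop)
  simpa using hc.tendsto a

namespace C0

/-- The superposition operator on `C₀(ℝᴺ)` induced by a power type function. -/
def nl {p : ℝ} {f : ℝ → ℝ} (hf : PowerLip p f) (hp : 1 ≤ p) (w : C0 N) : C0 N where
  toFun x := f (w x)
  continuous_toFun := (hf.continuous hp).comp (map_continuous w)
  zero_at_infty' := by
    have := ((hf.continuous hp).tendsto 0).comp w.zero_at_infty'
    rwa [hf.map_zero] at this

variable {p : ℝ} {f : ℝ → ℝ}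

lemma nl_apply (hf : PowerLip p f) (hp : 1 ≤ p) (w : C0 N) (x : Euc N) :
    nl hf hp w x = f (w x) := rfl

lemma norm_nl_sub_le (hf : PowerLip p f) (hp : 1 ≤ p) {w w' : C0 N} {R d : ℝ} (hw : ‖w‖ ≤ R)
    (hw' : ‖w'‖ ≤ R) (hd : ‖w - w'‖ ≤ d) :
    ‖nl hf hp w - nl hf hp w'‖ ≤ p * R ^ (p - 1) * d := by
  have hR : 0 ≤ R := (norm_nonneg _).trans hw
  have hd0 : 0 ≤ d := (norm_nonneg _).trans hd
  refine norm_le_of_forall (by positivity) fun x => ?_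
  refine (hf.lip (w x) (w' x)).trans ?_
  have h1 : max |w x| |w' x| ≤ R :=
    max_le ((abs_apply_le w x).trans hw) ((abs_apply_le w' x).trans hw')
  have h2 : |w x - w' x| ≤ d := (abs_apply_le (w - w') x).trans hd
  have h3 : 0 ≤ max |w x| |w' x| := le_max_of_le_left (abs_nonneg _)
  gcongr

lemma norm_nl_le (hf : PowerLip p f) (hp : 1 ≤ p) {w : C0 N} {R : ℝ} (hw : ‖w‖ ≤ R) :
    ‖nl hf hp w‖ ≤ p * R ^ p := by
  have hR : 0 ≤ R := (norm_nonneg _).trans hw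
  refine norm_le_of_forall (by positivity) fun x => (hf.abs_le hp _).trans ?_
  gcongr
  exact (abs_apply_le w x).trans hw

lemma continuous_nl (hf : PowerLip p f) (hp : 1 ≤ p) : Continuous (nl hf hp : C0 N → C0 N) := by
  rw [continuous_iff_continuousAt]
  intro w
  rw [ContinuousAt, tendsto_iff_norm_sub_tendsto_zero]
  refine squeeze_zero (fun _ => norm_nonneg _) (fun b => norm_nl_sub_le hf hp (w := b) (w' := w)
    (R := max ‖b‖ ‖w‖) (le_max_left _ _) (le_max_right _ _) le_rfl) ?_
  have hc : Continuous fun b : C0 N => p * max ‖b‖ ‖w‖ ^ (p - 1) * ‖b - w‖ :=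
    (continuous_const.mul ((Continuous.rpow_const (by fun_prop) fun _ => Or.inr (by linarith)))).mul
      (by fun_prop)
  simpa using hc.tendsto w

lemma nrm_mono {κ c : ℝ} {w w' : C0 N} (h : ∀ x, |w x| ≤ c * |w' x|) :
    nrm κ w ≤ ENNReal.ofReal c * nrm κ w' :=
  eLpNorm_le_mul_eLpNorm_of_ae_le_mul (Eventually.of_forall h) _

lemma nrm_nl_abs_rpow_le {κ B : ℝ} (hp : 1 ≤ p) {w : C0 N} (hB0 : 0 ≤ B)
    (hB : nrm κ w ≤ ENNReal.ofReal B) :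
    nrm (p * κ) (nl (powerLip_abs_rpow hp) hp w) ≤ ENNReal.ofReal (B ^ p) := by
  have hp0 : 0 < p := by linarith
  have h2 : (ENNReal.ofReal (p * κ))⁻¹ * ENNReal.ofReal p = (ENNReal.ofReal κ)⁻¹ := by
    rw [ENNReal.ofReal_mul hp0.le, ENNReal.mul_inv (by simp) (by simp), mul_assoc, mul_comm,
      mul_assoc, ENNReal.mul_inv_cancel (by simpa) (by simp), mul_one]
  have h1 : nrm (p * κ) (nl (powerLip_abs_rpow hp) hp w) = nrm κ w ^ p := by
    have := eLpNorm_norm_rpow (p := (ENNReal.ofReal (p * κ))⁻¹) (μ := volume) (⇑w) hp0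
    rw [h2] at this
    exact this
  rw [h1, ← ENNReal.ofReal_rpow_of_nonneg hB0 hp0.le]
  gcongr

lemma nrm_nl_le {κ B : ℝ} (hf : PowerLip p f) (hp : 1 ≤ p) {w : C0 N} (hB0 : 0 ≤ B)
    (hB : nrm κ w ≤ ENNReal.ofReal B) :
    nrm (p * κ) (nl hf hp w) ≤ ENNReal.ofReal (p * B ^ p) := by
  refine (nrm_mono (c := p) (w' := nl (powerLip_abs_rpow hp) hp w) fun x => ?_).trans ?_
  · rw [nl_apply, nl_apply, abs_of_nonneg (by positivity : 0 ≤ |w x| ^ p)]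
    exact hf.abs_le hp _
  · rw [ENNReal.ofReal_mul (by linarith)]
    gcongr
    exact nrm_nl_abs_rpow_le hp hB0 hB

lemma nrm_nl_sub_le {κ R d : ℝ} (hf : PowerLip p f) (hp : 1 ≤ p) (hκ1 : p * κ ≤ 1)
    {w w' : C0 N} (hR : 0 < R) (hd : 0 < d) (hw : nrm κ w ≤ ENNReal.ofReal R)
    (hw' : nrm κ w' ≤ ENNReal.ofReal R) (hww : nrm κ (w - w') ≤ ENNReal.ofReal d) :
    nrm (p * κ) (nl hf hp w - nl hf hp w') ≤ ENNReal.ofReal (3 * p * R ^ (p - 1) * d) := by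
  have hl : 0 < d / R := by positivity
  set A : C0 N → C0 N := nl (powerLip_abs_rpow hp) hp with hA
  have hAapp : ∀ (z : C0 N) x, A z x = |z x| ^ p := fun z x => rfl
  have hz : nrm κ ((d / R)⁻¹ • (w - w')) ≤ ENNReal.ofReal R := by
    rw [nrm_smul, abs_of_pos (by positivity)]
    calc _ ≤ ENNReal.ofReal ((d / R)⁻¹) * ENNReal.ofReal d := by gcongr
      _ = _ := by
        rw [← ENNReal.ofReal_mul (by positivity)]; congr 1; field_simp
  have hsum : nrm (p * κ) (A w + A w' + A ((d / R)⁻¹ • (w - w'))) ≤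
      ENNReal.ofReal (R ^ p + R ^ p + R ^ p) := by
    refine (nrm_add_le hκ1 _ _).trans ?_
    rw [ENNReal.ofReal_add (by positivity) (by positivity)]
    refine add_le_add ((nrm_add_le hκ1 _ _).trans ?_) (nrm_nl_abs_rpow_le hp hR.le hz)
    rw [ENNReal.ofReal_add (by positivity) (by positivity)]
    exact add_le_add (nrm_nl_abs_rpow_le hp hR.le hw) (nrm_nl_abs_rpow_le hp hR.le hw')
  refine (nrm_mono (c := p * (d / R)) (w' := A w + A w' + A ((d / R)⁻¹ • (w - w')))
    fun x => ?_).trans ?_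
  · set M := max |w x| |w' x| with hM
    set y := (d / R)⁻¹ * |w x - w' x| with hy
    have hM0 : 0 ≤ M := le_max_of_le_left (abs_nonneg _)
    have hy0 : 0 ≤ y := by positivity
    have hval : (A w + A w' + A ((d / R)⁻¹ • (w - w'))) x = |w x| ^ p + |w' x| ^ p + y ^ p := by
      change |w x| ^ p + |w' x| ^ p + |(d / R)⁻¹ * (w x - w' x)| ^ p = _
      rw [abs_mul, abs_of_pos (by positivity : 0 < (d / R)⁻¹)]
    have hMp : M ^ p ≤ |w x| ^ p + |w' x| ^ p := by
      have h1 : 0 ≤ |w x| ^ p := by positivity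
      have h2 : 0 ≤ |w' x| ^ p := by positivity
      rcases max_choice |w x| |w' x| with h | h <;> rw [hM, h] <;> linarith
    have hprod : M ^ (p - 1) * y ≤ M ^ p + y ^ p := by
      have hpow : ∀ z : ℝ, 0 ≤ z → z ^ (p - 1) * z = z ^ p := by
        intro z hz
        rcases hz.eq_or_lt with h | h
        · rw [← h]; simp [Real.zero_rpow (by linarith : p ≠ 0)]
        · rw [Real.rpow_sub_one h.ne']; field_simp
      have h1 : 0 ≤ M ^ p := by positivity
      have h2 : 0 ≤ y ^ p := by positivity
      rcases le_total M y with h | h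
      · have : M ^ (p - 1) * y ≤ y ^ (p - 1) * y := by gcongr
        rw [hpow y hy0] at this; linarith
      · have : M ^ (p - 1) * y ≤ M ^ (p - 1) * M := by gcongr
        rw [hpow M hM0] at this; linarith
    rw [hval, abs_of_nonneg (by positivity : 0 ≤ |w x| ^ p + |w' x| ^ p + y ^ p)]
    change |f (w x) - f (w' x)| ≤ _
    calc |f (w x) - f (w' x)| ≤ p * M ^ (p - 1) * |w x - w' x| := hf.lip _ _
      _ = p * (d / R) * (M ^ (p - 1) * y) := by rw [hy]; field_simp
      _ ≤ _ := by gcongr; linarith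
  · calc _ ≤ ENNReal.ofReal (p * (d / R)) * ENNReal.ofReal (R ^ p + R ^ p + R ^ p) := by gcongr
      _ = _ := by
        rw [← ENNReal.ofReal_mul (by positivity), Real.rpow_sub_one hR.ne']
        congr 1; field_simp; ring

end C0

end

section

variable {N : ℕ}

namespace C0

/-- Bounded continuous curves in `C₀(ℝᴺ)` with algebraic decay in `L^{1/κ}`. -/
structure Bd (κ m K : ℝ) (h : ℝ → C0 N) : Prop where
  cont : Continuous h
  norm_le : ∀ t, ‖h t‖ ≤ K
  nrm_le : ∀ t, nrm κ (h t) ≤ ENNReal.ofReal (K * (1 + |t|) ^ (-m))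

namespace Bd

variable {κ κ' m m' K K' γ x : ℝ} {h h' : ℝ → C0 N}

lemma nonneg (H : Bd κ m K h) : 0 ≤ K := (norm_nonneg _).trans (H.norm_le 0)

lemma mono (H : Bd κ m K h) (hK : K ≤ K') : Bd κ m K' h :=
  ⟨H.cont, fun t => (H.norm_le t).trans hK,
    fun t => (H.nrm_le t).trans (ENNReal.ofReal_le_ofReal (by gcongr))⟩

lemma zero (hK : 0 ≤ K) : Bd κ m K (fun _ => (0 : C0 N)) :=
  ⟨continuous_const, fun t => by simpa using hK, fun t => by simp [nrm_zero_right]⟩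

lemma add (hκ : κ ≤ 1) (H : Bd κ m K h) (H' : Bd κ m K' h') :
    Bd κ m (K + K') (fun t => h t + h' t) := by
  refine ⟨H.cont.add H'.cont, fun t => (norm_add_le _ _).trans
    (add_le_add (H.norm_le t) (H'.norm_le t)), fun t => (nrm_add_le hκ _ _).trans ?_⟩
  have := H.nonneg
  have := H'.nonneg
  rw [add_mul, ENNReal.ofReal_add (by positivity) (by positivity)]
  exact add_le_add (H.nrm_le t) (H'.nrm_le t)

lemma duhamel (hN : 1 ≤ N) (h0 : 0 < γ) (h1 : γ < 1) (hx : (N : ℝ) / 2 * (κ - κ') = x)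
    (hx1 : x < 1) (hκ' : 0 ≤ κ') (hle : κ' ≤ κ) (hκ0 : 0 < κ) (hκ1 : κ ≤ 1) (hm0 : 0 < m)
    (hm1 : m < 1) (hcond : γ * (1 - (N : ℝ) / 2 * κ) ≤ m) (hm' : γ * (1 - x) - m ≤ -m') :
    ∃ C > 0, ∀ (h : ℝ → C0 N) (K : ℝ), Bd κ m K h →
      Bd κ' m' (C * K) (fun t => C0.duhamel γ h |t|) := by
  obtain ⟨C, hC, H⟩ := nrm_duhamel_le (N := N) h0 h1 hx hx1 hκ' hle hκ1 hm0.le hm1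
  obtain ⟨C', hC', H'⟩ := norm_duhamel_le hN h0 h1 hκ0 hκ1 hm0 hm1 hcond
  refine ⟨max C C', lt_max_of_lt_left hC, fun h K hB => ?_⟩
  have hK := hB.nonneg
  refine ⟨(continuous_duhamel h0 h1 hB.cont hB.norm_le).comp continuous_abs, fun t =>
    (H' h K hB.cont hB.norm_le hB.nrm_le t).trans (by gcongr; exact le_max_right _ _), fun t =>
    (H h K K hB.cont hB.norm_le hK hB.nrm_le t).trans (ENNReal.ofReal_le_ofReal ?_)⟩
  gcongr
  · exact le_max_left _ _
  · linarith [abs_nonneg t]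

lemma free (hN : 1 ≤ N) (h0 : 0 < γ) (h1 : γ < 1) (hκ : 0 ≤ κ) (hm0 : 0 ≤ m) (hm1 : m < γ)
    (hκm : (N : ℝ) / 2 * κ + m / γ ≤ N / 2) :
    ∃ C > 0, ∀ (w : C0 N) (ε : ℝ), ‖w‖ ≤ ε → nrm 1 w ≤ ENNReal.ofReal ε →
      Bd κ m (C * ε) (fun t => subord (wrightFn γ) (|t| ^ γ) w) := by
  obtain ⟨C, hC, H⟩ := nrm_subord_wrightFn_le (N := N) hN h0 h1 hκ (x := m / γ) (by positivity)
    ((div_lt_one h0).2 hm1) hκm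
  set C' := ∫ θ in Set.Ioi (0:ℝ), ‖wrightFn γ θ‖ with hC'
  have hk := integrableOn_wrightFn h0 h1
  refine ⟨max C C', lt_max_of_lt_left hC, fun w ε hw hw1 => ⟨?_, fun t => ?_, fun t => ?_⟩⟩
  · exact (continuous_subord hk).comp (f := fun t : ℝ => (|t| ^ γ, w))
      ((Continuous.rpow_const continuous_abs fun _ => Or.inr h0.le).prodMk continuous_const)
  · refine (norm_subord_le hk _ w).trans ?_
    have hC0 : 0 ≤ max C C' := (lt_max_of_lt_left hC).le
    gcongr
    exact le_max_right _ _
  · have := H w ε hw hw1 t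
    rw [mul_div_cancel₀ _ h0.ne'] at this
    refine this.trans (ENNReal.ofReal_le_ofReal ?_)
    have hε : 0 ≤ ε := (norm_nonneg _).trans hw
    gcongr
    exact le_max_left _ _

variable {p : ℝ} {f : ℝ → ℝ}

lemma nl (hf : PowerLip p f) (hp : 1 ≤ p) (H : Bd κ m K h) :
    Bd (p * κ) (p * m) (p * K ^ p) (fun t => C0.nl hf hp (h t)) := by
  have hK := H.nonneg
  refine ⟨(continuous_nl hf hp).comp H.cont, fun t => norm_nl_le hf hp (H.norm_le t), fun t =>
    (nrm_nl_le hf hp (by positivity) (H.nrm_le t)).trans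
      (ENNReal.ofReal_le_ofReal (le_of_eq ?_))⟩
  rw [Real.mul_rpow hK (by positivity), ← Real.rpow_mul (by positivity), mul_assoc]
  congr 3
  ring

lemma nl_sub (hf : PowerLip p f) (hp : 1 ≤ p) (hκ : p * κ ≤ 1) {R d : ℝ} (hR : 0 < R)
    (hd : 0 < d) (H : Bd κ m R h) (H' : Bd κ m R h') (Hd : Bd κ m d (fun t => h t - h' t)) :
    Bd (p * κ) (p * m) (3 * p * R ^ (p - 1) * d)
      (fun t => C0.nl hf hp (h t) - C0.nl hf hp (h' t)) := by
  refine ⟨((continuous_nl hf hp).comp H.cont).sub ((continuous_nl hf hp).comp H'.cont), fun t =>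
    (norm_nl_sub_le hf hp (H.norm_le t) (H'.norm_le t) (Hd.norm_le t)).trans ?_, fun t =>
    (nrm_nl_sub_le hf hp hκ (by positivity) (by positivity) (H.nrm_le t) (H'.nrm_le t)
      (Hd.nrm_le t)).trans (ENNReal.ofReal_le_ofReal (le_of_eq ?_))⟩
  · gcongr; linarith
  · have h1 : (0:ℝ) < 1 + |t| := by positivity
    rw [Real.mul_rpow hR.le (by positivity), ← Real.rpow_mul h1.le,
      show -(p * m) = -m * (p - 1) + -m by ring, Real.rpow_add h1]
    ring

/-- Contraction principle for curves with algebraic decay. -/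
lemma exists_fixedPoint (hκ : κ ≤ 1) {R : ℝ} (hR : 0 < R) (T : (ℝ → C0 N) → ℝ → C0 N)
    (hT : ∀ v, Bd κ m R v → Bd κ m R (T v))
    (hcontr : ∀ v v' d, Bd κ m R v → Bd κ m R v' → 0 < d → Bd κ m d (fun t => v t - v' t) →
      Bd κ m (d / 2) (fun t => T v t - T v' t)) :
    ∃ v, Bd κ m R v ∧ T v = v := by
  set s : ℕ → ℝ → C0 N := fun n => T^[n] (fun _ => 0) with hs
  have hs1 : ∀ n, s (n + 1) = T (s n) := fun n => Function.iterate_succ_apply' T n _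
  have hB : ∀ n, Bd κ m R (s n) := by
    intro n
    induction n with
    | zero => exact Bd.zero hR.le
    | succ n ih => rw [hs1]; exact hT _ ih
  have hstep : ∀ n, Bd κ m (R / 2 ^ n) (fun t => s (n + 1) t - s n t) := by
    intro n
    induction n with
    | zero => simpa [hs] using hB 1
    | succ n ih =>
      have := hcontr _ _ _ (hB (n + 1)) (hB n) (by positivity) ih
      rw [← hs1, ← hs1] at this
      rwa [pow_succ, ← div_div]
  have hdiff : ∀ n j, Bd κ m (2 * R / 2 ^ n - 2 * R / 2 ^ (n + j)) (fun t => s (n + j) t - s n t) := by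
    intro n j
    induction j with
    | zero => simpa using Bd.zero (κ := κ) (m := m) (N := N) le_rfl
    | succ j ih =>
      have := (hstep (n + j)).add hκ ih
      simp only [sub_add_sub_cancel] at this
      convert this using 1
      · rw [← add_assoc, pow_succ]; field_simp; ring
      · rfl
  have hdist : ∀ t n, dist (s n t) (s (n + 1) t) ≤ R * (1 / 2) ^ n := by
    intro t n
    rw [dist_comm, dist_eq_norm, one_div, inv_pow]
    exact (hstep n).norm_le t
  have hcauchy : ∀ t, CauchySeq fun n => s n t := fun t =>
    cauchySeq_of_le_geometric _ _ (by norm_num) (hdist t)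
  choose v hv using fun t => cauchySeq_tendsto_of_complete (hcauchy t)
  have hrate : ∀ n t, ‖v t - s n t‖ ≤ 2 * R / 2 ^ n := by
    intro n t
    have h1 : Tendsto (fun j => s (n + j) t - s n t) atTop (𝓝 (v t - s n t)) := by
      have := (hv t).comp (tendsto_add_atTop_nat n)
      simp only [Function.comp_def, add_comm _ n] at this
      exact this.sub_const _
    refine le_of_tendsto h1.norm (Eventually.of_forall fun j => ((hdiff n j).norm_le t).trans ?_)
    have : 0 < 2 * R / 2 ^ (n + j) := by positivity
    linarith
  have hgeom : Tendsto (fun n : ℕ => 2 * R / 2 ^ n) atTop (𝓝 0) := by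
    have := (tendsto_pow_atTop_nhds_zero_of_lt_one (r := (1 / 2 : ℝ)) (by norm_num)
      (by norm_num)).const_mul (2 * R)
    simpa [div_eq_mul_inv] using this
  have hcont : Continuous v := by
    have hu : TendstoUniformly s v atTop := by
      rw [Metric.tendstoUniformly_iff]
      intro e he
      filter_upwards [hgeom.eventually (gt_mem_nhds he)] with n hn t
      rw [dist_eq_norm]
      exact (hrate n t).trans_lt hn
    exact hu.continuous (Frequently.of_forall fun n => (hB n).cont)
  have hvB : Bd κ m R v := ⟨hcont, fun t => le_of_tendsto (hv t).norm
    (Eventually.of_forall fun n => (hB n).norm_le t), fun t =>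
    nrm_le_of_tendsto (hv t) tendsto_const_nhds fun n => (hB n).nrm_le t⟩
  have hvn : ∀ n, Bd κ m (2 * R / 2 ^ n) (fun t => v t - s n t) := by
    refine fun n => ⟨hcont.sub (hB n).cont, hrate n, fun t => ?_⟩
    have h1 : Tendsto (fun j => s (n + j) t - s n t) atTop (𝓝 (v t - s n t)) := by
      have := (hv t).comp (tendsto_add_atTop_nat n)
      simp only [Function.comp_def, add_comm _ n] at this
      exact this.sub_const _
    refine nrm_le_of_tendsto h1 tendsto_const_nhds fun j => ((hdiff n j).mono ?_).nrm_le t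
    have : 0 < 2 * R / 2 ^ (n + j) := by positivity
    linarith
  refine ⟨v, hvB, funext fun t => ?_⟩
  have hlim : Tendsto (fun n => s (n + 1) t) atTop (𝓝 (T v t)) := by
    rw [tendsto_iff_norm_sub_tendsto_zero]
    refine squeeze_zero (fun _ => norm_nonneg _) (fun n => ?_) hgeom
    have := (hcontr _ _ _ hvB (hB n) (by positivity) (hvn n)).norm_le t
    rw [hs1, norm_sub_rev]
    refine this.trans ?_
    have : 0 < 2 * R / 2 ^ n := by positivity
    linarith
  exact tendsto_nhds_unique hlim ((hv t).comp (tendsto_add_atTop_nat 1))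

end Bd

end C0

end

section

variable {N : ℕ}

namespace C0

variable {p q γ γ₁ γ₂ κ κ' m m' : ℝ} {f g : ℝ → ℝ}

/-- One component of the Duhamel map. -/
def duhamelMap (γ : ℝ) (hf : PowerLip p f) (hp : 1 ≤ p) (w : C0 N) (v : ℝ → C0 N) (t : ℝ) : C0 N :=
  subord (wrightFn γ) (|t| ^ γ) w + duhamel γ (fun τ => nl hf hp (v τ)) |t|

/-- Bounds for one component of the Duhamel map, with Lipschitz dependence. -/
lemma exists_duhamelMap_bounds (hN : 1 ≤ N) (h0 : 0 < γ) (h1 : γ < 1) (hf : PowerLip p f)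
    (hp : 1 ≤ p) {x : ℝ} (hx : (N : ℝ) / 2 * (p * κ - κ') = x) (hx0 : 0 ≤ x) (hx1 : x < 1)
    (hκ' : 0 ≤ κ') (hκ0 : 0 < κ) (hκ1 : p * κ ≤ 1) (hm0 : 0 < m) (hm1 : p * m < 1)
    (hm'0 : 0 ≤ m') (hm' : γ * (1 - x) - p * m ≤ -m')
    (hm'1 : m' < γ) (hdata : (N : ℝ) / 2 * κ' + m' / γ ≤ N / 2) :
    ∃ C ≥ 1, (∀ (w : C0 N) (v : ℝ → C0 N) (ε R : ℝ), ‖w‖ ≤ ε → nrm 1 w ≤ ENNReal.ofReal ε →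
        Bd κ m R v → Bd κ' m' (C * ε + C * R ^ p) (duhamelMap γ hf hp w v)) ∧
      (∀ (w : C0 N) (v v' : ℝ → C0 N) (R d : ℝ), 0 < R → 0 < d → Bd κ m R v → Bd κ m R v' →
        Bd κ m d (fun t => v t - v' t) → Bd κ' m' (C * R ^ (p - 1) * d)
          (fun t => duhamelMap γ hf hp w v t - duhamelMap γ hf hp w v' t)) := by
  have hNpos : (0:ℝ) < N := by exact_mod_cast hN
  have hle : κ' ≤ p * κ := by
    have : p * κ - κ' = x / (N / 2) := by rw [← hx]; field_simp
    have h2 : 0 ≤ x / ((N:ℝ) / 2) := by positivity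
    linarith
  have hcond : γ * (1 - (N : ℝ) / 2 * (p * κ)) ≤ p * m := by
    have h2 : (N : ℝ) / 2 * (p * κ) = x + N / 2 * κ' := by rw [← hx]; ring
    have h3 : 0 ≤ γ * ((N : ℝ) / 2 * κ') := by positivity
    rw [h2]; nlinarith
  obtain ⟨A, hA, HA⟩ := Bd.duhamel (N := N) hN h0 h1 hx hx1 hκ' hle (by positivity) hκ1
    (by positivity) hm1 hcond hm'
  obtain ⟨A', hA', HA'⟩ := Bd.free (N := N) hN h0 h1 hκ' hm'0 hm'1 hdata
  refine ⟨A' + 3 * p * A + 1, by nlinarith [mul_pos (by linarith : 0 < p) hA], ?_, ?_⟩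
  · intro w v ε R hw hw1 hv
    have hR := hv.nonneg
    have hε := (norm_nonneg _).trans hw
    refine ((HA' w ε hw hw1).add (hle.trans hκ1) (HA _ _ (hv.nl hf hp))).mono ?_
    have h2 : 0 ≤ R ^ p := by positivity
    have hpA : 0 < p * A := by positivity
    have h3 : A * (p * R ^ p) ≤ (A' + 3 * p * A + 1) * R ^ p := by
      rw [← mul_assoc]; gcongr; nlinarith
    have h4 : A' * ε ≤ (A' + 3 * p * A + 1) * ε := by gcongr; nlinarith
    linarith
  · intro w v v' R d hR hd hv hv' hvv
    have hB := HA _ _ (hv.nl_sub hf hp hκ1 hR hd hv' hvv)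
    have heq : (fun t => duhamelMap γ hf hp w v t - duhamelMap γ hf hp w v' t) =
        fun t => duhamel γ (fun τ => nl hf hp (v τ) - nl hf hp (v' τ)) |t| := by
      funext t
      rw [duhamel_sub h0 h1 (hv.nl hf hp).cont (hv.nl hf hp).norm_le (hv'.nl hf hp).cont
        (hv'.nl hf hp).norm_le]
      exact add_sub_add_left_eq_sub _ _ _
    rw [heq]
    refine hB.mono ?_
    have h2 : 0 ≤ R ^ (p - 1) * d := by positivity
    calc A * (3 * p * R ^ (p - 1) * d) = (3 * p * A) * (R ^ (p - 1) * d) := by ring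
      _ ≤ (A' + 3 * p * A + 1) * (R ^ (p - 1) * d) := by gcongr; linarith
      _ = _ := by ring

lemma _root_.exists_small_radius {A q : ℝ} (hA : 1 ≤ A) (hq : 1 < q) :
    ∃ R, 0 < R ∧ R ≤ 1 ∧ A * R ^ (q - 1) = 1 := by
  have hq0 : q - 1 ≠ 0 := by linarith
  refine ⟨(A⁻¹) ^ (q - 1)⁻¹, by positivity, Real.rpow_le_one (by positivity)
    (inv_le_one_of_one_le₀ hA) (inv_nonneg.2 (by linarith)), ?_⟩
  rw [← Real.rpow_mul (by positivity), inv_mul_cancel₀ hq0, Real.rpow_one,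
    mul_inv_cancel₀ (by linarith)]

/-- Global solutions of the coupled Duhamel system for small data. -/
lemma exists_system_solution (hN : 1 ≤ N) (h0 : 0 < γ₁) (h1 : γ₁ < 1) (h0' : 0 < γ₂) (h1' : γ₂ < 1)
    (hf : PowerLip p f) (hp : 1 ≤ p) (hg : PowerLip q g) (hq : 1 < q) {κ₁ κ₂ a b δ : ℝ}
    (hx : (N : ℝ) / 2 * (p * κ₂ - κ₁) = δ) (hx' : (N : ℝ) / 2 * (q * κ₁ - κ₂) = δ)
    (hδ0 : 0 ≤ δ) (hδ1 : δ < 1) (hκ₁ : 0 < κ₁) (hκ₂ : 0 < κ₂) (hpκ : p * κ₂ ≤ 1)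
    (hqκ : q * κ₁ ≤ 1) (ha0 : 0 < a) (hb0 : 0 < b) (hpb : p * b < 1) (hqa : q * a < 1)
    (ha : γ₁ * (1 - δ) - p * b = -a) (hb : γ₂ * (1 - δ) - q * a = -b) (haγ : a < γ₁)
    (hbγ : b < γ₂) (hda : (N : ℝ) / 2 * κ₁ + a / γ₁ ≤ N / 2)
    (hdb : (N : ℝ) / 2 * κ₂ + b / γ₂ ≤ N / 2) :
    ∃ ε₀ > 0, ∀ u₀ v₀ : C0 N, ‖u₀‖ ≤ ε₀ → nrm 1 u₀ ≤ ENNReal.ofReal ε₀ → ‖v₀‖ ≤ ε₀ →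
      nrm 1 v₀ ≤ ENNReal.ofReal ε₀ → ∃ (u v : ℝ → C0 N) (K : ℝ), Bd κ₁ a K u ∧ Bd κ₂ b K v ∧
        u = duhamelMap γ₁ hf hp u₀ v ∧ v = duhamelMap γ₂ hg hq.le v₀ u := by
  obtain ⟨A, hA, HA, HA'⟩ := exists_duhamelMap_bounds hN h0 h1 hf hp hx hδ0 hδ1 hκ₁.le hκ₂ hpκ hb0
    hpb ha0.le ha.le haγ hda
  obtain ⟨B, hB, HB, HB'⟩ := exists_duhamelMap_bounds hN h0' h1' hg hq.le hx' hδ0 hδ1 hκ₂.le hκ₁ hqκ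
    ha0 hqa hb0.le hb.le hbγ hdb
  have hpow : 1 ≤ (2 * A) ^ q := Real.one_le_rpow (by linarith) (by linarith)
  obtain ⟨R, hR, hR1, hRq⟩ := exists_small_radius (A := 2 * B * (2 * A) ^ q) (q := q)
    (one_le_mul_of_one_le_of_one_le (by linarith) hpow) hq
  have hAR : 0 < 2 * A * R := by positivity
  have hLR : B * (2 * A * R) ^ (q - 1) * (2 * A) = 1 / 2 := by
    rw [Real.mul_rpow (by linarith) hR.le, Real.rpow_sub_one (by linarith : 2 * A ≠ 0)]
    have : 2 * (B * ((2 * A) ^ q / (2 * A) * R ^ (q - 1)) * (2 * A)) = 1 := by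
      rw [show 2 * (B * ((2 * A) ^ q / (2 * A) * R ^ (q - 1)) * (2 * A)) =
        2 * B * (2 * A) ^ q * R ^ (q - 1) by field_simp, hRq]
    linarith
  have hLR' : B * (2 * A * R) ^ q = R / 2 := by
    have h2 : (2 * A * R) ^ q = (2 * A * R) ^ (q - 1) * (2 * A * R) := by
      rw [Real.rpow_sub_one hAR.ne']; field_simp
    rw [h2]
    linear_combination R * hLR
  refine ⟨R / (2 * A * B), by positivity, fun u₀ v₀ hu hu1 hv hv1 => ?_⟩
  have hεA : A * (R / (2 * A * B)) ≤ R := by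
    rw [show A * (R / (2 * A * B)) = R / (2 * B) by field_simp]
    exact div_le_self hR.le (by linarith)
  have hεB : B * (R / (2 * A * B)) ≤ R / 2 := by
    rw [show B * (R / (2 * A * B)) = R / 2 / A by field_simp]
    exact div_le_self (by linarith) hA
  have hRp : R ^ p ≤ R := by
    simpa using Real.rpow_le_rpow_of_exponent_ge hR hR1 hp
  have hRp1 : R ^ (p - 1) ≤ 1 := Real.rpow_le_one hR.le hR1 (by linarith)
  have hΦ : ∀ v, Bd κ₂ b R v → Bd κ₁ a (2 * A * R) (duhamelMap γ₁ hf hp u₀ v) := by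
    intro v hvB
    refine (HA u₀ v _ R hu hu1 hvB).mono ?_
    have h2 : A * R ^ p ≤ A * R := mul_le_mul_of_nonneg_left hRp (by linarith)
    have h3 : R ≤ A * R := le_mul_of_one_le_left hR.le hA
    linarith
  have hself : ∀ v, Bd κ₂ b R v →
      Bd κ₂ b R (duhamelMap γ₂ hg hq.le v₀ (duhamelMap γ₁ hf hp u₀ v)) := by
    intro v hvB
    refine (HB v₀ _ _ _ hv hv1 (hΦ v hvB)).mono ?_
    linarith
  have hcontr : ∀ v v' d, Bd κ₂ b R v → Bd κ₂ b R v' → 0 < d → Bd κ₂ b d (fun t => v t - v' t) →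
      Bd κ₂ b (d / 2) (fun t => duhamelMap γ₂ hg hq.le v₀ (duhamelMap γ₁ hf hp u₀ v) t -
        duhamelMap γ₂ hg hq.le v₀ (duhamelMap γ₁ hf hp u₀ v') t) := by
    intro v v' d hvB hvB' hd hvv
    have h2 : Bd κ₁ a (2 * A * d) (fun t => duhamelMap γ₁ hf hp u₀ v t -
        duhamelMap γ₁ hf hp u₀ v' t) := by
      refine (HA' u₀ v v' R d hR hd hvB hvB' hvv).mono ?_
      calc A * R ^ (p - 1) * d ≤ A * 1 * d := by gcongr
        _ ≤ 2 * A * d := by linarith [mul_pos (by linarith : 0 < A) hd]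
    refine (HB' v₀ _ _ _ _ hAR (by positivity) (hΦ v hvB) (hΦ v' hvB') h2).mono (le_of_eq ?_)
    linear_combination d * hLR
  obtain ⟨v, hvB, hvfix⟩ := Bd.exists_fixedPoint
    ((le_mul_of_one_le_left hκ₂.le hp).trans hpκ) hR
    (fun v => duhamelMap γ₂ hg hq.le v₀ (duhamelMap γ₁ hf hp u₀ v)) hself hcontr
  exact ⟨duhamelMap γ₁ hf hp u₀ v, v, 2 * A * R, hΦ v hvB,
    hvB.mono (le_mul_of_one_le_left hR.le (by linarith)), rfl,
    hvfix.symm⟩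

end C0

end

section

variable {N : ℕ}

namespace C0

variable {p q γ γ₁ γ₂ K₁ K₂ A B : ℝ} {f g : ℝ → ℝ}

/-- Decay of `v` in one Lebesgue space gives decay of its Duhamel image in another. -/
lemma exists_bd_duhamelMap (hN : 1 ≤ N) (h0 : 0 < γ) (h1 : γ < 1) (hf : PowerLip p f) (hp : 1 ≤ p)
    {w : C0 N} {v : ℝ → C0 N} {ε k k' m m' : ℝ} (hw : ‖w‖ ≤ ε) (hw1 : nrm 1 w ≤ ENNReal.ofReal ε)
    (hv : ∃ R, Bd (2 * k / N) m R v) (hx0 : 0 ≤ p * k - k') (hx1 : p * k - k' < 1) (hk' : 0 ≤ k')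
    (hk0 : 0 < k) (hk1 : p * k ≤ N / 2) (hm0 : 0 < m) (hm1 : p * m < 1) (hm'0 : 0 ≤ m')
    (hm' : γ * (1 - (p * k - k')) - p * m ≤ -m') (hm'1 : m' < γ)
    (hdata : γ * k' + m' ≤ γ * (N / 2)) :
    ∃ R, Bd (2 * k' / N) m' R (duhamelMap γ hf hp w v) := by
  have hN0 : (0 : ℝ) < N := by exact_mod_cast hN
  obtain ⟨R, hR⟩ := hv
  have hx : (N : ℝ) / 2 * (p * (2 * k / N) - 2 * k' / N) = p * k - k' := by field_simp
  have hκ1 : p * (2 * k / N) ≤ 1 := by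
    rw [show p * (2 * k / N) = p * k / (N / 2) by field_simp]
    exact (div_le_one (by positivity)).2 hk1
  have hd : (N : ℝ) / 2 * (2 * k' / N) + m' / γ ≤ N / 2 := by
    rw [show (N : ℝ) / 2 * (2 * k' / N) + m' / γ = (γ * k' + m') / γ by field_simp, div_le_iff₀ h0]
    linarith
  obtain ⟨C, -, hC, -⟩ := exists_duhamelMap_bounds hN h0 h1 hf hp hx hx0 hx1 (by positivity)
    (by positivity) hκ1 hm0 hm1 hm'0 hm' hm'1 hd
  exact ⟨_, hC w v ε R hw hw1 hR⟩

/-- Admissible interpolation parameters. -/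
structure Adm (N : ℕ) (p q γ₁ γ₂ K₁ K₂ A B δ : ℝ) : Prop where
  pos : 0 < δ
  lt_one : δ < 1
  hpk : p * (δ * K₂) < N / 2
  hqk : q * (δ * K₁) < N / 2
  hpb : p * ((1 - δ) * B) < 1
  hqa : q * ((1 - δ) * A) < 1
  haγ : (1 - δ) * A < γ₁
  hbγ : (1 - δ) * B < γ₂
  hda : γ₁ * (δ * K₁) + (1 - δ) * A ≤ γ₁ * (N / 2)
  hdb : γ₂ * (δ * K₂) + (1 - δ) * B ≤ γ₂ * (N / 2)

/-- Pairs of interpolation parameters between which decay estimates transfer in one step. -/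
def transferSet (N : ℕ) (p q γ₁ γ₂ K₁ K₂ A B c : ℝ) : Set (ℝ × ℝ) :=
  {z | z.1 + |z.1 - z.2| * c < 1 ∧ |z.1 - z.2| * c < z.1 * K₂ ∧
    (1 - z.1) * B + γ₂ * (|z.1 - z.2| * c) < γ₂ ∧
    p * ((1 - z.1) * B + γ₂ * (|z.1 - z.2| * c)) < 1 ∧
    0 < p * (z.1 * K₂ - |z.1 - z.2| * c) - z.2 * K₁ ∧
    p * (z.1 * K₂ - |z.1 - z.2| * c) - z.2 * K₁ < 1 ∧
    |z.1 - z.2| * c < z.1 ∧ 0 < (1 - z.1) * A - γ₁ * (|z.1 - z.2| * c) ∧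
    q * (z.1 * K₁ + |z.1 - z.2| * c) < N / 2 ∧
    0 < q * (z.1 * K₁ + |z.1 - z.2| * c) - z.2 * K₂ ∧
    q * (z.1 * K₁ + |z.1 - z.2| * c) - z.2 * K₂ < 1}

lemma isOpen_transferSet (N : ℕ) (p q γ₁ γ₂ K₁ K₂ A B c : ℝ) :
    IsOpen (transferSet N p q γ₁ γ₂ K₁ K₂ A B c) := by
  unfold transferSet
  simp only [Set.ofPred_and]
  repeat' apply IsOpen.inter
  all_goals exact isOpen_lt (by fun_prop) (by fun_prop)

lemma Adm.diag_mem {δ : ℝ} (h : Adm N p q γ₁ γ₂ K₁ K₂ A B δ) (c : ℝ) (hK₂ : 0 < K₂) (hA : 0 < A)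
    (h1 : p * K₂ - K₁ = 1) (h2 : q * K₁ - K₂ = 1) :
    (δ, δ) ∈ transferSet N p q γ₁ γ₂ K₁ K₂ A B c := by
  have e1 : p * (δ * K₂) - δ * K₁ = δ := by linear_combination δ * h1
  have e2 : q * (δ * K₁) - δ * K₂ = δ := by linear_combination δ * h2
  have := h.pos
  have := h.lt_one
  simp only [transferSet, Set.mem_ofPred_eq, sub_self, abs_zero, zero_mul, mul_zero, add_zero,
    sub_zero, e1, e2]
  exact ⟨h.lt_one, by positivity, h.hbγ, h.hpb, h.pos, h.lt_one, h.pos,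
    mul_pos (by linarith) hA, h.hqk, h.pos, h.lt_one⟩

/-- Simultaneous decay of both components at interpolation parameter `δ`. -/
def Decay (K₁ K₂ A B : ℝ) (u v : ℝ → C0 N) (δ : ℝ) : Prop :=
  (∃ R, Bd (2 * (δ * K₁) / N) ((1 - δ) * A) R u) ∧ ∃ R, Bd (2 * (δ * K₂) / N) ((1 - δ) * B) R v

variable {c ε : ℝ} {u₀ v₀ : C0 N} {u v : ℝ → C0 N}

lemma Decay.transfer (hN : 1 ≤ N) (hγ₁ : 0 < γ₁) (hγ : γ₁ ≤ γ₂) (hγ₂ : γ₂ < 1)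
    (hf : PowerLip p f) (hp : 1 ≤ p) (hg : PowerLip q g) (hq : 1 ≤ q)
    (hc : 0 ≤ c) (h1 : p * K₂ - K₁ = 1) (h2 : q * K₁ - K₂ = 1) (h3 : p * B - A = γ₁)
    (h4 : q * A - B = γ₂) (hK₁ : K₁ = c * (p + 1)) (hK₂ : K₂ = c * (q + 1))
    (hA : A = c * (γ₁ + p * γ₂)) (hB : B = c * (γ₂ + q * γ₁))
    (hA0 : 0 < A) (hB0 : 0 < B) (hK₁0 : 0 < K₁) (hK₂0 : 0 < K₂)
    (hu₀ : ‖u₀‖ ≤ ε) (hu₁ : nrm 1 u₀ ≤ ENNReal.ofReal ε) (hv₀ : ‖v₀‖ ≤ ε)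
    (hv₁ : nrm 1 v₀ ≤ ENNReal.ofReal ε) (hu : u = duhamelMap γ₁ hf hp u₀ v)
    (hv : v = duhamelMap γ₂ hg hq v₀ u) {δ δ' : ℝ} (hδ : Adm N p q γ₁ γ₂ K₁ K₂ A B δ)
    (hδ' : Adm N p q γ₁ γ₂ K₁ K₂ A B δ') (hn : (δ, δ') ∈ transferSet N p q γ₁ γ₂ K₁ K₂ A B c)
    (H : Decay K₁ K₂ A B u v δ) : Decay K₁ K₂ A B u v δ' := by
  obtain ⟨n1, n2, n3, n4, n5, n6, n7, n8, n9, n10, n11⟩ := hn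
  dsimp only at n1 n2 n3 n4 n5 n6 n7 n8 n9 n10 n11
  obtain ⟨Hu, Hv⟩ := H
  have hγ₂0 : 0 < γ₂ := hγ₁.trans_le hγ
  have hp0 : 0 < p := by linarith
  have hq0 : 0 < q := by linarith
  set η := |δ - δ'| * c with hη
  have hη0 : 0 ≤ η := by positivity
  have he1 : (δ - δ') * c ≤ η := mul_le_mul_of_nonneg_right (le_abs_self _) hc
  have he2 : -((δ - δ') * c) ≤ η := by
    rw [← neg_mul]; exact mul_le_mul_of_nonneg_right (neg_le_abs _) hc
  have hb0 : 0 < (1 - δ) * B := mul_pos (by linarith [hδ.lt_one]) hB0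
  have ha0 : 0 < (1 - δ) * A := mul_pos (by linarith [hδ.lt_one]) hA0
  have hb0' : 0 < (1 - δ') * B := mul_pos (by linarith [hδ'.lt_one]) hB0
  have ha0' : 0 < (1 - δ') * A := mul_pos (by linarith [hδ'.lt_one]) hA0
  have hγη₂ : 0 ≤ γ₂ * η := by positivity
  have hγη₁ : 0 ≤ γ₁ * η := by positivity
  have hk1 : 0 < δ * K₁ := mul_pos hδ.pos hK₁0
  have hk2 : 0 < δ * K₂ := mul_pos hδ.pos hK₂0
  have hk1' : 0 < δ' * K₁ := mul_pos hδ'.pos hK₁0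
  have hk2' : 0 < δ' * K₂ := mul_pos hδ'.pos hK₂0
  have hpη : 0 ≤ p * η := by positivity
  have hqη : 0 ≤ q * (γ₁ * η) := by positivity
  constructor
  · have Hv' : ∃ R, Bd (2 * (δ * K₂ - η) / N) ((1 - δ) * B + γ₂ * η) R v := by
      have ex : q * (δ * K₁) - (δ * K₂ - η) = δ + η := by linear_combination δ * h2
      rw [hv]
      refine exists_bd_duhamelMap hN hγ₂0 hγ₂ hg hq hv₀ hv₁ Hu ?_ ?_ ?_ hk1 hδ.hqk.le ha0 hδ.hqa
        ?_ ?_ n3 ?_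
      · rw [ex]; linarith [hδ.pos]
      · rwa [ex]
      · linarith
      · linarith
      · rw [ex]; refine le_of_eq ?_; linear_combination -(1 - δ) * h4
      · linarith [hδ.hdb]
    rw [hu]
    refine exists_bd_duhamelMap hN hγ₁ (by linarith) hf hp hu₀ hu₁ Hv' n5.le n6 hk1'.le
      (by linarith) ?_ (by linarith) n4 ha0'.le ?_ hδ'.haγ hδ'.hda
    · linarith [hδ.hpk]
    · have e1 : γ₁ * (1 - (p * (δ * K₂ - η) - δ' * K₁)) - p * ((1 - δ) * B + γ₂ * η)
          + (1 - δ') * A = p * (γ₂ - γ₁) * ((δ - δ') * c - η) := by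
        linear_combination -γ₁ * δ * h1 - (1 - δ) * h3 - γ₁ * (δ - δ') * hK₁ + (δ - δ') * hA
      have e2 : p * (γ₂ - γ₁) * ((δ - δ') * c - η) ≤ 0 :=
        mul_nonpos_of_nonneg_of_nonpos (mul_nonneg hp0.le (by linarith)) (by linarith)
      linarith
  · have Hu' : ∃ R, Bd (2 * (δ * K₁ + η) / N) ((1 - δ) * A - γ₁ * η) R u := by
      have ex : p * (δ * K₂) - (δ * K₁ + η) = δ - η := by linear_combination δ * h1
      rw [hu]
      refine exists_bd_duhamelMap hN hγ₁ (by linarith) hf hp hu₀ hu₁ Hv ?_ ?_ ?_ hk2 hδ.hpk.le hb0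
        hδ.hpb ?_ ?_ ?_ ?_
      · rw [ex]; linarith
      · rw [ex]; linarith [hδ.lt_one]
      · linarith
      · linarith
      · rw [ex]; refine le_of_eq ?_; linear_combination -(1 - δ) * h3
      · linarith [hδ.haγ]
      · linarith [hδ.hda]
    rw [hv]
    refine exists_bd_duhamelMap hN hγ₂0 hγ₂ hg hq hv₀ hv₁ Hu' n10.le n11 hk2'.le
      (by linarith) n9.le n8 ?_ hb0'.le ?_ hδ'.hbγ hδ'.hdb
    · linarith [hδ.hqa]
    · have e1 : γ₂ * (1 - (q * (δ * K₁ + η) - δ' * K₂)) - q * ((1 - δ) * A - γ₁ * η)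
          + (1 - δ') * B = -(q * (γ₂ - γ₁) * ((δ - δ') * c + η)) := by
        linear_combination -γ₂ * δ * h2 - (1 - δ) * h4 - γ₂ * (δ - δ') * hK₂ + (δ - δ') * hB
      have e2 : 0 ≤ q * (γ₂ - γ₁) * ((δ - δ') * c + η) :=
        mul_nonneg (mul_nonneg hq0.le (by linarith)) (by linarith)
      linarith

/-- Decay at one admissible parameter propagates to an interval of admissible parameters. -/
lemma Decay.propagate (hN : 1 ≤ N) (hγ₁ : 0 < γ₁) (hγ : γ₁ ≤ γ₂) (hγ₂ : γ₂ < 1)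
    (hf : PowerLip p f) (hp : 1 ≤ p) (hg : PowerLip q g) (hq : 1 ≤ q)
    (hc : 0 ≤ c) (h1 : p * K₂ - K₁ = 1) (h2 : q * K₁ - K₂ = 1) (h3 : p * B - A = γ₁)
    (h4 : q * A - B = γ₂) (hK₁ : K₁ = c * (p + 1)) (hK₂ : K₂ = c * (q + 1))
    (hA : A = c * (γ₁ + p * γ₂)) (hB : B = c * (γ₂ + q * γ₁))
    (hA0 : 0 < A) (hB0 : 0 < B) (hK₁0 : 0 < K₁) (hK₂0 : 0 < K₂)
    (hu₀ : ‖u₀‖ ≤ ε) (hu₁ : nrm 1 u₀ ≤ ENNReal.ofReal ε) (hv₀ : ‖v₀‖ ≤ ε)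
    (hv₁ : nrm 1 v₀ ≤ ENNReal.ofReal ε) (hu : u = duhamelMap γ₁ hf hp u₀ v)
    (hv : v = duhamelMap γ₂ hg hq v₀ u) {s : Set ℝ} (hs : IsPreconnected s)
    (hadm : ∀ δ ∈ s, Adm N p q γ₁ γ₂ K₁ K₂ A B δ) {δ δ' : ℝ} (hδ : δ ∈ s) (hδ' : δ' ∈ s)
    (H : Decay K₁ K₂ A B u v δ) : Decay K₁ K₂ A B u v δ' := by
  refine hs.induction₂' (fun x y => Decay K₁ K₂ A B u v x → Decay K₁ K₂ A B u v y)
    (fun x hx => ?_) (fun _ _ _ _ _ _ hxy hyz h => hyz (hxy h)) hδ hδ' H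
  have hmem := (isOpen_transferSet N p q γ₁ γ₂ K₁ K₂ A B c).mem_nhds
    ((hadm x hx).diag_mem c hK₂0 hA0 h1 h2)
  have e1 : ∀ᶠ y in 𝓝 x, (x, y) ∈ transferSet N p q γ₁ γ₂ K₁ K₂ A B c :=
    (by fun_prop : Continuous fun y : ℝ => (x, y)).continuousAt.eventually hmem
  have e2 : ∀ᶠ y in 𝓝 x, (y, x) ∈ transferSet N p q γ₁ γ₂ K₁ K₂ A B c :=
    (by fun_prop : Continuous fun y : ℝ => (y, x)).continuousAt.eventually hmem
  filter_upwards [nhdsWithin_le_nhds e1, nhdsWithin_le_nhds e2, self_mem_nhdsWithin] with y hy1 hy2 hy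
  exact ⟨Decay.transfer hN hγ₁ hγ hγ₂ hf hp hg hq hc h1 h2 h3 h4 hK₁ hK₂ hA hB hA0 hB0 hK₁0 hK₂0
      hu₀ hu₁ hv₀ hv₁ hu hv (hadm x hx) (hadm y hy) hy1,
    Decay.transfer hN hγ₁ hγ hγ₂ hf hp hg hq hc h1 h2 h3 h4 hK₁ hK₂ hA hB hA0 hB0 hK₁0 hK₂0
      hu₀ hu₁ hv₀ hv₁ hu hv (hadm y hy) (hadm x hx) hy2⟩

end C0

end

section

variable {N : ℕ}

namespace C0

variable {p q γ γ₁ γ₂ κ m K s δ : ℝ} {f g : ℝ → ℝ}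

lemma duhamelMap_zero (h0 : 0 < γ) (h1 : γ < 1) (hf : PowerLip p f) (hp : 1 ≤ p) (w : C0 N)
    (v : ℝ → C0 N) : duhamelMap γ hf hp w v 0 = w := by
  unfold duhamelMap duhamel
  rw [abs_zero, Real.zero_rpow h0.ne', subord_zero, integral_wrightFn h0 h1, one_smul, zero_smul,
    add_zero]

lemma duhamelMap_apply (h0 : 0 < γ) (h1 : γ < 1) (hf : PowerLip p f) (hp : 1 ≤ p) (w : C0 N)
    {v : ℝ → C0 N} (hv : Bd κ m K v) {t : ℝ} (ht : 0 < t) (x : Euc N) :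
    duhamelMap γ hf hp w v t x = Pop N γ t w x +
      ∫ τ in (0:ℝ)..t, (t - τ) ^ (γ - 1) * Sop N γ (t - τ) (fun y => f (v τ y)) x := by
  have h2 := duhamel_apply h0 h1 (h := fun τ => nl hf hp (v τ))
    ((continuous_nl hf hp).comp hv.cont) (fun t => norm_nl_le hf hp (hv.norm_le t)) ht x
  rw [duhamelMap, abs_of_pos ht, ZeroAtInftyContinuousMap.add_apply,
    subord_wrightFn_apply h0 h1 ht, h2]
  rfl

lemma isMildSolution_of_eq_duhamelMap (h0 : 0 < γ₁) (h1 : γ₁ < 1) (h0' : 0 < γ₂) (h1' : γ₂ < 1)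
    (hf : PowerLip p f) (hp : 1 ≤ p) (hg : PowerLip q g) (hq : 1 ≤ q) {u₀ v₀ : C0 N}
    {u v : ℝ → C0 N} {κ' m' K' : ℝ} (Hu : Bd κ m K u) (Hv : Bd κ' m' K' v)
    (hu : u = duhamelMap γ₁ hf hp u₀ v) (hv : v = duhamelMap γ₂ hg hq v₀ u) :
    IsMildSolution N γ₁ γ₂ f g u₀ v₀ (Set.Ici 0) u v := by
  refine ⟨Hu.cont.continuousOn, Hv.cont.continuousOn, ?_, ?_, fun t _ ht x => ⟨?_, ?_⟩⟩
  · exact (congrFun hu 0).trans (duhamelMap_zero h0 h1 hf hp u₀ v)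
  · exact (congrFun hv 0).trans (duhamelMap_zero h0' h1' hg hq v₀ u)
  · exact (congrArg (fun w : C0 N => w x) (congrFun hu t)).trans
      (duhamelMap_apply h0 h1 hf hp u₀ Hv ht x)
  · exact (congrArg (fun w : C0 N => w x) (congrFun hv t)).trans
      (duhamelMap_apply h0' h1' hg hq v₀ Hu ht x)

/-- Decay estimate in the Lebesgue space of exponent `s`. -/
lemma Bd.eLpNorm_le {h : ℝ → C0 N} (H : Bd κ m K h) (hκ : 0 < κ) (hs : 1 / s = κ) {t : ℝ}
    (ht : 0 ≤ t) :
    eLpNorm (h t) (ENNReal.ofReal s) volume ≤ ENNReal.ofReal (K * (1 + t) ^ (-m)) := by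
  have hs' : s = κ⁻¹ := by rw [← hs, one_div, inv_inv]
  have := H.nrm_le t
  rw [abs_of_nonneg ht] at this
  rwa [hs', ENNReal.ofReal_inv_of_pos hκ]

lemma eLpNorm_eq_zero_of_exponent_nonpos (w : C0 N) (hκ : κ ≤ 0) (hs : 1 / s = κ) :
    eLpNorm w (ENNReal.ofReal s) volume = 0 := by
  have hs' : s = κ⁻¹ := by rw [← hs, one_div, inv_inv]
  rw [ENNReal.ofReal_of_nonpos (hs' ▸ inv_nonpos.2 hκ), eLpNorm_exponent_zero]

lemma adm_of_lt (hN : 1 ≤ N) (hp : 1 ≤ p) (hpq : p ≤ q) (hpq1 : 1 < p * q)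
    (hγ₁ : 0 < γ₁) (hγ₁₂ : γ₁ ≤ γ₂)
    (hdim : ((γ₂ - γ₁) * (p * q) + q * γ₂ + γ₁) / (γ₁ * (p * q - 1)) ≤ (N : ℝ) / 2)
    (hδ0 : 0 < δ) (hδ1 : δ < 1) (H1 : 1 - (p * q - 1) / (γ₂ * q * (p + 1)) < δ)
    (H2 : 1 - γ₁ * (p * q - 1) / (γ₂ * (p + 1)) < δ) (H3 : 1 - (p * q - 1) / (q + 1) < δ)
    (H4 : δ < (N : ℝ) * (p * q - 1) / (2 * q * (p + 1))) :
    Adm N p q γ₁ γ₂ ((p * q - 1)⁻¹ * (p + 1)) ((p * q - 1)⁻¹ * (q + 1))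
      ((p * q - 1)⁻¹ * (γ₁ + p * γ₂)) ((p * q - 1)⁻¹ * (γ₂ + q * γ₁)) δ := by
  have hD : 0 < p * q - 1 := by linarith
  have hp0 : 0 < p := by linarith
  have hq0 : 0 < q := by linarith
  have hγ₂ : 0 < γ₂ := by linarith
  have hε : 0 < 1 - δ := by linarith
  have hN0 : (0 : ℝ) < N := by exact_mod_cast hN
  have G1 : (1 - δ) * (γ₂ * q * (p + 1)) < p * q - 1 := by
    rw [← lt_div_iff₀ (by positivity)]; linarith
  have G2 : (1 - δ) * (γ₂ * (p + 1)) < γ₁ * (p * q - 1) := by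
    rw [← lt_div_iff₀ (by positivity)]; linarith
  have G3 : (1 - δ) * (q + 1) < p * q - 1 := by
    rw [← lt_div_iff₀ (by positivity)]; linarith
  have G4 : δ * (2 * q * (p + 1)) < N * (p * q - 1) := by
    rwa [← lt_div_iff₀ (by positivity)]
  have G5 : (γ₂ - γ₁) * (p * q) + q * γ₂ + γ₁ ≤ N / 2 * (γ₁ * (p * q - 1)) := by
    rwa [← div_le_iff₀ (by positivity)]
  have hA : γ₁ + p * γ₂ ≤ γ₂ * (p + 1) := by linarith
  have hB : γ₂ + q * γ₁ ≤ γ₂ * (q + 1) := by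
    have := mul_le_mul_of_nonneg_left hγ₁₂ hq0.le
    linarith
  have hpB : p * (γ₂ + q * γ₁) ≤ γ₂ * q * (p + 1) := by
    have e1 := mul_le_mul_of_nonneg_left hγ₁₂ (mul_pos hp0 hq0).le
    have e2 := mul_le_mul_of_nonneg_left hpq hγ₂.le
    linarith
  have hqA : q * (γ₁ + p * γ₂) ≤ γ₂ * q * (p + 1) := by
    have := mul_le_mul_of_nonneg_left hA hq0.le
    linarith
  have key : ∀ {x y : ℝ}, x < y * (p * q - 1) → (p * q - 1)⁻¹ * x < y := fun h => by
    rw [inv_mul_lt_iff₀ hD]; linarith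
  have key' : ∀ {x y : ℝ}, x ≤ y * (p * q - 1) → (p * q - 1)⁻¹ * x ≤ y := fun h => by
    rw [inv_mul_le_iff₀ hD]; linarith
  refine ⟨hδ0, hδ1, ?_, ?_, ?_, ?_, ?_, ?_, ?_, ?_⟩
  · rw [show p * (δ * ((p * q - 1)⁻¹ * (q + 1))) = (p * q - 1)⁻¹ * (δ * (p * (q + 1))) by ring]
    refine key ?_
    have : δ * (p * (q + 1)) ≤ δ * (q * (p + 1)) :=
      mul_le_mul_of_nonneg_left (by linarith) hδ0.le
    linarith
  · rw [show q * (δ * ((p * q - 1)⁻¹ * (p + 1))) = (p * q - 1)⁻¹ * (δ * (q * (p + 1))) by ring]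
    exact key (by linarith)
  · rw [show p * ((1 - δ) * ((p * q - 1)⁻¹ * (γ₂ + q * γ₁))) =
      (p * q - 1)⁻¹ * ((1 - δ) * (p * (γ₂ + q * γ₁))) by ring]
    exact key (by linarith [mul_le_mul_of_nonneg_left hpB hε.le])
  · rw [show q * ((1 - δ) * ((p * q - 1)⁻¹ * (γ₁ + p * γ₂))) =
      (p * q - 1)⁻¹ * ((1 - δ) * (q * (γ₁ + p * γ₂))) by ring]
    exact key (by linarith [mul_le_mul_of_nonneg_left hqA hε.le])
  · rw [mul_left_comm]
    exact key (by linarith [mul_le_mul_of_nonneg_left hA hε.le])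
  · rw [mul_left_comm]
    refine key ?_
    have e1 := mul_le_mul_of_nonneg_left hB hε.le
    have e2 := mul_lt_mul_of_pos_left G3 hγ₂
    linarith
  · rw [show γ₁ * (δ * ((p * q - 1)⁻¹ * (p + 1))) + (1 - δ) * ((p * q - 1)⁻¹ * (γ₁ + p * γ₂)) =
      (p * q - 1)⁻¹ * (γ₁ + p * γ₂ - δ * (p * (γ₂ - γ₁))) by ring]
    refine key' ?_
    have e1 : 0 ≤ δ * (p * (γ₂ - γ₁)) :=
      mul_nonneg hδ0.le (mul_nonneg hp0.le (by linarith))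
    have e2 : 0 ≤ (γ₂ - γ₁) * (p * q) := mul_nonneg (by linarith) (mul_pos hp0 hq0).le
    have e3 := mul_le_mul_of_nonneg_right hpq hγ₂.le
    linarith
  · rw [show γ₂ * (δ * ((p * q - 1)⁻¹ * (q + 1))) + (1 - δ) * ((p * q - 1)⁻¹ * (γ₂ + q * γ₁)) =
      (p * q - 1)⁻¹ * (γ₂ * (q + 1) - (1 - δ) * (q * (γ₂ - γ₁))) by ring]
    refine key' ?_
    have e1 : 0 ≤ (1 - δ) * (q * (γ₂ - γ₁)) :=
      mul_nonneg hε.le (mul_nonneg hq0.le (by linarith))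
    have e2 : 0 ≤ (γ₂ - γ₁) * (p * q) := mul_nonneg (by linarith) (mul_pos hp0 hq0).le
    have e3 := mul_le_mul_of_nonneg_left hγ₁₂ hq0.le
    have e4 : γ₁ * (q + 1) ≤ γ₁ * (N / 2 * (p * q - 1)) := by linarith
    have e5 := mul_le_mul_of_nonneg_left (le_of_mul_le_mul_left e4 hγ₁) hγ₂.le
    linarith

end C0

end

lemma exists_powerLip {p q : ℝ} (hp : 1 ≤ p) (hq : 1 ≤ q) {f g : ℝ → ℝ}
    (hfg :
      (∃ ε₁ ∈ ({-1, 1} : Set ℝ), ∃ ε₂ ∈ ({-1, 1} : Set ℝ),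
        f = (fun v => ε₁ * |v| ^ (p - 1) * v) ∧ g = fun u => ε₂ * |u| ^ (q - 1) * u) ∨
      (∃ ε₁ ∈ ({-1, 1} : Set ℝ), ∃ ε₂ ∈ ({-1, 1} : Set ℝ),
        f = (fun v => ε₁ * |v| ^ p) ∧ g = fun u => ε₂ * |u| ^ q)) :
    PowerLip p f ∧ PowerLip q g := by
  have habs : ∀ ε ∈ ({-1, 1} : Set ℝ), |ε| = 1 := by
    rintro ε (rfl | rfl) <;> simp
  rcases hfg with ⟨ε₁, h1, ε₂, h2, rfl, rfl⟩ | ⟨ε₁, h1, ε₂, h2, rfl, rfl⟩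
  · simp only [mul_assoc]
    exact ⟨(powerLip_abs_rpow_mul hp).const_mul (habs _ h1),
      (powerLip_abs_rpow_mul hq).const_mul (habs _ h2)⟩
  · exact ⟨(powerLip_abs_rpow hp).const_mul (habs _ h1),
      (powerLip_abs_rpow hq).const_mul (habs _ h2)⟩

/-- Global existence with small data and `Lˢ`-decay for the coupled fractional
diffusion system. -/
theorem global_existence_small_data
    (N : ℕ) (hN : 1 ≤ N) (p q γ₁ γ₂ : ℝ)
    (hp : 1 ≤ p) (hpq : p ≤ q) (hpq1 : 1 < p * q)
    (hγ₁ : 0 < γ₁) (hγ₁₂ : γ₁ ≤ γ₂) (hγ₂ : γ₂ < 1)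
    (f g : ℝ → ℝ)
    (hfg :
      (∃ ε₁ ∈ ({-1, 1} : Set ℝ), ∃ ε₂ ∈ ({-1, 1} : Set ℝ),
        f = (fun v => ε₁ * |v| ^ (p - 1) * v) ∧ g = fun u => ε₂ * |u| ^ (q - 1) * u) ∨
      (∃ ε₁ ∈ ({-1, 1} : Set ℝ), ∃ ε₂ ∈ ({-1, 1} : Set ℝ),
        f = (fun v => ε₁ * |v| ^ p) ∧ g = fun u => ε₂ * |u| ^ q))
    (hdim : ((γ₂ - γ₁) * (p * q) + q * γ₂ + γ₁) / (γ₁ * (p * q - 1)) ≤ (N : ℝ) / 2) :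
    ∃ ε₀ > (0:ℝ), ∀ δ : ℝ,
      1 - (p * q - 1) / (γ₂ * q * (p + 1)) < δ →
      1 - γ₁ * (p * q - 1) / (γ₂ * (p + 1)) < δ →
      1 - (p * q - 1) / (q + 1) < δ →
      δ < 1 → δ < (N : ℝ) * (p * q - 1) / (2 * q * (p + 1)) →
      ∀ s₁ s₂ : ℝ,
        1 / s₁ = (2 * δ / (N : ℝ)) * ((p + 1) / (p * q - 1)) →
        1 / s₂ = (2 * δ / (N : ℝ)) * ((q + 1) / (p * q - 1)) →
        ∀ u₀ v₀ : ZeroAtInftyContinuousMap (Euc N) ℝ,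
          Integrable (⇑u₀) volume → Integrable (⇑v₀) volume →
          eLpNorm (⇑u₀) 1 volume + eLpNorm (⇑u₀) ⊤ volume +
              eLpNorm (⇑v₀) 1 volume + eLpNorm (⇑v₀) ⊤ volume ≤ ENNReal.ofReal ε₀ →
          ∃ u v : ℝ → ZeroAtInftyContinuousMap (Euc N) ℝ,
            IsMildSolution N γ₁ γ₂ f g u₀ v₀ (Set.Ici 0) u v ∧
            (∃ M : ℝ, ∀ t : ℝ, 0 ≤ t →
              eLpNorm (⇑(u t)) ⊤ volume ≤ ENNReal.ofReal M ∧
              eLpNorm (⇑(u t)) (ENNReal.ofReal s₁) volume ≤ ENNReal.ofReal M ∧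
              eLpNorm (⇑(v t)) ⊤ volume ≤ ENNReal.ofReal M ∧
              eLpNorm (⇑(v t)) (ENNReal.ofReal s₂) volume ≤ ENNReal.ofReal M) ∧
            ∃ C > (0:ℝ), ∀ t : ℝ, 0 ≤ t →
              eLpNorm (⇑(u t)) (ENNReal.ofReal s₁) volume ≤
                ENNReal.ofReal (C * (1 + t) ^ (-((1 - δ) * (γ₁ + p * γ₂) / (p * q - 1)))) ∧
              eLpNorm (⇑(v t)) (ENNReal.ofReal s₂) volume ≤
                ENNReal.ofReal (C * (1 + t) ^ (-((1 - δ) * (γ₂ + q * γ₁) / (p * q - 1)))) := by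
  have hD : 0 < p * q - 1 := by linarith
  have hp0 : 0 < p := by linarith
  have hq0 : 0 < q := by linarith
  have hγ₂0 : 0 < γ₂ := by linarith
  have hN0 : (0 : ℝ) < N := by exact_mod_cast hN
  have hq1 : 1 < q := by
    by_contra! h
    linarith [mul_le_mul hpq h hq0.le hq0.le, mul_le_mul h h hq0.le zero_le_one]
  obtain ⟨hf, hg⟩ := exists_powerLip hp hq1.le hfg
  set c := (p * q - 1)⁻¹ with hc
  have hc0 : 0 < c := inv_pos.2 hD
  have hcD : c * (p * q - 1) = 1 := inv_mul_cancel₀ hD.ne'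
  set K₁ := c * (p + 1) with hK₁
  set K₂ := c * (q + 1) with hK₂
  set A := c * (γ₁ + p * γ₂) with hA
  set B := c * (γ₂ + q * γ₁) with hB
  have hK₁0 : 0 < K₁ := by positivity
  have hK₂0 : 0 < K₂ := by positivity
  have hA0 : 0 < A := by positivity
  have hB0 : 0 < B := by positivity
  have r1 : p * K₂ - K₁ = 1 := by linear_combination hcD
  have r2 : q * K₁ - K₂ = 1 := by linear_combination hcD
  have r3 : p * B - A = γ₁ := by linear_combination γ₁ * hcD
  have r4 : q * A - B = γ₂ := by linear_combination γ₂ * hcD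
  let S : Set ℝ := {δ | 0 < δ ∧ δ < 1 ∧ 1 - (p * q - 1) / (γ₂ * q * (p + 1)) < δ ∧
    1 - γ₁ * (p * q - 1) / (γ₂ * (p + 1)) < δ ∧ 1 - (p * q - 1) / (q + 1) < δ ∧
    δ < (N : ℝ) * (p * q - 1) / (2 * q * (p + 1))}
  have hS : IsPreconnected S := by
    refine Set.OrdConnected.isPreconnected ⟨fun x hx y hy z hz => ?_⟩
    obtain ⟨x1, -, x3, x4, x5, -⟩ := hx
    obtain ⟨-, y2, -, -, -, y6⟩ := hy
    exact ⟨x1.trans_le hz.1, hz.2.trans_lt y2, x3.trans_le hz.1, x4.trans_le hz.1,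
      x5.trans_le hz.1, hz.2.trans_lt y6⟩
  have hadm : ∀ δ ∈ S, C0.Adm N p q γ₁ γ₂ K₁ K₂ A B δ := fun δ ⟨d1, d2, d3, d4, d5, d6⟩ =>
    C0.adm_of_lt hN hp hpq hpq1 hγ₁ hγ₁₂ hdim d1 d2 d3 d4 d5 d6
  by_cases hne : S.Nonempty
  swap
  · refine ⟨1, one_pos, fun δ d3 d4 d5 d2 d6 => (hne ?_).elim⟩
    have hU : 0 < min 1 ((N : ℝ) * (p * q - 1) / (2 * q * (p + 1))) := by positivity
    have hU' : max δ 0 < min 1 ((N : ℝ) * (p * q - 1) / (2 * q * (p + 1))) :=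
      max_lt (lt_min d2 d6) hU
    obtain ⟨z, hz1, hz2⟩ := exists_between hU'
    have hz3 : δ < z := (le_max_left _ _).trans_lt hz1
    exact ⟨z, (le_max_right _ _).trans_lt hz1, hz2.trans_le (min_le_left _ _), d3.trans hz3,
      d4.trans hz3, d5.trans hz3, hz2.trans_le (min_le_right _ _)⟩
  obtain ⟨δ₁, hδ₁⟩ := hne
  have a1 := hadm δ₁ hδ₁
  have hδ₁0 : 0 < δ₁ := a1.pos
  have hκ₁ : p * (2 * (δ₁ * K₂) / N) ≤ 1 := by
    rw [show p * (2 * (δ₁ * K₂) / N) = p * (δ₁ * K₂) / (N / 2) by field_simp]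
    exact (div_le_one (by positivity)).2 a1.hpk.le
  have hκ₂ : q * (2 * (δ₁ * K₁) / N) ≤ 1 := by
    rw [show q * (2 * (δ₁ * K₁) / N) = q * (δ₁ * K₁) / (N / 2) by field_simp]
    exact (div_le_one (by positivity)).2 a1.hqk.le
  have hda : (N : ℝ) / 2 * (2 * (δ₁ * K₁) / N) + (1 - δ₁) * A / γ₁ ≤ N / 2 := by
    rw [show (N : ℝ) / 2 * (2 * (δ₁ * K₁) / N) + (1 - δ₁) * A / γ₁ =
      (γ₁ * (δ₁ * K₁) + (1 - δ₁) * A) / γ₁ by field_simp, div_le_iff₀ hγ₁]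
    linarith [a1.hda]
  have hdb : (N : ℝ) / 2 * (2 * (δ₁ * K₂) / N) + (1 - δ₁) * B / γ₂ ≤ N / 2 := by
    rw [show (N : ℝ) / 2 * (2 * (δ₁ * K₂) / N) + (1 - δ₁) * B / γ₂ =
      (γ₂ * (δ₁ * K₂) + (1 - δ₁) * B) / γ₂ by field_simp, div_le_iff₀ hγ₂0]
    linarith [a1.hdb]
  have hx : (N : ℝ) / 2 * (p * (2 * (δ₁ * K₂) / N) - 2 * (δ₁ * K₁) / N) = δ₁ := by
    rw [show (N : ℝ) / 2 * (p * (2 * (δ₁ * K₂) / N) - 2 * (δ₁ * K₁) / N) =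
      δ₁ * (p * K₂ - K₁) by field_simp, r1, mul_one]
  have hx' : (N : ℝ) / 2 * (q * (2 * (δ₁ * K₁) / N) - 2 * (δ₁ * K₂) / N) = δ₁ := by
    rw [show (N : ℝ) / 2 * (q * (2 * (δ₁ * K₁) / N) - 2 * (δ₁ * K₂) / N) =
      δ₁ * (q * K₁ - K₂) by field_simp, r2, mul_one]
  obtain ⟨ε₀, hε₀, H⟩ := C0.exists_system_solution hN hγ₁ (hγ₁₂.trans_lt hγ₂) hγ₂0 hγ₂ hf hp hg hq1
    hx hx' a1.pos.le a1.lt_one (by positivity) (by positivity) hκ₁ hκ₂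
    (mul_pos (by linarith [a1.lt_one]) hA0) (mul_pos (by linarith [a1.lt_one]) hB0) a1.hpb a1.hqa
    (by linear_combination -(1 - δ₁) * r3) (by linear_combination -(1 - δ₁) * r4) a1.haγ a1.hbγ
    hda hdb
  refine ⟨ε₀, hε₀, fun δ d3 d4 d5 d2 d6 s₁ s₂ hs₁ hs₂ u₀ v₀ _ _ hdata => ?_⟩
  have hu₁ : C0.nrm 1 u₀ ≤ ENNReal.ofReal ε₀ := by
    simp only [C0.nrm, ENNReal.ofReal_one, inv_one]
    exact ((le_self_add.trans le_self_add).trans le_self_add).trans hdata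
  have hv₁ : C0.nrm 1 v₀ ≤ ENNReal.ofReal ε₀ := by
    simp only [C0.nrm, ENNReal.ofReal_one, inv_one]
    exact (le_add_self.trans le_self_add).trans hdata
  have hu₀ : ‖u₀‖ ≤ ε₀ := C0.norm_le_of_nrm_zero_le hε₀.le <| by
    rw [C0.nrm_zero_left]
    exact ((le_add_self.trans le_self_add).trans le_self_add).trans hdata
  have hv₀ : ‖v₀‖ ≤ ε₀ := C0.norm_le_of_nrm_zero_le hε₀.le <| by
    rw [C0.nrm_zero_left]
    exact le_add_self.trans hdata
  obtain ⟨u, v, K, Hu, Hv, hu, hv⟩ := H u₀ v₀ hu₀ hu₁ hv₀ hv₁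
  have hs₁' : 1 / s₁ = 2 * (δ * K₁) / N := by rw [hs₁, hK₁, hc]; field_simp
  have hs₂' : 1 / s₂ = 2 * (δ * K₂) / N := by rw [hs₂, hK₂, hc]; field_simp
  have hA' : (1 - δ) * (γ₁ + p * γ₂) / (p * q - 1) = (1 - δ) * A := by
    rw [hA, hc]; field_simp
  have hB' : (1 - δ) * (γ₂ + q * γ₁) / (p * q - 1) = (1 - δ) * B := by
    rw [hB, hc]; field_simp
  have hmain : ∃ C, 0 ≤ C ∧ ∀ t : ℝ, 0 ≤ t →
      eLpNorm (u t) (ENNReal.ofReal s₁) volume ≤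
        ENNReal.ofReal (C * (1 + t) ^ (-((1 - δ) * A))) ∧
      eLpNorm (v t) (ENNReal.ofReal s₂) volume ≤
        ENNReal.ofReal (C * (1 + t) ^ (-((1 - δ) * B))) := by
    rcases le_or_gt δ 0 with hδ | hδ
    · refine ⟨0, le_rfl, fun t _ => ⟨?_, ?_⟩⟩
      · rw [C0.eLpNorm_eq_zero_of_exponent_nonpos (u t) (div_nonpos_of_nonpos_of_nonneg
          (by linarith [mul_nonpos_of_nonpos_of_nonneg hδ hK₁0.le]) hN0.le) hs₁']
        exact zero_le
      · rw [C0.eLpNorm_eq_zero_of_exponent_nonpos (v t) (div_nonpos_of_nonpos_of_nonneg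
          (by linarith [mul_nonpos_of_nonpos_of_nonneg hδ hK₂0.le]) hN0.le) hs₂']
        exact zero_le
    · obtain ⟨⟨R₁, h₁⟩, R₂, h₂⟩ := C0.Decay.propagate hN hγ₁ hγ₁₂ hγ₂ hf hp hg hq1.le hc0.le
        r1 r2 r3 r4 hK₁ hK₂ hA hB hA0 hB0 hK₁0 hK₂0 hu₀ hu₁ hv₀ hv₁ hu hv hS hadm hδ₁
        (⟨hδ, d2, d3, d4, d5, d6⟩ : δ ∈ S) ⟨⟨K, Hu⟩, K, Hv⟩
      refine ⟨max R₁ R₂, h₁.nonneg.trans (le_max_left _ _), fun t ht => ⟨?_, ?_⟩⟩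
      · exact (h₁.mono (le_max_left _ R₂)).eLpNorm_le (by positivity) hs₁' ht
      · exact (h₂.mono (le_max_right R₁ _)).eLpNorm_le (by positivity) hs₂' ht
  obtain ⟨C, hC0, hC⟩ := hmain
  have hdecay : ∀ {t r : ℝ}, 0 ≤ t → 0 < r → (1 + t) ^ (-((1 - δ) * r)) ≤ 1 := fun ht hr =>
    Real.rpow_le_one_of_one_le_of_nonpos (by linarith)
      (neg_nonpos.2 (mul_pos (by linarith) hr).le)
  refine ⟨u, v, C0.isMildSolution_of_eq_duhamelMap hγ₁ (hγ₁₂.trans_lt hγ₂) hγ₂0 hγ₂ hf hp hg hq1.le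
    Hu Hv hu hv, ⟨max K C, fun t ht => ⟨?_, ?_, ?_, ?_⟩⟩, C + 1, by linarith, fun t ht => ⟨?_, ?_⟩⟩
  · rw [← C0.nrm_zero_left]
    exact C0.nrm_zero_le ((Hu.norm_le t).trans (le_max_left _ _))
  · exact (hC t ht).1.trans (ENNReal.ofReal_le_ofReal
      ((mul_le_of_le_one_right hC0 (hdecay ht hA0)).trans (le_max_right _ _)))
  · rw [← C0.nrm_zero_left]
    exact C0.nrm_zero_le ((Hv.norm_le t).trans (le_max_left _ _))
  · exact (hC t ht).2.trans (ENNReal.ofReal_le_ofReal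
      ((mul_le_of_le_one_right hC0 (hdecay ht hB0)).trans (le_max_right _ _)))
  · rw [hA']
    refine (hC t ht).1.trans (ENNReal.ofReal_le_ofReal ?_)
    exact mul_le_mul_of_nonneg_right (by linarith) (Real.rpow_nonneg (by linarith) _)
  · rw [hB']
    refine (hC t ht).2.trans (ENNReal.ofReal_le_ofReal ?_)
    exact mul_le_mul_of_nonneg_right (by linarith) (Real.rpow_nonneg (by linarith) _)

end
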